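/- arXiv:1712.06218 — 2 statements merged into one kernel-verified Lean document; each statement's English description precedes it below -/
import Mathlib

section
/- Subadditivity of the Dirichlet energy: if Ω₁ and Ω₂ are disjoint, open, simply connected subsets of ℝ², then for every α ∈ [0,1] and all integers N₁, N₂ ≥ 1, E^D_{N₁+N₂}(α; Ω₁ ∪ Ω₂) ≤ E^D_{N₁}(α; Ω₁) + E^D_{N₂}(α; Ω₂). -/
noncomputable section

open MeasureTheory Real Set
open scoped BigOperators Topology

/-- The plane `ℝ²`, with points written as pairs. -/
abbrev Plane : Type := ℝ × ℝ

/-- Configuration space of `N` particles in the plane. -/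
abbrev Config (N : ℕ) : Type := Fin N → Plane

/-- `x^{-⊥} := (-y, x)/(x² + y²)` for `x = (x, y) ∈ ℝ²`. -/
def perpInv (v : Plane) : Plane :=
  (-v.2 / (v.1 ^ 2 + v.2 ^ 2), v.1 / (v.1 ^ 2 + v.2 ^ 2))

/-- The Aharonov–Bohm potential `A_j(x) = ∑_{k ≠ j} (x_j - x_k)^{-⊥}`. -/
def abPot (N : ℕ) (j : Fin N) (x : Config N) : Plane :=
  ∑ k ∈ Finset.univ.erase j, perpInv (x j - x k)

/-- Partial derivative of `Ψ` at `x` in direction `v` of the `j`-th particle. -/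
def pder (N : ℕ) (j : Fin N) (v : Plane) (Ψ : Config N → ℂ) (x : Config N) : ℂ :=
  fderiv ℝ Ψ x (Pi.single j v)

/-- The two components of `D_j Ψ = -i ∇_{x_j} Ψ + α A_j Ψ` at `x`. -/
def DOp (N : ℕ) (α : ℝ) (j : Fin N) (Ψ : Config N → ℂ) (x : Config N) : ℂ × ℂ :=
  (-Complex.I * pder N j (1, 0) Ψ x + Complex.ofReal (α * (abPot N j x).1) * Ψ x,
   -Complex.I * pder N j (0, 1) Ψ x + Complex.ofReal (α * (abPot N j x).2) * Ψ x)

/-- `|D_j Ψ(x)|²`, the squared Euclidean norm of the vector `D_j Ψ(x) ∈ ℂ²`. -/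
def DSq (N : ℕ) (α : ℝ) (j : Fin N) (Ψ : Config N → ℂ) (x : Config N) : ℝ :=
  ‖(DOp N α j Ψ x).1‖ ^ 2 + ‖(DOp N α j Ψ x).2‖ ^ 2

/-- The diagonal set `{x : x_j = x_k for some j ≠ k}`. -/
def diagSet (N : ℕ) : Set (Config N) := {x | ∃ j k : Fin N, j ≠ k ∧ x j = x k}

/-- Admissible wave functions: smooth, symmetric, vanishing on a neighbourhood of
the diagonal set. -/
structure Admissible (N : ℕ) (Ψ : Config N → ℂ) : Prop where
  smooth : ContDiff ℝ (⊤ : ℕ∞) Ψ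
  symm : ∀ (σ : Equiv.Perm (Fin N)) (x : Config N), Ψ (x ∘ σ) = Ψ x
  vanishes : ∃ U : Set (Config N), IsOpen U ∧ diagSet N ⊆ U ∧ ∀ x ∈ U, Ψ x = 0

/-- `Ω^N` as a subset of configuration space. -/
def cube (N : ℕ) (Ω : Set Plane) : Set (Config N) := Set.univ.pi fun _ => Ω

/-- Total kinetic energy `∑_j ∫_{Ω^N} |D_j Ψ|²`. -/
def kinE (N : ℕ) (α : ℝ) (Ω : Set Plane) (Ψ : Config N → ℂ) : ℝ :=
  ∑ j, ∫ x in cube N Ω, DSq N α j Ψ x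

/-- `∫_{Ω^N} |Ψ|²`. -/
def normSq (N : ℕ) (Ω : Set Plane) (Ψ : Config N → ℂ) : ℝ :=
  ∫ x in cube N Ω, ‖Ψ x‖ ^ 2

/-- Neumann ground-state energy of `N` anyons with statistics parameter `α` on `Ω`,
with the convention that it is `0` for `N = 0`. -/
def neumannE (N : ℕ) (α : ℝ) (Ω : Set Plane) : ℝ :=
  if N = 0 then 0 else
    sInf {E | ∃ Ψ : Config N → ℂ, Admissible N Ψ ∧ normSq N Ω Ψ = 1 ∧ E = kinE N α Ω Ψ}

/-- Dirichlet ground-state energy of `N` anyons with statistics parameter `α` on `Ω`. -/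
def dirichletE (N : ℕ) (α : ℝ) (Ω : Set Plane) : ℝ :=
  sInf {E | ∃ Ψ : Config N → ℂ, Admissible N Ψ ∧ IsCompact (tsupport Ψ) ∧
    tsupport Ψ ⊆ cube N Ω ∧ normSq N Ω Ψ = 1 ∧ E = kinE N α Ω Ψ}

/-- The open unit square `Q₀ = (0,1)²`. -/
def Q0 : Set Plane := Set.Ioo (0 : ℝ) 1 ×ˢ Set.Ioo (0 : ℝ) 1

/-- `E^N_N(α)`, the Neumann energy on the unit square. -/
def EN (N : ℕ) (α : ℝ) : ℝ := neumannE N α Q0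

/-- `E^D_N(α)`, the Dirichlet energy on the unit square. -/
def ED (N : ℕ) (α : ℝ) : ℝ := dirichletE N α Q0

/-- One-particle density `ρ_Ψ` of a wave function of `n+1` particles. -/
def density (n : ℕ) (Ψ : Config (n + 1) → ℂ) (y : Plane) : ℝ :=
  (n + 1) * ∫ z : Config n, ‖Ψ (Fin.cons y z)‖ ^ 2


lemma sc_prod {X Y : Type*} [TopologicalSpace X] [TopologicalSpace Y]
    [SimplyConnectedSpace X] [SimplyConnectedSpace Y] : SimplyConnectedSpace (X × Y) := by
  rw [simply_connected_iff_paths_homotopic]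
  refine ⟨inferInstance, ?_⟩
  rintro ⟨a, b⟩ ⟨c, d⟩
  refine ⟨fun p q => ?_⟩
  rw [← Path.Homotopic.prod_projLeft_projRight p, ← Path.Homotopic.prod_projLeft_projRight q]
  congr 1 <;> exact Subsingleton.elim _ _

/-- The difference of two plane points as a complex number. -/
def dC : (Plane × Plane) →L[ℝ] ℂ :=
  Complex.equivRealProdCLM.symm.toContinuousLinearMap.comp
    (ContinuousLinearMap.fst ℝ Plane Plane - ContinuousLinearMap.snd ℝ Plane Plane)

lemma dC_apply (p : Plane × Plane) : dC p = ⟨p.1.1 - p.2.1, p.1.2 - p.2.2⟩ := by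
  apply Complex.ext <;> simp [dC]

lemma exists_theta (Ω₁ Ω₂ : Set Plane)
    (h₁o : IsOpen Ω₁) (h₂o : IsOpen Ω₂) (hdisj : Disjoint Ω₁ Ω₂)
    (h₁sc : SimplyConnectedSpace Ω₁) (h₂sc : SimplyConnectedSpace Ω₂) :
    ∃ θ : Plane × Plane → ℝ, ∀ p ∈ Ω₁ ×ˢ Ω₂, ContDiffAt ℝ (⊤ : ℕ∞) θ p ∧
      ∀ v w : Plane, fderiv ℝ θ p (v, w) =
        (perpInv (p.1 - p.2)).1 * (v.1 - w.1) + (perpInv (p.1 - p.2)).2 * (v.2 - w.2) := by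
  have hsc : IsSimplyConnected (Ω₁ ×ˢ Ω₂) := by
    have : SimplyConnectedSpace (Ω₁ × Ω₂) := sc_prod
    exact (Homeomorph.Set.prod Ω₁ Ω₂).toHomotopyEquiv.simplyConnectedSpace
  have hopen : IsOpen (Ω₁ ×ˢ Ω₂) := h₁o.prod h₂o
  have hne : ∀ p ∈ Ω₁ ×ˢ Ω₂, dC p ≠ 0 := by
    rintro ⟨a, b⟩ ⟨ha, hb⟩ h
    rw [dC_apply] at h
    have h1 := congrArg Complex.re h
    have h2 := congrArg Complex.im h
    simp at h1 h2
    have : a = b := Prod.ext (by linarith) (by linarith)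
    subst this
    exact Set.disjoint_left.1 hdisj ha hb
  obtain ⟨f, hfc, hfe⟩ := Complex.exists_continuousOn_eqOn_exp_comp hsc hopen
    (g := fun p => dC p) dC.continuous.continuousOn (by rintro ⟨p, hp, h⟩; exact hne p hp h)
  refine ⟨fun p => (f p).im, fun p hp => ?_⟩
  have hev : f =ᶠ[𝓝 p] fun q => f p + Complex.log (dC q / dC p) := by
    have h1 : ∀ᶠ q in 𝓝 p, q ∈ Ω₁ ×ˢ Ω₂ := hopen.mem_nhds hp
    have h2 : ∀ᶠ q in 𝓝 p, ‖f q - f p‖ < π := by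
      have hc := (hfc.continuousAt (hopen.mem_nhds hp))
      have : Filter.Tendsto (fun q => ‖f q - f p‖) (𝓝 p) (𝓝 0) := by
        simpa using (hc.sub (continuousAt_const (y := f p))).norm.tendsto
      exact this.eventually (gt_mem_nhds pi_pos)
    filter_upwards [h1, h2] with q hq hq2
    have e1 : Complex.exp (f q) = dC q := hfe hq
    have e2 : Complex.exp (f p) = dC p := hfe hp
    rw [← e1, ← e2, ← Complex.exp_sub, Complex.log_exp]
    · ring
    · have := (abs_le.1 (Complex.abs_im_le_norm (f q - f p))).1; linarith
    · have := (abs_le.1 (Complex.abs_im_le_norm (f q - f p))).2; linarith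
  have hsl : dC p / dC p ∈ Complex.slitPlane := by rw [div_self (hne p hp)]; simp
  have hfd : HasFDerivAt f ((dC p)⁻¹ • dC) p := by
    have h1 : HasFDerivAt (fun q => dC q / dC p) ((dC p)⁻¹ • dC) p := by
      simp only [div_eq_inv_mul]
      exact dC.hasFDerivAt.const_mul _
    have hl : HasFDerivAt Complex.log (1 : ℂ →L[ℝ] ℂ) (dC p / dC p) := by
      have := (Complex.hasDerivAt_log hsl).complexToReal_fderiv
      rw [div_self (hne p hp)] at this ⊢
      simpa using this
    have h2 := (HasFDerivAt.comp p hl h1).const_add (f p)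
    exact h2.congr_of_eventuallyEq hev
  have hcd : ContDiffAt ℝ (⊤ : ℕ∞) f p := by
    refine ContDiffAt.congr_of_eventuallyEq ?_ hev
    refine contDiffAt_const.add ?_
    have hlog : ContDiffAt ℝ (⊤ : ℕ∞) Complex.log (dC p / dC p) :=
      (Complex.contDiffAt_log hsl).restrict_scalars ℝ
    have hq : ContDiffAt ℝ (⊤ : ℕ∞) (fun q => dC q / dC p) p := by
      simp only [div_eq_inv_mul]
      exact contDiffAt_const.mul dC.contDiff.contDiffAt
    exact hlog.comp p hq
  refine ⟨Complex.imCLM.contDiff.contDiffAt.comp p hcd, fun v w => ?_⟩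
  have := (Complex.imCLM.hasFDerivAt.comp p hfd).fderiv
  have h3 : fderiv ℝ (fun p => (f p).im) p = Complex.imCLM.comp ((dC p)⁻¹ • dC) := this
  rw [h3]
  have hn : (p.1.1 - p.2.1) * (p.1.1 - p.2.1) + (p.1.2 - p.2.2) * (p.1.2 - p.2.2) ≠ 0 := by
    have := hne p hp
    rw [← Complex.normSq_pos, dC_apply, Complex.normSq_mk] at this
    exact this.ne'
  have hn' : (p.1.1 - p.2.1)^2 + (p.1.2 - p.2.2)^2 ≠ 0 := by
    intro h; apply hn; linarith
  simp [dC_apply, perpInv, Complex.inv_re, Complex.inv_im, Complex.normSq_mk]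
  field_simp
  ring


lemma DSq_congr {N : ℕ} {α : ℝ} {j : Fin N} {Ψ Φ : Config N → ℂ} {x : Config N}
    (h : Ψ =ᶠ[𝓝 x] Φ) : DSq N α j Ψ x = DSq N α j Φ x := by
  simp only [DSq, DOp, pder, h.fderiv_eq, h.eq_of_nhds]

lemma DSq_zero {N : ℕ} {α : ℝ} {j : Fin N} {x : Config N} :
    DSq N α j (fun _ => 0) x = 0 := by
  simp [DSq, DOp, pder]

lemma DSq_eq_zero {N : ℕ} {α : ℝ} {j : Fin N} {Ψ : Config N → ℂ} {x : Config N}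
    (h : x ∉ tsupport Ψ) : DSq N α j Ψ x = 0 := by
  rw [notMem_tsupport_iff_eventuallyEq] at h
  rw [DSq_congr h]
  exact DSq_zero

lemma DSq_nonneg {N : ℕ} {α : ℝ} {j : Fin N} {Ψ : Config N → ℂ} {x : Config N} :
    0 ≤ DSq N α j Ψ x := by
  unfold DSq; positivity

lemma DSq_const_mul {N : ℕ} {α : ℝ} {j : Fin N} {Ψ : Config N → ℂ} {x : Config N} (c : ℂ)
    (h : DifferentiableAt ℝ Ψ x) :
    DSq N α j (fun y => c * Ψ y) x = ‖c‖ ^ 2 * DSq N α j Ψ x := by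
  have e : fderiv ℝ (fun y => c * Ψ y) x = c • fderiv ℝ Ψ x := fderiv_const_mul h c
  have e1 : ∀ v, pder N j v (fun y => c * Ψ y) x = c * pder N j v Ψ x := by
    intro v; simp [pder, e]
  simp only [DSq, DOp, e1]
  rw [show ∀ a b : ℂ, -Complex.I * (c * a) + b * (c * Ψ x) = c * (-Complex.I * a + b * Ψ x) from
    fun a b => by ring, show ∀ a b : ℂ, -Complex.I * (c * a) + b * (c * Ψ x)
      = c * (-Complex.I * a + b * Ψ x) from fun a b => by ring, norm_mul, norm_mul]
  ring

lemma tsupport_diag {N : ℕ} {Ψ : Config N → ℂ} (h : Admissible N Ψ) {x : Config N}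
    (hx : x ∈ tsupport Ψ) : x ∉ diagSet N := by
  obtain ⟨U, hU, hd, hz⟩ := h.vanishes
  intro hxd
  have : x ∉ tsupport Ψ := by
    rw [notMem_tsupport_iff_eventuallyEq]
    filter_upwards [hU.mem_nhds (hd hxd)] with y hy using hz y hy
  exact this hx

lemma perpInv_contAt {v : Plane} (hv : v ≠ 0) : ContinuousAt perpInv v := by
  have : v.1 ^ 2 + v.2 ^ 2 ≠ 0 := by
    intro h
    apply hv
    have h1 : v.1 = 0 := by nlinarith [sq_nonneg v.1, sq_nonneg v.2]
    have h2 : v.2 = 0 := by nlinarith [sq_nonneg v.1, sq_nonneg v.2]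
    exact Prod.ext h1 h2
  unfold perpInv
  fun_prop (disch := assumption)

lemma abPot_contAt {N : ℕ} (j : Fin N) {x : Config N} (hx : x ∉ diagSet N) :
    ContinuousAt (abPot N j) x := by
  unfold abPot
  refine tendsto_finsetSum _ fun k hk => ?_
  have hne : x j - x k ≠ 0 := by
    intro h
    exact hx ⟨j, k, (Finset.ne_of_mem_erase hk).symm, sub_eq_zero.1 h⟩
  have h2 : ContinuousAt (fun y : Config N => y j - y k) x := by fun_prop
  exact ContinuousAt.comp (g := perpInv) (f := fun y : Config N => y j - y k)
    (perpInv_contAt hne) h2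

lemma DSq_continuous {N : ℕ} {α : ℝ} {j : Fin N} {Ψ : Config N → ℂ} (h : Admissible N Ψ) :
    Continuous (DSq N α j Ψ) := by
  rw [continuous_iff_continuousAt]
  intro x
  by_cases hx : x ∈ tsupport Ψ
  · have hA := abPot_contAt j (tsupport_diag h hx)
    have hf : Continuous (fderiv ℝ Ψ) := h.smooth.continuous_fderiv (by simp)
    have hΨ : Continuous Ψ := h.smooth.continuous
    have hp : ∀ v, Continuous (pder N j v Ψ) := fun v => by unfold pder; fun_prop
    have h1 := hp (1, 0)
    have h2 := hp (0, 1)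
    have hA1 : ContinuousAt (fun y => (((α * (abPot N j y).1 : ℝ)) : ℂ)) x :=
      Complex.continuous_ofReal.continuousAt.comp (continuousAt_const.mul hA.fst)
    have hA2 : ContinuousAt (fun y => (((α * (abPot N j y).2 : ℝ)) : ℂ)) x :=
      Complex.continuous_ofReal.continuousAt.comp (continuousAt_const.mul hA.snd)
    have g1 : ContinuousAt (fun y => -Complex.I * pder N j (1, 0) Ψ y
        + Complex.ofReal (α * (abPot N j y).1) * Ψ y) x :=
      (continuousAt_const.mul h1.continuousAt).add (hA1.mul hΨ.continuousAt)
    have g2 : ContinuousAt (fun y => -Complex.I * pder N j (0, 1) Ψ y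
        + Complex.ofReal (α * (abPot N j y).2) * Ψ y) x :=
      (continuousAt_const.mul h2.continuousAt).add (hA2.mul hΨ.continuousAt)
    exact (g1.norm.pow 2).add (g2.norm.pow 2)
  · have : DSq N α j Ψ =ᶠ[𝓝 x] fun _ => 0 := by
      filter_upwards [(isClosed_tsupport Ψ).isOpen_compl.mem_nhds hx] with y hy
      exact DSq_eq_zero hy
    exact continuousAt_const.congr this.symm

lemma DSq_integrable {N : ℕ} {α : ℝ} {j : Fin N} {Ψ : Config N → ℂ} (h : Admissible N Ψ)
    (hc : IsCompact (tsupport Ψ)) : Integrable (DSq N α j Ψ) :=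
  (DSq_continuous h).integrable_of_hasCompactSupport
    (HasCompactSupport.intro hc fun _ hx => DSq_eq_zero hx)

lemma sq_integrable {N : ℕ} {Ψ : Config N → ℂ} (h : Admissible N Ψ)
    (hc : IsCompact (tsupport Ψ)) : Integrable (fun x => ‖Ψ x‖ ^ 2) := by
  have := h.smooth.continuous
  refine Continuous.integrable_of_hasCompactSupport (by fun_prop)
    (HasCompactSupport.intro hc fun x hx => ?_)
  simp [image_eq_zero_of_notMem_tsupport hx]

lemma kinE_eq {N : ℕ} {α : ℝ} {Ω : Set Plane} {Ψ : Config N → ℂ} (hs : tsupport Ψ ⊆ cube N Ω) :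
    kinE N α Ω Ψ = ∑ j, ∫ x, DSq N α j Ψ x := by
  refine Finset.sum_congr rfl fun j _ => ?_
  exact setIntegral_eq_integral_of_forall_compl_eq_zero fun x hx => DSq_eq_zero fun h => hx (hs h)

lemma normSq_eq {N : ℕ} {Ω : Set Plane} {Ψ : Config N → ℂ} (hs : tsupport Ψ ⊆ cube N Ω) :
    normSq N Ω Ψ = ∫ x, ‖Ψ x‖ ^ 2 := by
  refine setIntegral_eq_integral_of_forall_compl_eq_zero fun x hx => ?_
  simp [image_eq_zero_of_notMem_tsupport fun h => hx (hs h)]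

lemma kinE_nonneg {N : ℕ} {α : ℝ} {Ω : Set Plane} {Ψ : Config N → ℂ} : 0 ≤ kinE N α Ω Ψ :=
  Finset.sum_nonneg fun _ _ => integral_nonneg fun _ => DSq_nonneg

/-- The set of Dirichlet energies. -/
def dSet (N : ℕ) (α : ℝ) (Ω : Set Plane) : Set ℝ :=
  {E | ∃ Ψ : Config N → ℂ, Admissible N Ψ ∧ IsCompact (tsupport Ψ) ∧
    tsupport Ψ ⊆ cube N Ω ∧ normSq N Ω Ψ = 1 ∧ E = kinE N α Ω Ψ}

lemma dSet_bdd (N : ℕ) (α : ℝ) (Ω : Set Plane) : BddBelow (dSet N α Ω) := by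
  refine ⟨0, ?_⟩
  rintro E ⟨Ψ, -, -, -, -, rfl⟩
  exact kinE_nonneg

lemma mem_dSet {N : ℕ} {α : ℝ} {Ω : Set Plane} {Ψ : Config N → ℂ} (h : Admissible N Ψ)
    (hc : IsCompact (tsupport Ψ)) (hs : tsupport Ψ ⊆ cube N Ω) (hn : 0 < normSq N Ω Ψ) :
    kinE N α Ω Ψ / normSq N Ω Ψ ∈ dSet N α Ω := by
  set n := normSq N Ω Ψ with hndef
  set c : ℂ := Complex.ofReal (√n)⁻¹ with hcdef
  have hcn : ‖c‖ ^ 2 = n⁻¹ := by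
    rw [hcdef, Complex.norm_real, norm_eq_abs, sq_abs, inv_pow, sq_sqrt hn.le]
  have hts : tsupport (fun y => c * Ψ y) ⊆ tsupport Ψ :=
    closure_mono (by intro x hx; simp only [Function.mem_support] at *; exact right_ne_zero_of_mul hx)
  refine ⟨fun y => c * Ψ y, ⟨contDiff_const.mul h.smooth, fun σ x => by rw [h.symm], ?_⟩,
    hc.of_isClosed_subset (isClosed_tsupport _) hts, hts.trans hs, ?_, ?_⟩
  · obtain ⟨U, h1, h2, h3⟩ := h.vanishes
    exact ⟨U, h1, h2, fun x hx => by simp [h3 x hx]⟩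
  · have : normSq N Ω (fun y => c * Ψ y) = n⁻¹ * n := by
      simp only [normSq, norm_mul, mul_pow, hcn]
      rw [integral_const_mul]
      rfl
    rw [this, inv_mul_cancel₀ hn.ne']
  · simp only [kinE]
    rw [Finset.sum_div]
    refine Finset.sum_congr rfl fun j _ => ?_
    rw [div_eq_inv_mul, ← integral_const_mul]
    congr 1
    ext x
    rw [DSq_const_mul c (h.smooth.differentiable (by simp) x), hcn]

lemma abPot_perm {N : ℕ} (j : Fin N) (σ : Equiv.Perm (Fin N)) (x : Config N) :
    abPot N j (x ∘ σ) = abPot N (σ j) x := by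
  unfold abPot
  refine Finset.sum_bij (fun k _ => σ k) ?_ ?_ ?_ ?_
  · intro a ha; simpa using ha
  · intro a _ b _ hab; exact σ.injective hab
  · intro b hb; exact ⟨σ.symm b, by
      simp only [Finset.mem_erase, Finset.mem_univ, and_true] at *
      intro h; apply hb; rw [← h]; simp, by simp⟩
  · intro a _; rfl

/-- Permuting coordinates as a continuous linear map. -/
def permL {N : ℕ} (σ : Equiv.Perm (Fin N)) : Config N →L[ℝ] Config N :=
  ContinuousLinearMap.pi fun i => ContinuousLinearMap.proj (σ i)

lemma permL_apply {N : ℕ} (σ : Equiv.Perm (Fin N)) (x : Config N) : permL σ x = x ∘ σ := rfl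

lemma DSq_perm {N : ℕ} {α : ℝ} {j : Fin N} {Ψ : Config N → ℂ} (h : Admissible N Ψ)
    (σ : Equiv.Perm (Fin N)) (x : Config N) : DSq N α j Ψ (x ∘ σ) = DSq N α (σ j) Ψ x := by
  have hp : ∀ v, pder N j v Ψ (x ∘ σ) = pder N (σ j) v Ψ x := by
    intro v
    unfold pder
    have e : Ψ = fun y => Ψ (permL σ y) := by ext y; rw [permL_apply, h.symm]
    have hd : HasFDerivAt (fun y => Ψ (permL σ y)) ((fderiv ℝ Ψ (x ∘ σ)).comp (permL σ)) x :=
      HasFDerivAt.comp x (f := permL σ)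
        ((h.smooth.differentiable (by simp) (x ∘ σ)).hasFDerivAt) (permL σ).hasFDerivAt
    rw [← e] at hd
    rw [hd.fderiv, ContinuousLinearMap.comp_apply, permL_apply]
    congr 1
    ext i : 1
    by_cases hi : i = j
    · subst hi; simp
    · simp [hi]
  simp only [DSq, DOp, hp, abPot_perm, h.symm]

/-- Symmetrization. -/
def symz (N : ℕ) (Φ : Config N → ℂ) (x : Config N) : ℂ := ∑ σ : Equiv.Perm (Fin N), Φ (x ∘ σ)

lemma symz_adm {N : ℕ} {Ω : Set Plane} {Φ : Config N → ℂ} (hΦ : ContDiff ℝ (⊤ : ℕ∞) Φ)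
    (hc : IsCompact (tsupport Φ)) (hs : tsupport Φ ⊆ cube N Ω) (hd : ∀ x ∈ tsupport Φ, x ∉ diagSet N) :
    Admissible N (symz N Φ) ∧ IsCompact (tsupport (symz N Φ)) ∧ tsupport (symz N Φ) ⊆ cube N Ω ∧
    ∀ x ∈ tsupport (symz N Φ), ∃ σ : Equiv.Perm (Fin N), x ∘ σ ∈ tsupport Φ := by
  set K : Set (Config N) := ⋃ σ : Equiv.Perm (Fin N), permL σ '' tsupport Φ with hK
  have hKc : IsCompact K := isCompact_iUnion fun σ => hc.image (permL σ).continuous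
  have hts : tsupport (symz N Φ) ⊆ K := by
    refine closure_minimal ?_ hKc.isClosed
    intro x hx
    obtain ⟨σ, -, hσ⟩ := Finset.exists_ne_zero_of_sum_ne_zero hx
    refine mem_iUnion.2 ⟨σ⁻¹, x ∘ σ, subset_tsupport _ hσ, ?_⟩
    ext i : 1
    simp [permL_apply]
  have hKcube : K ⊆ cube N Ω := by
    intro x hx
    obtain ⟨σ, y, hy, rfl⟩ := mem_iUnion.1 hx
    intro i _
    exact hs hy (σ i) (mem_univ _)
  have hKd : ∀ x ∈ K, x ∉ diagSet N := by
    intro x hx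
    obtain ⟨σ, y, hy, rfl⟩ := mem_iUnion.1 hx
    rintro ⟨j, k, hjk, h⟩
    exact hd y hy ⟨σ j, σ k, fun h => hjk (σ.injective h), h⟩
  refine ⟨⟨?_, ?_, ?_⟩, hKc.of_isClosed_subset (isClosed_tsupport _) hts, hts.trans hKcube,
    fun x hx => ?_⟩
  rotate_left 3
  · obtain ⟨σ, y, hy, rfl⟩ := mem_iUnion.1 (hts hx)
    refine ⟨σ⁻¹, ?_⟩
    convert hy using 1
    ext i : 1
    simp [permL_apply]
  · exact ContDiff.sum fun σ _ => hΦ.comp (permL σ).contDiff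
  · intro σ x
    unfold symz
    exact Fintype.sum_equiv (Equiv.mulLeft σ) _ _ fun τ => rfl
  · refine ⟨Kᶜ, hKc.isClosed.isOpen_compl, fun x hx hxK => hKd x hxK hx, fun x hx => ?_⟩
    exact image_eq_zero_of_notMem_tsupport fun h => hx (hts h)

lemma dSet_nonempty (N : ℕ) (α : ℝ) {Ω : Set Plane} (ho : IsOpen Ω) (hne : Ω.Nonempty) :
    (dSet N α Ω).Nonempty := by
  have hinf : Ω.Infinite := by
    obtain ⟨x, hx⟩ := hne
    exact infinite_of_mem_nhds x (ho.mem_nhds hx)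
  let p : Config N := fun i => hinf.natEmbedding Ω i
  have hpinj : Function.Injective p := fun i j h => by
    have := (hinf.natEmbedding Ω).injective (Subtype.ext h)
    exact Fin.ext this
  have hdc : IsClosed (diagSet N) := by
    have : diagSet N = ⋃ j : Fin N, ⋃ k : Fin N, {x | j ≠ k ∧ x j = x k} := by
      ext x; simp [diagSet]
    rw [this]
    refine isClosed_iUnion_of_finite fun j => isClosed_iUnion_of_finite fun k => ?_
    by_cases hjk : j = k
    · simp [hjk]
    · simp only [ne_eq, hjk, not_false_eq_true, true_and]
      exact isClosed_eq (continuous_apply j) (continuous_apply k)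
  have hco : IsOpen (cube N Ω) := isOpen_set_pi finite_univ fun _ _ => ho
  have hmem : cube N Ω ∩ (diagSet N)ᶜ ∈ 𝓝 p := by
    refine (hco.inter hdc.isOpen_compl).mem_nhds ⟨fun i _ => (hinf.natEmbedding Ω i).2, ?_⟩
    rintro ⟨j, k, hjk, h⟩
    exact hjk (hpinj h)
  obtain ⟨f, hfs, hfc, hfd, hfr, hfp⟩ := exists_contDiff_tsupport_subset (n := ⊤) hmem
  have hf0 : ∀ x, 0 ≤ f x := fun x => (hfr (mem_range_self x)).1
  let Φ : Config N → ℂ := fun x => (f x : ℂ)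
  have htΦ : tsupport Φ = tsupport f := by
    unfold tsupport; congr 1; ext x; simp [Φ]
  obtain ⟨h1, h2, h3, -⟩ := symz_adm (Ω := Ω) (Φ := Φ) (Complex.ofRealCLM.contDiff.comp hfd)
    (by rw [htΦ]; exact hfc) (by rw [htΦ]; exact fun x hx => (hfs hx).1)
    (by rw [htΦ]; exact fun x hx => (hfs hx).2)
  refine ⟨_, mem_dSet h1 h2 h3 ?_⟩
  rw [normSq_eq h3]
  have hcont := h1.smooth.continuous
  refine Continuous.integral_pos_of_hasCompactSupport_nonneg_nonzero (x := p) (by fun_prop)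
    (HasCompactSupport.intro h2 fun x hx => by simp [image_eq_zero_of_notMem_tsupport hx])
    (fun x => by positivity) ?_
  have : symz N Φ p = ((∑ σ : Equiv.Perm (Fin N), f (p ∘ σ) : ℝ) : ℂ) := by
    simp [symz, Φ]
  have hpos : 0 < ∑ σ : Equiv.Perm (Fin N), f (p ∘ σ) := by
    refine Finset.sum_pos' (fun σ _ => hf0 _) ⟨1, Finset.mem_univ _, ?_⟩
    simp [hfp]
  rw [this]
  simp only [Complex.norm_real]
  have := norm_pos_iff.2 hpos.ne'
  positivity


lemma mp_perm {N : ℕ} (σ : Equiv.Perm (Fin N)) :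
    MeasurePreserving (fun x : Config N => x ∘ σ) volume volume := by
  have := volume_measurePreserving_piCongrLeft (fun _ : Fin N => Plane) σ⁻¹
  convert this using 1
  ext x i : 2
  have := MeasurableEquiv.piCongrLeft_apply_apply (β := fun _ : Fin N => Plane) σ⁻¹ x (σ i)
  simp at this
  rw [Function.comp_apply, ← this]

lemma integral_perm {N : ℕ} (σ : Equiv.Perm (Fin N)) (g : Config N → ℝ) :
    ∫ x, g (x ∘ σ) = ∫ x, g x := by
  have hm : MeasurableEmbedding (fun x : Config N => x ∘ σ) := by
    have h : Continuous (fun x : Config N => x ∘ σ) := (permL σ).continuous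
    refine h.measurableEmbedding ?_
    intro x y hxy
    ext i : 1
    simpa using congrFun hxy (σ⁻¹ i)
  exact (mp_perm σ).integral_comp hm g

lemma integral_symm {N : ℕ} {C : Set (Config N)} (hC : MeasurableSet C)
    (H : Finset (Equiv.Perm (Fin N)))
    (hH : ∀ x ∈ C, ∀ σ : Equiv.Perm (Fin N), x ∘ σ ∈ C ↔ σ ∈ H)
    {g : Config N → ℝ} (hg : Integrable g) (hsym : ∀ (σ : Equiv.Perm (Fin N)) x, g (x ∘ σ) = g x)
    (hsupp : ∀ x, g x ≠ 0 → ∃ σ : Equiv.Perm (Fin N), x ∘ σ ∈ C) :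
    (H.card : ℝ) * ∫ x, g x = (N.factorial : ℝ) * ∫ x in C, g x := by
  classical
  have hpt : ∀ x, (H.card : ℝ) * g x = ∑ σ : Equiv.Perm (Fin N), C.indicator g (x ∘ σ) := by
    intro x
    by_cases h0 : g x = 0
    · rw [h0, mul_zero]
      symm
      refine Finset.sum_eq_zero fun σ _ => ?_
      rw [indicator_apply, hsym, h0, ite_self]
    · obtain ⟨τ, hτ⟩ := hsupp x h0
      have : ∀ σ : Equiv.Perm (Fin N), C.indicator g (x ∘ (τ * σ : Equiv.Perm (Fin N)))
          = if σ ∈ H then g x else 0 := by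
        intro σ
        have e := hH _ hτ σ
        have e2 : x ∘ (τ * σ : Equiv.Perm (Fin N)) = (x ∘ τ) ∘ σ := rfl
        rw [indicator_apply, hsym, e2]
        simp only [e]
      rw [← Fintype.sum_equiv (Equiv.mulLeft τ) (fun σ : Equiv.Perm (Fin N) =>
        C.indicator g (x ∘ (τ * σ : Equiv.Perm (Fin N)))) _ (fun σ => rfl)]
      rw [Finset.sum_congr rfl fun σ _ => this σ]
      simp
  have hi : ∀ σ : Equiv.Perm (Fin N), Integrable (fun x => C.indicator g (x ∘ σ)) := fun σ =>
    (mp_perm σ).integrable_comp_of_integrable (hg.indicator hC)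
  rw [← integral_const_mul]
  simp only [hpt]
  rw [integral_finsetSum _ fun σ _ => hi σ]
  simp only [integral_perm _ (C.indicator g), integral_indicator hC]
  simp [Fintype.card_perm]

/-- First-block projection. -/
def prj1 (N₁ N₂ : ℕ) : Config (N₁ + N₂) →L[ℝ] Config N₁ :=
  ContinuousLinearMap.pi fun i => ContinuousLinearMap.proj (Fin.castAdd N₂ i)
/-- Second-block projection. -/
def prj2 (N₁ N₂ : ℕ) : Config (N₁ + N₂) →L[ℝ] Config N₂ :=
  ContinuousLinearMap.pi fun i => ContinuousLinearMap.proj (Fin.natAdd N₁ i)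

lemma prj1_apply {N₁ N₂ : ℕ} (x : Config (N₁ + N₂)) (i) : prj1 N₁ N₂ x i = x (Fin.castAdd N₂ i) := rfl
lemma prj2_apply {N₁ N₂ : ℕ} (x : Config (N₁ + N₂)) (i) : prj2 N₁ N₂ x i = x (Fin.natAdd N₁ i) := rfl

lemma mp_prj (N₁ N₂ : ℕ) : MeasurePreserving
    (fun x : Config (N₁ + N₂) => (prj1 N₁ N₂ x, prj2 N₁ N₂ x)) volume volume := by
  have h1 := volume_measurePreserving_piCongrLeft (fun _ : Fin N₁ ⊕ Fin N₂ => Plane)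
    (finSumFinEquiv (m := N₁) (n := N₂)).symm
  have h2 := volume_measurePreserving_sumPiEquivProdPi (fun _ : Fin N₁ ⊕ Fin N₂ => Plane)
  convert h2.comp h1 using 1
  ext x : 1
  refine Prod.ext ?_ ?_
  · ext i : 1
    have := MeasurableEquiv.piCongrLeft_apply_apply (β := fun _ : Fin N₁ ⊕ Fin N₂ => Plane)
      (finSumFinEquiv (m := N₁) (n := N₂)).symm x (Fin.castAdd N₂ i)
    change x (Fin.castAdd N₂ i) = _
    rw [← this, finSumFinEquiv_symm_apply_castAdd]
    rfl
  · ext i : 1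
    have := MeasurableEquiv.piCongrLeft_apply_apply (β := fun _ : Fin N₁ ⊕ Fin N₂ => Plane)
      (finSumFinEquiv (m := N₁) (n := N₂)).symm x (Fin.natAdd N₁ i)
    change x (Fin.natAdd N₁ i) = _
    rw [← this, finSumFinEquiv_symm_apply_natAdd]
    rfl

/-- The block `Ω₁^{N₁} × Ω₂^{N₂}`. -/
def blk (N₁ N₂ : ℕ) (Ω₁ Ω₂ : Set Plane) : Set (Config (N₁ + N₂)) :=
  {x | prj1 N₁ N₂ x ∈ cube N₁ Ω₁ ∧ prj2 N₁ N₂ x ∈ cube N₂ Ω₂}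

lemma isOpen_cube (N : ℕ) {Ω : Set Plane} (h : IsOpen Ω) : IsOpen (cube N Ω) :=
  isOpen_set_pi finite_univ fun _ _ => h

lemma isOpen_blk (N₁ N₂ : ℕ) {Ω₁ Ω₂ : Set Plane} (h₁ : IsOpen Ω₁) (h₂ : IsOpen Ω₂) :
    IsOpen (blk N₁ N₂ Ω₁ Ω₂) :=
  ((isOpen_cube N₁ h₁).preimage (prj1 N₁ N₂).continuous).inter
    ((isOpen_cube N₂ h₂).preimage (prj2 N₁ N₂).continuous)

lemma integral_blk (N₁ N₂ : ℕ) (Ω₁ Ω₂ : Set Plane) (f : Config N₁ → ℝ) (g : Config N₂ → ℝ) :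
    ∫ x in blk N₁ N₂ Ω₁ Ω₂, f (prj1 N₁ N₂ x) * g (prj2 N₁ N₂ x) =
      (∫ y in cube N₁ Ω₁, f y) * ∫ z in cube N₂ Ω₂, g z := by
  have hm : MeasurableEmbedding (fun x : Config (N₁ + N₂) => (prj1 N₁ N₂ x, prj2 N₁ N₂ x)) := by
    have h : Continuous (fun x : Config (N₁ + N₂) => (prj1 N₁ N₂ x, prj2 N₁ N₂ x)) := by fun_prop
    refine h.measurableEmbedding ?_
    intro x y hxy
    have ha := congrArg Prod.fst hxy
    have hb := congrArg Prod.snd hxy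
    ext i : 1
    induction i using Fin.addCases with
    | left i => exact congrFun ha i
    | right i => exact congrFun hb i
  have := (mp_prj N₁ N₂).setIntegral_preimage_emb hm (fun p => f p.1 * g p.2)
    (cube N₁ Ω₁ ×ˢ cube N₂ Ω₂)
  rw [Measure.volume_eq_prod, setIntegral_prod_mul f g] at this
  exact this


lemma perm_split {N₁ N₂ : ℕ} (σ : Equiv.Perm (Fin (N₁ + N₂)))
    (h : ∀ i : Fin N₁, (σ (Fin.castAdd N₂ i)).val < N₁) :
    ∃ (σ₁ : Equiv.Perm (Fin N₁)) (σ₂ : Equiv.Perm (Fin N₂)),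
      (∀ i, σ (Fin.castAdd N₂ i) = Fin.castAdd N₂ (σ₁ i)) ∧
      (∀ k, σ (Fin.natAdd N₁ k) = Fin.natAdd N₁ (σ₂ k)) := by
  let τ : Equiv.Perm (Fin N₁ ⊕ Fin N₂) := (finSumFinEquiv.trans σ).trans finSumFinEquiv.symm
  have hτ : Set.MapsTo τ (Set.range Sum.inl) (Set.range Sum.inl) := by
    rintro _ ⟨i, rfl⟩
    refine ⟨⟨(σ (Fin.castAdd N₂ i)).val, h i⟩, ?_⟩
    rw [← finSumFinEquiv.injective.eq_iff]
    simp only [τ, Equiv.trans_apply, Equiv.apply_symm_apply, finSumFinEquiv_apply_left]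
    rfl
  obtain ⟨⟨σ₁, σ₂⟩, hs⟩ := Equiv.Perm.mem_sumCongrHom_range_of_perm_mapsTo_inl hτ
  refine ⟨σ₁, σ₂, fun i => ?_, fun k => ?_⟩
  · have := congrArg finSumFinEquiv (DFunLike.congr_fun hs (Sum.inl i))
    simpa [τ] using this.symm
  · have := congrArg finSumFinEquiv (DFunLike.congr_fun hs (Sum.inr k))
    simpa [τ] using this.symm

lemma perpInv_zero : perpInv 0 = 0 := by ext <;> simp [perpInv]

lemma perpInv_sub_comm (a b : Plane) : perpInv (a - b) = -perpInv (b - a) := by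
  have h : (a.1 - b.1) ^ 2 + (a.2 - b.2) ^ 2 = (b.1 - a.1) ^ 2 + (b.2 - a.2) ^ 2 := by ring
  ext <;> simp [perpInv, h] <;> ring

lemma abPot_eq (N : ℕ) (j : Fin N) (x : Config N) : abPot N j x = ∑ k, perpInv (x j - x k) := by
  unfold abPot
  rw [← Finset.add_sum_erase _ _ (Finset.mem_univ j), sub_self, perpInv_zero, zero_add]

lemma abPot_left {N₁ N₂ : ℕ} (i : Fin N₁) (x : Config (N₁ + N₂)) :
    abPot (N₁ + N₂) (Fin.castAdd N₂ i) x = abPot N₁ i (prj1 N₁ N₂ x) +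
      ∑ k : Fin N₂, perpInv (x (Fin.castAdd N₂ i) - x (Fin.natAdd N₁ k)) := by
  rw [abPot_eq, abPot_eq, Fin.sum_univ_add]
  rfl

lemma abPot_right {N₁ N₂ : ℕ} (k : Fin N₂) (x : Config (N₁ + N₂)) :
    abPot (N₁ + N₂) (Fin.natAdd N₁ k) x = abPot N₂ k (prj2 N₁ N₂ x) -
      ∑ i : Fin N₁, perpInv (x (Fin.castAdd N₂ i) - x (Fin.natAdd N₁ k)) := by
  rw [abPot_eq, abPot_eq, Fin.sum_univ_add, sub_eq_add_neg, ← Finset.sum_neg_distrib, add_comm]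
  congr 1
  exact Finset.sum_congr rfl fun i _ => perpInv_sub_comm _ _

/-- Projection to a pair of particles. -/
def prP {N₁ N₂ : ℕ} (i : Fin N₁) (k : Fin N₂) : Config (N₁ + N₂) →L[ℝ] Plane × Plane :=
  (ContinuousLinearMap.proj (Fin.castAdd N₂ i)).prod (ContinuousLinearMap.proj (Fin.natAdd N₁ k))

lemma prP_apply {N₁ N₂ : ℕ} (i : Fin N₁) (k : Fin N₂) (x : Config (N₁ + N₂)) :
    prP i k x = (x (Fin.castAdd N₂ i), x (Fin.natAdd N₁ k)) := rfl

/-- Total relative phase. -/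
def ph (N₁ N₂ : ℕ) (θ : Plane × Plane → ℝ) (x : Config (N₁ + N₂)) : ℝ :=
  ∑ i : Fin N₁, ∑ k : Fin N₂, θ (prP i k x)

/-- Gauge-transformed product function. -/
def gp (N₁ N₂ : ℕ) (α : ℝ) (θ : Plane × Plane → ℝ) (Ψ₁ : Config N₁ → ℂ) (Ψ₂ : Config N₂ → ℂ)
    (x : Config (N₁ + N₂)) : ℂ :=
  Complex.exp (-(Complex.I * α) * (ph N₁ N₂ θ x : ℂ)) * (Ψ₁ (prj1 N₁ N₂ x) * Ψ₂ (prj2 N₁ N₂ x))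

/-- The property of the phase function. -/
def IsPhase (Ω₁ Ω₂ : Set Plane) (θ : Plane × Plane → ℝ) : Prop :=
  ∀ p ∈ Ω₁ ×ˢ Ω₂, ContDiffAt ℝ (⊤ : ℕ∞) θ p ∧
      ∀ v w : Plane, fderiv ℝ θ p (v, w) =
        (perpInv (p.1 - p.2)).1 * (v.1 - w.1) + (perpInv (p.1 - p.2)).2 * (v.2 - w.2)

lemma blk_pair {N₁ N₂ : ℕ} {Ω₁ Ω₂ : Set Plane} {x : Config (N₁ + N₂)}
    (hx : x ∈ blk N₁ N₂ Ω₁ Ω₂) (i : Fin N₁) (k : Fin N₂) : prP i k x ∈ Ω₁ ×ˢ Ω₂ :=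
  ⟨hx.1 i (mem_univ _), hx.2 k (mem_univ _)⟩

lemma ph_contDiffAt {N₁ N₂ : ℕ} {Ω₁ Ω₂ : Set Plane} {θ : Plane × Plane → ℝ}
    (hθ : IsPhase Ω₁ Ω₂ θ) {x : Config (N₁ + N₂)} (hx : x ∈ blk N₁ N₂ Ω₁ Ω₂) :
    ContDiffAt ℝ (⊤ : ℕ∞) (ph N₁ N₂ θ) x :=
  ContDiffAt.sum fun i _ => ContDiffAt.sum fun k _ =>
    ContDiffAt.comp x (hθ _ (blk_pair hx i k)).1 (prP i k).contDiff.contDiffAt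

lemma ph_fderiv {N₁ N₂ : ℕ} {Ω₁ Ω₂ : Set Plane} {θ : Plane × Plane → ℝ}
    (hθ : IsPhase Ω₁ Ω₂ θ) {x : Config (N₁ + N₂)} (hx : x ∈ blk N₁ N₂ Ω₁ Ω₂)
    (h : Config (N₁ + N₂)) :
    fderiv ℝ (ph N₁ N₂ θ) x h = ∑ i : Fin N₁, ∑ k : Fin N₂,
      ((perpInv (x (Fin.castAdd N₂ i) - x (Fin.natAdd N₁ k))).1
          * ((h (Fin.castAdd N₂ i)).1 - (h (Fin.natAdd N₁ k)).1)
        + (perpInv (x (Fin.castAdd N₂ i) - x (Fin.natAdd N₁ k))).2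
          * ((h (Fin.castAdd N₂ i)).2 - (h (Fin.natAdd N₁ k)).2)) := by
  have hd : HasFDerivAt (ph N₁ N₂ θ)
      (∑ i : Fin N₁, ∑ k : Fin N₂, (fderiv ℝ θ (prP i k x)).comp (prP i k)) x := by
    refine HasFDerivAt.fun_sum fun i _ => HasFDerivAt.fun_sum fun k _ => ?_
    exact HasFDerivAt.comp x
      (((hθ _ (blk_pair hx i k)).1.differentiableAt (by simp)).hasFDerivAt) (prP i k).hasFDerivAt
  rw [hd.fderiv]
  simp only [_root_.sum_apply, ContinuousLinearMap.comp_apply]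
  refine Finset.sum_congr rfl fun i _ => Finset.sum_congr rfl fun k _ => ?_
  rw [prP_apply i k h, (hθ _ (blk_pair hx i k)).2]
  rfl

lemma gp_fderiv {N₁ N₂ : ℕ} {α : ℝ} {Ω₁ Ω₂ : Set Plane} {θ : Plane × Plane → ℝ}
    (hθ : IsPhase Ω₁ Ω₂ θ) {Ψ₁ : Config N₁ → ℂ} {Ψ₂ : Config N₂ → ℂ}
    (h1 : ContDiff ℝ (⊤ : ℕ∞) Ψ₁) (h2 : ContDiff ℝ (⊤ : ℕ∞) Ψ₂)
    {x : Config (N₁ + N₂)} (hx : x ∈ blk N₁ N₂ Ω₁ Ω₂) (h : Config (N₁ + N₂)) :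
    fderiv ℝ (gp N₁ N₂ α θ Ψ₁ Ψ₂) x h =
      Complex.exp (-(Complex.I * α) * (ph N₁ N₂ θ x : ℂ)) *
      (-(Complex.I * α) * (fderiv ℝ (ph N₁ N₂ θ) x h : ℂ)
          * (Ψ₁ (prj1 N₁ N₂ x) * Ψ₂ (prj2 N₁ N₂ x))
        + fderiv ℝ Ψ₁ (prj1 N₁ N₂ x) (prj1 N₁ N₂ h) * Ψ₂ (prj2 N₁ N₂ x)
        + Ψ₁ (prj1 N₁ N₂ x) * fderiv ℝ Ψ₂ (prj2 N₁ N₂ x) (prj2 N₁ N₂ h)) := by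
  have d1 : HasFDerivAt (fun x => Ψ₁ (prj1 N₁ N₂ x))
      ((fderiv ℝ Ψ₁ (prj1 N₁ N₂ x)).comp (prj1 N₁ N₂)) x :=
    HasFDerivAt.comp x (h1.differentiable (by simp) _).hasFDerivAt (prj1 N₁ N₂).hasFDerivAt
  have d2 : HasFDerivAt (fun x => Ψ₂ (prj2 N₁ N₂ x))
      ((fderiv ℝ Ψ₂ (prj2 N₁ N₂ x)).comp (prj2 N₁ N₂)) x :=
    HasFDerivAt.comp x (h2.differentiable (by simp) _).hasFDerivAt (prj2 N₁ N₂).hasFDerivAt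
  have d3 : HasFDerivAt (ph N₁ N₂ θ) (fderiv ℝ (ph N₁ N₂ θ) x) x :=
    ((ph_contDiffAt hθ hx).differentiableAt (by simp)).hasFDerivAt
  have d4 : HasFDerivAt (fun y => (ph N₁ N₂ θ y : ℂ))
      (Complex.ofRealCLM.comp (fderiv ℝ (ph N₁ N₂ θ) x)) x :=
    HasFDerivAt.comp x Complex.ofRealCLM.hasFDerivAt d3
  have d5 := (d4.const_mul (-(Complex.I * α))).cexp
  have d6 := d5.mul (d1.mul d2)
  have e : fderiv ℝ (gp N₁ N₂ α θ Ψ₁ Ψ₂) x = _ := d6.fderiv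
  rw [e]
  simp
  ring

lemma gp_norm {N₁ N₂ : ℕ} {α : ℝ} {θ : Plane × Plane → ℝ}
    (x : Config (N₁ + N₂)) :
    ‖Complex.exp (-(Complex.I * α) * (ph N₁ N₂ θ x : ℂ))‖ = 1 := by
  rw [Complex.norm_exp]; simp

lemma prj1_single_left {N₁ N₂ : ℕ} (i : Fin N₁) (v : Plane) :
    prj1 N₁ N₂ (Pi.single (Fin.castAdd N₂ i) v) = Pi.single i v := by
  ext a : 1
  by_cases h : a = i
  · subst h; simp [prj1_apply]
  · rw [prj1_apply, Pi.single_eq_of_ne h, Pi.single_eq_of_ne]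
    exact fun h' => h (Fin.castAdd_injective _ _ h')

lemma prj2_single_right {N₁ N₂ : ℕ} (i : Fin N₂) (v : Plane) :
    prj2 N₁ N₂ (Pi.single (Fin.natAdd N₁ i) v) = Pi.single i v := by
  ext a : 1
  by_cases h : a = i
  · subst h; simp [prj2_apply]
  · rw [prj2_apply, Pi.single_eq_of_ne h, Pi.single_eq_of_ne]
    exact fun h' => h (Fin.natAdd_injective _ _ h')

lemma cast_ne_nat {N₁ N₂ : ℕ} (i : Fin N₁) (k : Fin N₂) : Fin.castAdd N₂ i ≠ Fin.natAdd N₁ k := by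
  intro h
  have := congrArg Fin.val h
  simp at this
  omega

lemma prj2_single_left {N₁ N₂ : ℕ} (i : Fin N₁) (v : Plane) :
    prj2 N₁ N₂ (Pi.single (Fin.castAdd N₂ i) v) = 0 := by
  ext a : 1
  rw [prj2_apply, Pi.single_eq_of_ne (cast_ne_nat _ _).symm]; rfl

lemma prj1_single_right {N₁ N₂ : ℕ} (i : Fin N₂) (v : Plane) :
    prj1 N₁ N₂ (Pi.single (Fin.natAdd N₁ i) v) = 0 := by
  ext a : 1
  rw [prj1_apply, Pi.single_eq_of_ne (cast_ne_nat _ _)]; rfl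

lemma ph_fderiv_left {N₁ N₂ : ℕ} {Ω₁ Ω₂ : Set Plane} {θ : Plane × Plane → ℝ}
    (hθ : IsPhase Ω₁ Ω₂ θ) {x : Config (N₁ + N₂)} (hx : x ∈ blk N₁ N₂ Ω₁ Ω₂)
    (i : Fin N₁) (v : Plane) :
    fderiv ℝ (ph N₁ N₂ θ) x (Pi.single (Fin.castAdd N₂ i) v) =
      (∑ k : Fin N₂, perpInv (x (Fin.castAdd N₂ i) - x (Fin.natAdd N₁ k))).1 * v.1 +
      (∑ k : Fin N₂, perpInv (x (Fin.castAdd N₂ i) - x (Fin.natAdd N₁ k))).2 * v.2 := by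
  rw [ph_fderiv hθ hx, Finset.sum_eq_single i]
  · rw [Prod.fst_sum, Prod.snd_sum, Finset.sum_mul, Finset.sum_mul, ← Finset.sum_add_distrib]
    refine Finset.sum_congr rfl fun k _ => ?_
    rw [Pi.single_eq_same, Pi.single_eq_of_ne (cast_ne_nat _ _).symm]
    simp
  · intro b _ hb
    refine Finset.sum_eq_zero fun k _ => ?_
    rw [Pi.single_eq_of_ne (cast_ne_nat _ _).symm,
      Pi.single_eq_of_ne fun h => hb (Fin.castAdd_injective _ _ h)]
    simp
  · simp

lemma ph_fderiv_right {N₁ N₂ : ℕ} {Ω₁ Ω₂ : Set Plane} {θ : Plane × Plane → ℝ}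
    (hθ : IsPhase Ω₁ Ω₂ θ) {x : Config (N₁ + N₂)} (hx : x ∈ blk N₁ N₂ Ω₁ Ω₂)
    (k : Fin N₂) (v : Plane) :
    fderiv ℝ (ph N₁ N₂ θ) x (Pi.single (Fin.natAdd N₁ k) v) =
      -((∑ i : Fin N₁, perpInv (x (Fin.castAdd N₂ i) - x (Fin.natAdd N₁ k))).1 * v.1 +
      (∑ i : Fin N₁, perpInv (x (Fin.castAdd N₂ i) - x (Fin.natAdd N₁ k))).2 * v.2) := by
  rw [ph_fderiv hθ hx, Prod.fst_sum, Prod.snd_sum, Finset.sum_mul, Finset.sum_mul,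
    ← Finset.sum_add_distrib, ← Finset.sum_neg_distrib]
  refine Finset.sum_congr rfl fun i _ => ?_
  rw [Finset.sum_eq_single k]
  · rw [Pi.single_eq_same, Pi.single_eq_of_ne (cast_ne_nat _ _)]
    simp
    ring
  · intro b _ hb
    rw [Pi.single_eq_of_ne (cast_ne_nat _ _),
      Pi.single_eq_of_ne fun h => hb (Fin.natAdd_injective _ _ h)]
    simp
  · simp

lemma DSq_left {N₁ N₂ : ℕ} {α : ℝ} {Ω₁ Ω₂ : Set Plane} {θ : Plane × Plane → ℝ}
    (hθ : IsPhase Ω₁ Ω₂ θ) {Ψ₁ : Config N₁ → ℂ} {Ψ₂ : Config N₂ → ℂ}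
    (h1 : ContDiff ℝ (⊤ : ℕ∞) Ψ₁) (h2 : ContDiff ℝ (⊤ : ℕ∞) Ψ₂)
    {x : Config (N₁ + N₂)} (hx : x ∈ blk N₁ N₂ Ω₁ Ω₂) (i : Fin N₁) :
    DSq (N₁ + N₂) α (Fin.castAdd N₂ i) (gp N₁ N₂ α θ Ψ₁ Ψ₂) x =
      DSq N₁ α i Ψ₁ (prj1 N₁ N₂ x) * ‖Ψ₂ (prj2 N₁ N₂ x)‖ ^ 2 := by
  simp only [DSq, DOp, pder, gp_fderiv hθ h1 h2 hx, ph_fderiv_left hθ hx, prj1_single_left,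
    prj2_single_left, abPot_left, map_zero, Prod.fst_add, Prod.snd_add, gp]
  set e := Complex.exp (-(Complex.I * α) * (ph N₁ N₂ θ x : ℂ)) with he
  have hn : ‖e‖ = 1 := gp_norm x
  set S := ∑ k : Fin N₂, perpInv (x (Fin.castAdd N₂ i) - x (Fin.natAdd N₁ k))
  set A := abPot N₁ i (prj1 N₁ N₂ x)
  set a := Ψ₁ (prj1 N₁ N₂ x)
  set b := Ψ₂ (prj2 N₁ N₂ x)
  have hI := Complex.I_sq
  have hb : ‖b‖ = ‖e * b‖ := by rw [norm_mul, hn, one_mul]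
  rw [hb, add_mul, ← mul_pow, ← mul_pow, ← norm_mul, ← norm_mul]
  congr 3
  · push_cast
    linear_combination (e * α * S.1 * a * b) * hI
  · push_cast
    linear_combination (e * α * S.2 * a * b) * hI

lemma DSq_right {N₁ N₂ : ℕ} {α : ℝ} {Ω₁ Ω₂ : Set Plane} {θ : Plane × Plane → ℝ}
    (hθ : IsPhase Ω₁ Ω₂ θ) {Ψ₁ : Config N₁ → ℂ} {Ψ₂ : Config N₂ → ℂ}
    (h1 : ContDiff ℝ (⊤ : ℕ∞) Ψ₁) (h2 : ContDiff ℝ (⊤ : ℕ∞) Ψ₂)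
    {x : Config (N₁ + N₂)} (hx : x ∈ blk N₁ N₂ Ω₁ Ω₂) (k : Fin N₂) :
    DSq (N₁ + N₂) α (Fin.natAdd N₁ k) (gp N₁ N₂ α θ Ψ₁ Ψ₂) x =
      ‖Ψ₁ (prj1 N₁ N₂ x)‖ ^ 2 * DSq N₂ α k Ψ₂ (prj2 N₁ N₂ x) := by
  simp only [DSq, DOp, pder, gp_fderiv hθ h1 h2 hx, ph_fderiv_right hθ hx, prj1_single_right,
    prj2_single_right, abPot_right, map_zero, Prod.fst_sub, Prod.snd_sub, gp]
  set e := Complex.exp (-(Complex.I * α) * (ph N₁ N₂ θ x : ℂ)) with he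
  have hn : ‖e‖ = 1 := gp_norm x
  set S := ∑ i : Fin N₁, perpInv (x (Fin.castAdd N₂ i) - x (Fin.natAdd N₁ k))
  set A := abPot N₂ k (prj2 N₁ N₂ x)
  set a := Ψ₁ (prj1 N₁ N₂ x)
  set b := Ψ₂ (prj2 N₁ N₂ x)
  have hI := Complex.I_sq
  have ha : ‖a‖ = ‖e * a‖ := by rw [norm_mul, hn, one_mul]
  rw [ha, mul_add (‖e * a‖ ^ 2), ← mul_pow, ← mul_pow, ← norm_mul, ← norm_mul]
  congr 3
  · push_cast
    linear_combination (-e * α * S.1 * a * b) * hI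
  · push_cast
    linear_combination (-e * α * S.2 * a * b) * hI


lemma gp_tsupport {N₁ N₂ : ℕ} {α : ℝ} {θ : Plane × Plane → ℝ}
    {Ψ₁ : Config N₁ → ℂ} {Ψ₂ : Config N₂ → ℂ} {x : Config (N₁ + N₂)}
    (hx : x ∈ tsupport (gp N₁ N₂ α θ Ψ₁ Ψ₂)) :
    prj1 N₁ N₂ x ∈ tsupport Ψ₁ ∧ prj2 N₁ N₂ x ∈ tsupport Ψ₂ := by
  have hcl : IsClosed {x : Config (N₁ + N₂) |
      prj1 N₁ N₂ x ∈ tsupport Ψ₁ ∧ prj2 N₁ N₂ x ∈ tsupport Ψ₂} :=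
    ((isClosed_tsupport Ψ₁).preimage (prj1 N₁ N₂).continuous).inter
      ((isClosed_tsupport Ψ₂).preimage (prj2 N₁ N₂).continuous)
  refine closure_minimal (fun y hy => ?_) hcl hx
  have h1 := right_ne_zero_of_mul hy
  exact ⟨subset_tsupport _ (left_ne_zero_of_mul h1), subset_tsupport _ (right_ne_zero_of_mul h1)⟩

lemma gp_compact {N₁ N₂ : ℕ} {α : ℝ} {θ : Plane × Plane → ℝ}
    {Ψ₁ : Config N₁ → ℂ} {Ψ₂ : Config N₂ → ℂ} (hc1 : IsCompact (tsupport Ψ₁))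
    (hc2 : IsCompact (tsupport Ψ₂)) : IsCompact (tsupport (gp N₁ N₂ α θ Ψ₁ Ψ₂)) := by
  have hcont : Continuous (fun p : Config N₁ × Config N₂ =>
      (Fin.append p.1 p.2 : Config (N₁ + N₂))) := by
    refine continuous_pi fun i => ?_
    induction i using Fin.addCases with
    | left i => simp only [Fin.append_left]; fun_prop
    | right i => simp only [Fin.append_right]; fun_prop
  refine ((hc1.prod hc2).image hcont).of_isClosed_subset (isClosed_tsupport _) fun x hx => ?_
  refine ⟨(prj1 N₁ N₂ x, prj2 N₁ N₂ x), gp_tsupport hx, ?_⟩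
  ext i : 1
  induction i using Fin.addCases with
  | left i => simp [prj1_apply]
  | right i => simp [prj2_apply]

lemma gp_smooth {N₁ N₂ : ℕ} {α : ℝ} {Ω₁ Ω₂ : Set Plane} {θ : Plane × Plane → ℝ}
    (hθ : IsPhase Ω₁ Ω₂ θ) {Ψ₁ : Config N₁ → ℂ} {Ψ₂ : Config N₂ → ℂ}
    (h1 : ContDiff ℝ (⊤ : ℕ∞) Ψ₁) (h2 : ContDiff ℝ (⊤ : ℕ∞) Ψ₂)
    (hs1 : tsupport Ψ₁ ⊆ cube N₁ Ω₁) (hs2 : tsupport Ψ₂ ⊆ cube N₂ Ω₂) :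
    ContDiff ℝ (⊤ : ℕ∞) (gp N₁ N₂ α θ Ψ₁ Ψ₂) := by
  rw [contDiff_iff_contDiffAt]
  intro x
  by_cases hx : x ∈ tsupport (gp N₁ N₂ α θ Ψ₁ Ψ₂)
  · have hx' := gp_tsupport hx
    have hb : x ∈ blk N₁ N₂ Ω₁ Ω₂ := ⟨hs1 hx'.1, hs2 hx'.2⟩
    have hp : ContDiffAt ℝ (⊤ : ℕ∞) (fun y => (ph N₁ N₂ θ y : ℂ)) x :=
      Complex.ofRealCLM.contDiff.contDiffAt.comp x (ph_contDiffAt hθ hb)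
    exact ((contDiffAt_const.mul hp).cexp).mul
      ((h1.comp (prj1 N₁ N₂).contDiff).mul (h2.comp (prj2 N₁ N₂).contDiff)).contDiffAt
  · rw [notMem_tsupport_iff_eventuallyEq] at hx
    exact contDiffAt_const.congr_of_eventuallyEq hx

lemma gp_diag {N₁ N₂ : ℕ} {α : ℝ} {Ω₁ Ω₂ : Set Plane} {θ : Plane × Plane → ℝ}
    (hdisj : Disjoint Ω₁ Ω₂) {Ψ₁ : Config N₁ → ℂ} {Ψ₂ : Config N₂ → ℂ}
    (h1 : Admissible N₁ Ψ₁) (h2 : Admissible N₂ Ψ₂)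
    (hs1 : tsupport Ψ₁ ⊆ cube N₁ Ω₁) (hs2 : tsupport Ψ₂ ⊆ cube N₂ Ω₂)
    {x : Config (N₁ + N₂)} (hx : x ∈ tsupport (gp N₁ N₂ α θ Ψ₁ Ψ₂)) : x ∉ diagSet (N₁ + N₂) := by
  have hx' := gp_tsupport hx
  have a1 : ∀ i, x (Fin.castAdd N₂ i) ∈ Ω₁ := fun i => hs1 hx'.1 i (mem_univ _)
  have a2 : ∀ i, x (Fin.natAdd N₁ i) ∈ Ω₂ := fun i => hs2 hx'.2 i (mem_univ _)
  rintro ⟨j, k, hjk, h⟩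
  induction j using Fin.addCases with
  | left j =>
    induction k using Fin.addCases with
    | left k =>
      exact tsupport_diag h1 hx'.1 ⟨j, k, fun e => hjk (by rw [e]), h⟩
    | right k =>
      exact Set.disjoint_left.1 hdisj (a1 j) (h ▸ a2 k)
  | right j =>
    induction k using Fin.addCases with
    | left k =>
      exact Set.disjoint_left.1 hdisj (a1 k) (h ▸ a2 j)
    | right k =>
      exact tsupport_diag h2 hx'.2 ⟨j, k, fun e => hjk (by rw [e]), h⟩

/-- Block-preserving permutations. -/
def blkPerm (N₁ N₂ : ℕ) : Finset (Equiv.Perm (Fin (N₁ + N₂))) :=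
  Finset.univ.filter fun σ => ∀ i : Fin N₁, (σ (Fin.castAdd N₂ i)).val < N₁

lemma blkPerm_iff {N₁ N₂ : ℕ} {Ω₁ Ω₂ : Set Plane} (hdisj : Disjoint Ω₁ Ω₂)
    (x : Config (N₁ + N₂)) (hx : x ∈ blk N₁ N₂ Ω₁ Ω₂) (σ : Equiv.Perm (Fin (N₁ + N₂))) :
    x ∘ σ ∈ blk N₁ N₂ Ω₁ Ω₂ ↔ σ ∈ blkPerm N₁ N₂ := by
  simp only [blkPerm, Finset.mem_filter, Finset.mem_univ, true_and]
  constructor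
  · intro h i
    by_contra hlt
    have h1 : x (σ (Fin.castAdd N₂ i)) ∈ Ω₁ := h.1 i (mem_univ _)
    generalize σ (Fin.castAdd N₂ i) = m at h1 hlt
    induction m using Fin.addCases with
    | left m => exact hlt (by simp)
    | right m => exact Set.disjoint_left.1 hdisj h1 (hx.2 m (mem_univ _))
  · intro h
    obtain ⟨σ₁, σ₂, e1, e2⟩ := perm_split σ h
    refine ⟨fun i _ => ?_, fun k _ => ?_⟩
    · change x (σ (Fin.castAdd N₂ i)) ∈ Ω₁
      rw [e1]; exact hx.1 _ (mem_univ _)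
    · change x (σ (Fin.natAdd N₁ k)) ∈ Ω₂
      rw [e2]; exact hx.2 _ (mem_univ _)

lemma gp_perm {N₁ N₂ : ℕ} {α : ℝ} {θ : Plane × Plane → ℝ}
    {Ψ₁ : Config N₁ → ℂ} {Ψ₂ : Config N₂ → ℂ}
    (h1 : Admissible N₁ Ψ₁) (h2 : Admissible N₂ Ψ₂) (x : Config (N₁ + N₂))
    {σ : Equiv.Perm (Fin (N₁ + N₂))} (hσ : σ ∈ blkPerm N₁ N₂) :
    gp N₁ N₂ α θ Ψ₁ Ψ₂ (x ∘ σ) = gp N₁ N₂ α θ Ψ₁ Ψ₂ x := by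
  simp only [blkPerm, Finset.mem_filter, Finset.mem_univ, true_and] at hσ
  obtain ⟨σ₁, σ₂, e1, e2⟩ := perm_split σ hσ
  have p1 : prj1 N₁ N₂ (x ∘ σ) = prj1 N₁ N₂ x ∘ σ₁ := by
    ext i : 1; simp [prj1_apply, e1]
  have p2 : prj2 N₁ N₂ (x ∘ σ) = prj2 N₁ N₂ x ∘ σ₂ := by
    ext i : 1; simp [prj2_apply, e2]
  have p3 : ph N₁ N₂ θ (x ∘ σ) = ph N₁ N₂ θ x := by
    simp only [ph, prP_apply, Function.comp_apply, e1, e2]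
    rw [← Equiv.sum_comp σ₁ (fun i => ∑ k, θ (x (Fin.castAdd N₂ i), x (Fin.natAdd N₁ k)))]
    refine Finset.sum_congr rfl fun i _ => ?_
    exact Equiv.sum_comp σ₂ (fun k => θ (x (Fin.castAdd N₂ (σ₁ i)), x (Fin.natAdd N₁ k)))
  simp only [gp, p1, p2, p3, h1.symm, h2.symm]

lemma symz_blk {N₁ N₂ : ℕ} {α : ℝ} {Ω₁ Ω₂ : Set Plane} {θ : Plane × Plane → ℝ}
    (hdisj : Disjoint Ω₁ Ω₂) {Ψ₁ : Config N₁ → ℂ} {Ψ₂ : Config N₂ → ℂ}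
    (h1 : Admissible N₁ Ψ₁) (h2 : Admissible N₂ Ψ₂)
    (hs1 : tsupport Ψ₁ ⊆ cube N₁ Ω₁) (hs2 : tsupport Ψ₂ ⊆ cube N₂ Ω₂)
    {x : Config (N₁ + N₂)} (hx : x ∈ blk N₁ N₂ Ω₁ Ω₂) :
    symz (N₁ + N₂) (gp N₁ N₂ α θ Ψ₁ Ψ₂) x =
      ((blkPerm N₁ N₂).card : ℂ) * gp N₁ N₂ α θ Ψ₁ Ψ₂ x := by
  classical
  have : ∀ σ : Equiv.Perm (Fin (N₁ + N₂)), gp N₁ N₂ α θ Ψ₁ Ψ₂ (x ∘ σ) =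
      if σ ∈ blkPerm N₁ N₂ then gp N₁ N₂ α θ Ψ₁ Ψ₂ x else 0 := by
    intro σ
    split_ifs with hσ
    · exact gp_perm h1 h2 x hσ
    · by_contra hne
      have ht := gp_tsupport (subset_tsupport _ hne)
      exact hσ ((blkPerm_iff hdisj x hx σ).1 ⟨hs1 ht.1, hs2 ht.2⟩)
  unfold symz
  rw [Finset.sum_congr rfl fun σ _ => this σ]
  simp

lemma energy_add {N₁ N₂ : ℕ} {α : ℝ} {Ω₁ Ω₂ : Set Plane} {θ : Plane × Plane → ℝ}
    (ho1 : IsOpen Ω₁) (ho2 : IsOpen Ω₂) (hdisj : Disjoint Ω₁ Ω₂)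
    (hθ : IsPhase Ω₁ Ω₂ θ) {E₁ E₂ : ℝ} (hE1 : E₁ ∈ dSet N₁ α Ω₁) (hE2 : E₂ ∈ dSet N₂ α Ω₂) :
    E₁ + E₂ ∈ dSet (N₁ + N₂) α (Ω₁ ∪ Ω₂) := by
  obtain ⟨Ψ₁, h1, hc1, hs1, hn1, rfl⟩ := hE1
  obtain ⟨Ψ₂, h2, hc2, hs2, hn2, rfl⟩ := hE2
  set Φ := gp N₁ N₂ α θ Ψ₁ Ψ₂ with hΦ
  have hΦs : ContDiff ℝ (⊤ : ℕ∞) Φ := gp_smooth hθ h1.smooth h2.smooth hs1 hs2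
  have htb : tsupport Φ ⊆ blk N₁ N₂ Ω₁ Ω₂ := fun x hx =>
    ⟨hs1 (gp_tsupport hx).1, hs2 (gp_tsupport hx).2⟩
  have hbc : blk N₁ N₂ Ω₁ Ω₂ ⊆ cube (N₁ + N₂) (Ω₁ ∪ Ω₂) := by
    intro x hx i _
    induction i using Fin.addCases with
    | left i => exact Or.inl (hx.1 i (mem_univ _))
    | right i => exact Or.inr (hx.2 i (mem_univ _))
  obtain ⟨hA, hC, hS, hT⟩ := symz_adm (Ω := Ω₁ ∪ Ω₂) hΦs (gp_compact hc1 hc2) (htb.trans hbc)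
    (fun x hx => gp_diag hdisj h1 h2 hs1 hs2 hx)
  set Ψ := symz (N₁ + N₂) Φ with hΨ
  set K : ℝ := ((blkPerm N₁ N₂).card : ℝ) with hK
  have hKpos : 0 < K := by
    have : (1 : Equiv.Perm (Fin (N₁ + N₂))) ∈ blkPerm N₁ N₂ := by simp [blkPerm]
    exact Nat.cast_pos.2 (Finset.card_pos.2 ⟨1, this⟩)
  have hbo := isOpen_blk N₁ N₂ ho1 ho2
  have hblk : ∀ x ∈ blk N₁ N₂ Ω₁ Ω₂, Ψ x = (K : ℂ) * Φ x := fun x hx => by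
    rw [hΨ, symz_blk hdisj h1 h2 hs1 hs2 hx, hK, Complex.ofReal_natCast]
  have hKn : ‖(K : ℂ)‖ ^ 2 = K ^ 2 := by rw [Complex.norm_real, norm_eq_abs, sq_abs]
  have hDblk : ∀ j, ∀ x ∈ blk N₁ N₂ Ω₁ Ω₂,
      DSq (N₁ + N₂) α j Ψ x = K ^ 2 * DSq (N₁ + N₂) α j Φ x := fun j x hx => by
    have : Ψ =ᶠ[𝓝 x] fun y => (K : ℂ) * Φ y := by
      filter_upwards [hbo.mem_nhds hx] with y hy using hblk y hy
    rw [DSq_congr this, DSq_const_mul _ (hΦs.differentiable (by simp) x), hKn]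
  -- the norm
  have hN : K * normSq (N₁ + N₂) (Ω₁ ∪ Ω₂) Ψ = ((N₁ + N₂).factorial : ℝ) * K ^ 2 := by
    rw [normSq_eq hS, hK, integral_symm hbo.measurableSet (blkPerm N₁ N₂)
      (fun x hx σ => blkPerm_iff hdisj x hx σ) (sq_integrable hA hC)
      (fun σ x => by rw [hA.symm]) (fun x hx => ?_), ← hK]
    · congr 1
      rw [setIntegral_congr_fun hbo.measurableSet (g := fun x => K ^ 2 *
        (‖Ψ₁ (prj1 N₁ N₂ x)‖ ^ 2 * ‖Ψ₂ (prj2 N₁ N₂ x)‖ ^ 2)) (fun x hx => ?_), integral_const_mul,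
        integral_blk N₁ N₂ Ω₁ Ω₂ (fun y => ‖Ψ₁ y‖ ^ 2) (fun y => ‖Ψ₂ y‖ ^ 2)]
      · change K ^ 2 * (normSq N₁ Ω₁ Ψ₁ * normSq N₂ Ω₂ Ψ₂) = _
        rw [hn1, hn2]; ring
      · simp only [hblk x hx, norm_mul, mul_pow, hKn, hΦ, gp, gp_norm, one_pow, one_mul]
    · have : x ∈ tsupport Ψ := subset_tsupport _ fun h => hx (by simp [h])
      obtain ⟨σ, hσ⟩ := hT x this
      exact ⟨σ, htb hσ⟩
  -- the energy
  have hE : K * kinE (N₁ + N₂) α (Ω₁ ∪ Ω₂) Ψ =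
      ((N₁ + N₂).factorial : ℝ) * (K ^ 2 * (kinE N₁ α Ω₁ Ψ₁ + kinE N₂ α Ω₂ Ψ₂)) := by
    rw [kinE_eq hS, ← integral_finsetSum _ (fun j _ => DSq_integrable hA hC), hK,
      integral_symm hbo.measurableSet (blkPerm N₁ N₂)
      (fun x hx σ => blkPerm_iff hdisj x hx σ) 
      (integrable_finsetSum _ (fun j _ => DSq_integrable hA hC))
      (fun σ x => ?_) (fun x hx => ?_), ← hK]
    · congr 1
      rw [integral_finsetSum _ (fun j _ => (DSq_integrable hA hC).integrableOn),
        Fin.sum_univ_add, mul_add]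
      congr 1
      · rw [kinE, Finset.mul_sum]
        refine Finset.sum_congr rfl fun i _ => ?_
        rw [setIntegral_congr_fun hbo.measurableSet (g := fun x => K ^ 2 *
          (DSq N₁ α i Ψ₁ (prj1 N₁ N₂ x) * ‖Ψ₂ (prj2 N₁ N₂ x)‖ ^ 2)) (fun x hx => ?_),
          integral_const_mul, integral_blk N₁ N₂ Ω₁ Ω₂ (DSq N₁ α i Ψ₁) (fun y => ‖Ψ₂ y‖ ^ 2)]
        · change K ^ 2 * (_ * normSq N₂ Ω₂ Ψ₂) = _
          rw [hn2, mul_one]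
        · simp only [hDblk _ x hx, hΦ, DSq_left hθ h1.smooth h2.smooth hx]
      · rw [kinE, Finset.mul_sum]
        refine Finset.sum_congr rfl fun k _ => ?_
        rw [setIntegral_congr_fun hbo.measurableSet (g := fun x => K ^ 2 *
          (‖Ψ₁ (prj1 N₁ N₂ x)‖ ^ 2 * DSq N₂ α k Ψ₂ (prj2 N₁ N₂ x))) (fun x hx => ?_),
          integral_const_mul, integral_blk N₁ N₂ Ω₁ Ω₂ (fun y => ‖Ψ₁ y‖ ^ 2) (DSq N₂ α k Ψ₂)]
        · change K ^ 2 * (normSq N₁ Ω₁ Ψ₁ * _) = _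
          rw [hn1, one_mul]
        · simp only [hDblk _ x hx, hΦ, DSq_right hθ h1.smooth h2.smooth hx]
    · simp only [DSq_perm hA]
      exact Equiv.sum_comp σ (fun j => DSq (N₁ + N₂) α j Ψ x)
    · obtain ⟨j, -, hj⟩ := Finset.exists_ne_zero_of_sum_ne_zero hx
      have : x ∈ tsupport Ψ := by
        by_contra h
        exact hj (DSq_eq_zero h)
      obtain ⟨σ, hσ⟩ := hT x this
      exact ⟨σ, htb hσ⟩
  have hF : (0 : ℝ) < ((N₁ + N₂).factorial : ℝ) := by exact_mod_cast Nat.factorial_pos _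
  have hN' : normSq (N₁ + N₂) (Ω₁ ∪ Ω₂) Ψ = ((N₁ + N₂).factorial : ℝ) * K :=
    mul_left_cancel₀ hKpos.ne' (by rw [hN]; ring)
  have hE' : kinE (N₁ + N₂) α (Ω₁ ∪ Ω₂) Ψ =
      ((N₁ + N₂).factorial : ℝ) * K * (kinE N₁ α Ω₁ Ψ₁ + kinE N₂ α Ω₂ Ψ₂) :=
    mul_left_cancel₀ hKpos.ne' (by rw [hE]; ring)
  have hfin := mem_dSet (α := α) hA hC hS (by rw [hN']; positivity)
  rw [hN', hE', mul_div_cancel_left₀ _ (by positivity)] at hfin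
  exact hfin

/-- Subadditivity of the Dirichlet energy: if `Ω₁` and `Ω₂` are disjoint,
open, simply connected subsets of `ℝ²`, then for every `α ∈ [0,1]` and all `N₁, N₂ ≥ 1`,
`E^D_{N₁+N₂}(α; Ω₁ ∪ Ω₂) ≤ E^D_{N₁}(α; Ω₁) + E^D_{N₂}(α; Ω₂)`. -/
theorem dirichlet_subadditivity (Ω₁ Ω₂ : Set Plane)
    (h₁o : IsOpen Ω₁) (h₂o : IsOpen Ω₂) (hdisj : Disjoint Ω₁ Ω₂)
    (h₁sc : SimplyConnectedSpace Ω₁) (h₂sc : SimplyConnectedSpace Ω₂)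
    (α : ℝ) (hα : α ∈ Set.Icc (0 : ℝ) 1) (N₁ N₂ : ℕ) (hN₁ : 1 ≤ N₁) (hN₂ : 1 ≤ N₂) :
    dirichletE (N₁ + N₂) α (Ω₁ ∪ Ω₂) ≤ dirichletE N₁ α Ω₁ + dirichletE N₂ α Ω₂ := by
  obtain ⟨θ, hθ⟩ := exists_theta Ω₁ Ω₂ h₁o h₂o hdisj h₁sc h₂sc
  have hne1 : Ω₁.Nonempty := Set.nonempty_coe_sort.1 (PathConnectedSpace.nonempty (X := Ω₁))
  have hne2 : Ω₂.Nonempty := Set.nonempty_coe_sort.1 (PathConnectedSpace.nonempty (X := Ω₂))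
  have key : ∀ E₁ ∈ dSet N₁ α Ω₁, ∀ E₂ ∈ dSet N₂ α Ω₂,
      dirichletE (N₁ + N₂) α (Ω₁ ∪ Ω₂) ≤ E₁ + E₂ := fun E₁ hE1 E₂ hE2 =>
    csInf_le (dSet_bdd _ _ _) (energy_add h₁o h₂o hdisj hθ hE1 hE2)
  have s1 : ∀ E₁ ∈ dSet N₁ α Ω₁,
      dirichletE (N₁ + N₂) α (Ω₁ ∪ Ω₂) - E₁ ≤ dirichletE N₂ α Ω₂ := fun E₁ hE1 =>
    le_csInf (dSet_nonempty N₂ α h₂o hne2) fun E₂ hE2 => by linarith [key E₁ hE1 E₂ hE2]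
  have s2 : dirichletE (N₁ + N₂) α (Ω₁ ∪ Ω₂) - dirichletE N₂ α Ω₂ ≤ dirichletE N₁ α Ω₁ :=
    le_csInf (dSet_nonempty N₁ α h₁o hne1) fun E₁ hE1 => by linarith [s1 E₁ hE1]
  linarith
end
end

section
/- Dyson-type upper bound (Dirichlet): for every α ∈ [0,1] and every integer N ≥ 1 with 8 π α N < 1, the Dirichlet energy on the unit square satisfies E^D_N(α) ≤ 2 π² N + (9π/2) N (N−1) α · (1 + (4/3)³ · 20 π (N−2) α) / (1 − 8 π α N)². -/
noncomputable section

open MeasureTheory Real Set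
open scoped BigOperators Topology

lemma dy_exists_S (η : ℝ) (hη : 0 < η) : ∃ S : ℝ → ℝ, ContDiff ℝ (⊤ : ℕ∞) S ∧
    (∀ t ≤ η, S t = 0) ∧ (∀ t, 0 ≤ deriv S t ∧ deriv S t ≤ 1) ∧
    (∀ t, 0 ≤ deriv (deriv S) t) ∧
    (∀ t, 0 ≤ S t ∧ t - 2 * η ≤ S t ∧ (0 ≤ t → S t ≤ t)) := by
  set h : ℝ → ℝ := fun s => smoothTransition ((s - η) / η) with hh
  have hcd : ContDiff ℝ (⊤ : ℕ∞) h := by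
    apply smoothTransition.contDiff.comp
    fun_prop
  have hc : Continuous h := hcd.continuous
  have hmono : Monotone h := by
    intro a b hab
    apply smoothTransition.monotone
    gcongr
  have h0 : ∀ s, 0 ≤ h s := fun s => smoothTransition.nonneg _
  have h1 : ∀ s, h s ≤ 1 := fun s => smoothTransition.le_one _
  have hz : ∀ s ≤ η, h s = 0 := fun s hs => smoothTransition.zero_of_nonpos
    (div_nonpos_of_nonpos_of_nonneg (by linarith) hη.le)
  have ho : ∀ s, 2 * η ≤ s → h s = 1 := fun s hs => smoothTransition.one_of_one_le
    (by rw [le_div_iff₀ hη]; linarith)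
  have hd : ∀ t, HasDerivAt (fun t => ∫ s in (0:ℝ)..t, h s) (h t) t := fun t =>
    intervalIntegral.integral_hasDerivAt_right (hc.intervalIntegrable _ _)
      (hc.stronglyMeasurableAtFilter _ _) hc.continuousAt
  have hderiv : deriv (fun t => ∫ s in (0:ℝ)..t, h s) = h := funext fun t => (hd t).deriv
  have hi : ∀ a b, IntervalIntegrable h volume a b := fun a b => hc.intervalIntegrable _ _
  have hle0 : ∀ t ≤ η, (∫ s in (0:ℝ)..t, h s) = 0 := by
    intro t ht
    rw [intervalIntegral.integral_congr (g := fun _ => (0:ℝ))]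
    · simp
    · intro s hs
      apply hz
      have := hs.2
      exact this.trans (max_le hη.le ht)
  have hnn : ∀ t, 0 ≤ ∫ s in (0:ℝ)..t, h s := by
    intro t
    rcases le_total 0 t with h | h
    · exact intervalIntegral.integral_nonneg h fun s _ => h0 s
    · rw [hle0 t (h.trans hη.le)]
  refine ⟨fun t => ∫ s in (0:ℝ)..t, h s, ?_, hle0, ?_, ?_, ?_⟩
  · rw [contDiff_infty_iff_deriv, hderiv]
    exact ⟨fun t => (hd t).differentiableAt, hcd⟩
  · intro t; rw [hderiv]; exact ⟨h0 t, h1 t⟩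
  · intro t; rw [hderiv]
    exact hmono.deriv_nonneg
  · intro t
    refine ⟨hnn t, ?_, ?_⟩
    · rcases le_total t (2 * η) with h9 | h9
      · linarith [hnn t]
      · have e : (∫ s in (0:ℝ)..t, h s) = (∫ s in (0:ℝ)..(2*η), h s) + ∫ s in (2*η)..t, h s :=
          (intervalIntegral.integral_add_adjacent_intervals (hi _ _) (hi _ _)).symm
        have e2 : (∫ s in (2*η)..t, h s) = t - 2 * η := by
          rw [intervalIntegral.integral_congr (g := fun _ => (1:ℝ))]
          · simp
          · intro s hs
            apply ho
            rw [uIcc_of_le h9] at hs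
            exact hs.1
        show _ ≤ ∫ s in (0:ℝ)..t, _
        rw [e, e2]
        linarith [hnn (2 * η)]
    · intro ht
      calc (∫ s in (0:ℝ)..t, h s) ≤ ∫ s in (0:ℝ)..t, (1:ℝ) :=
            intervalIntegral.integral_mono_on ht (hi _ _) (by simp) fun s _ => h1 s
        _ = t := by simp

/-- the unperturbed ground state -/
def dyPhi0 (p : Plane) : ℝ := 2 * (sin (π * p.1) * sin (π * p.2))

def dyE (b : Bool) : Plane := if b then (1, 0) else (0, 1)

lemma dyPhi0_contDiff : ContDiff ℝ (⊤ : ℕ∞) dyPhi0 := by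
  unfold dyPhi0
  fun_prop

lemma dyPhi0_le (p : Plane) : dyPhi0 p ≤ 2 := by
  unfold dyPhi0
  have := abs_le.1 (abs_mul (sin (π * p.1)) (sin (π * p.2)) ▸
    mul_le_one₀ (abs_sin_le_one _) (abs_nonneg _) (abs_sin_le_one _))
  linarith [this.2]

lemma dyPhi0_pos {p : Plane} (hp : p ∈ Q0) : 0 < dyPhi0 p := by
  obtain ⟨⟨h1, h2⟩, h3, h4⟩ := hp
  have := sin_pos_of_pos_of_lt_pi (x := π * p.1) (by positivity) (by nlinarith [pi_pos])
  have := sin_pos_of_pos_of_lt_pi (x := π * p.2) (by positivity) (by nlinarith [pi_pos])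
  unfold dyPhi0
  positivity

lemma dyPhi0_bdry {p : Plane} (hp : p ∈ Icc (0:ℝ) 1 ×ˢ Icc (0:ℝ) 1) (h : p ∉ Q0) :
    dyPhi0 p = 0 := by
  obtain ⟨⟨h1, h2⟩, h3, h4⟩ := hp
  have : p.1 = 0 ∨ p.1 = 1 ∨ p.2 = 0 ∨ p.2 = 1 := by
    by_contra hcon
    push Not at hcon
    apply h
    exact ⟨⟨lt_of_le_of_ne h1 (Ne.symm hcon.1), lt_of_le_of_ne h2 hcon.2.1⟩,
      ⟨lt_of_le_of_ne h3 (Ne.symm hcon.2.2.1), lt_of_le_of_ne h4 hcon.2.2.2⟩⟩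
  unfold dyPhi0
  rcases this with h | h | h | h <;> simp [h]

lemma dyPhi0_line (p : Plane) (b : Bool) : ∃ _a : ℝ,
    (∀ t : ℝ, HasDerivAt (fun t : ℝ => dyPhi0 (p + t • dyE b))
      (deriv (fun t : ℝ => dyPhi0 (p + t • dyE b)) t) t) ∧
    deriv (deriv (fun t : ℝ => dyPhi0 (p + t • dyE b))) 0 = - π ^ 2 * dyPhi0 p := by
  refine ⟨0, ?_, ?_⟩
  · intro t
    apply DifferentiableAt.hasDerivAt
    have := dyPhi0_contDiff.differentiable (by simp)
    fun_prop
  · have hs : ∀ a t : ℝ, HasDerivAt (fun t : ℝ => sin (π * (a + t))) (π * cos (π * (a + t))) t := by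
      intro a t
      have := (((hasDerivAt_id t).const_add a).const_mul π).sin
      simpa [mul_comm] using this
    have hcs : ∀ a t : ℝ, HasDerivAt (fun t : ℝ => cos (π * (a + t))) (-π * sin (π * (a + t))) t := by
      intro a t
      have := (((hasDerivAt_id t).const_add a).const_mul π).cos
      simpa [mul_comm] using this
    cases b
    · have e : (fun t : ℝ => dyPhi0 (p + t • dyE false)) =
          fun t => (2 * sin (π * p.1)) * sin (π * (p.2 + t)) := by
        ext t; simp [dyPhi0, dyE]; ring
      have d1 : deriv (fun t => (2 * sin (π * p.1)) * sin (π * (p.2 + t))) =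
          fun t => (2 * sin (π * p.1)) * (π * cos (π * (p.2 + t))) :=
        funext fun t => ((hs p.2 t).const_mul _).deriv
      rw [e, d1, (((hcs p.2 0).const_mul π).const_mul (2 * sin (π * p.1))).deriv]
      simp [dyPhi0]; ring
    · have e : (fun t : ℝ => dyPhi0 (p + t • dyE true)) =
          fun t => (2 * sin (π * p.2)) * sin (π * (p.1 + t)) := by
        ext t; simp [dyPhi0, dyE]; ring
      have d1 : deriv (fun t => (2 * sin (π * p.2)) * sin (π * (p.1 + t))) =
          fun t => (2 * sin (π * p.2)) * (π * cos (π * (p.1 + t))) :=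
        funext fun t => ((hs p.1 t).const_mul _).deriv
      rw [e, d1, (((hcs p.1 0).const_mul π).const_mul (2 * sin (π * p.2))).deriv]
      simp [dyPhi0]; ring

/-- second directional derivative as a one-variable derivative -/
lemma dy_second (F : Plane → ℝ) (hF : ContDiff ℝ (⊤ : ℕ∞) F) (p e : Plane) :
    fderiv ℝ (fun z => fderiv ℝ F z e) p e =
      deriv (deriv (fun t : ℝ => F (p + t • e))) 0 := by
  have hl : ∀ t : ℝ, HasDerivAt (fun t : ℝ => p + t • e) e t := by
    intro t
    simpa using ((hasDerivAt_id t).smul_const e).const_add p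
  have h1 : deriv (fun t : ℝ => F (p + t • e)) = fun t => fderiv ℝ F (p + t • e) e := by
    ext t
    exact (((hF.differentiable (by simp)) _).hasFDerivAt.comp_hasDerivAt t (hl t)).deriv
  rw [h1]
  have hF2 : ContDiff ℝ (⊤ : ℕ∞) (fun z => fderiv ℝ F z e) :=
    (hF.fderiv_right (m := (⊤ : ℕ∞)) (by simp)).clm_apply contDiff_const
  have h2 := (((hF2.differentiable (by simp)) (p + (0:ℝ) • e)).hasFDerivAt.comp_hasDerivAt 0 (hl 0)).deriv
  simp only [zero_smul, add_zero] at h2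
  exact h2.symm

lemma dy_S_second (S u : ℝ → ℝ) (hS : ContDiff ℝ (⊤ : ℕ∞) S) (hu : ContDiff ℝ (⊤ : ℕ∞) u) (t : ℝ) :
    deriv (deriv (fun t => S (u t))) t =
      deriv (deriv S) (u t) * (deriv u t) ^ 2 + deriv S (u t) * deriv (deriv u) t := by
  have dS : ContDiff ℝ (⊤ : ℕ∞) (deriv S) := (contDiff_infty_iff_deriv.1 hS).2
  have du : ContDiff ℝ (⊤ : ℕ∞) (deriv u) := (contDiff_infty_iff_deriv.1 hu).2
  have h1 : deriv (fun t => S (u t)) = fun t => deriv S (u t) * deriv u t := by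
    ext t
    exact ((hS.differentiable (by simp) (u t)).hasDerivAt.comp t
      (hu.differentiable (by simp) t).hasDerivAt).deriv
  rw [h1]
  have h2 := (((dS.differentiable (by simp) (u t)).hasDerivAt.comp t
      (hu.differentiable (by simp) t).hasDerivAt).mul
      (du.differentiable (by simp) t).hasDerivAt).deriv
  rw [show (fun t => deriv S (u t) * deriv u t) = (deriv S ∘ u) * deriv u from rfl, h2]
  simp only [Function.comp]
  ring

lemma dy_sin2 : ∫ x in Ioo (0:ℝ) 1, sin (π * x) ^ 2 = 1 / 2 := by
  rw [← integral_Ioc_eq_integral_Ioo, ← intervalIntegral.integral_of_le (by norm_num)]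
  rw [intervalIntegral.integral_comp_mul_left (fun x => sin x ^ 2) pi_ne_zero, integral_sin_sq]
  simp
  field_simp

lemma dy_sin4 : ∫ x in Ioo (0:ℝ) 1, sin (π * x) ^ 4 = 3 / 8 := by
  rw [← integral_Ioc_eq_integral_Ioo, ← intervalIntegral.integral_of_le (by norm_num)]
  rw [intervalIntegral.integral_comp_mul_left (fun x => sin x ^ 4) pi_ne_zero,
    integral_sin_pow 2, integral_sin_sq]
  simp
  field_simp
  norm_num

lemma dy_int_sq : ∫ p in Q0, dyPhi0 p ^ 2 = 1 := by
  have : ∀ p : Plane, dyPhi0 p ^ 2 = (4 * sin (π * p.1) ^ 2) * sin (π * p.2) ^ 2 := by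
    intro p; unfold dyPhi0; ring
  simp_rw [this]
  rw [Q0, Measure.volume_eq_prod,
    setIntegral_prod_mul (fun x => 4 * sin (π * x) ^ 2) (fun y => sin (π * y) ^ 2),
    integral_const_mul, dy_sin2]
  norm_num

lemma dy_int_four : ∫ p in Q0, dyPhi0 p ^ 4 = 9 / 4 := by
  have : ∀ p : Plane, dyPhi0 p ^ 4 = (16 * sin (π * p.1) ^ 4) * sin (π * p.2) ^ 4 := by
    intro p; unfold dyPhi0; ring
  simp_rw [this]
  rw [Q0, Measure.volume_eq_prod,
    setIntegral_prod_mul (fun x => 16 * sin (π * x) ^ 4) (fun y => sin (π * y) ^ 4),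
    integral_const_mul, dy_sin4]
  norm_num

lemma dy_Q0_open : IsOpen Q0 := isOpen_Ioo.prod isOpen_Ioo

lemma dy_Q0_vol : volume Q0 = 1 := by
  rw [Q0, Measure.volume_eq_prod, Measure.prod_prod]
  simp

lemma dy_Q0_intOn (F : Plane → ℝ) (hF : Continuous F) : IntegrableOn F Q0 := by
  apply IntegrableOn.mono_set (t := Icc (0:ℝ) 1 ×ˢ Icc (0:ℝ) 1)
  · exact hF.continuousOn.integrableOn_compact (isCompact_Icc.prod isCompact_Icc)
  · exact prod_mono Ioo_subset_Icc_self Ioo_subset_Icc_self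

lemma dy_exists_phi (η : ℝ) (hη : 0 < η) : ∃ φ : Plane → ℝ, ContDiff ℝ (⊤ : ℕ∞) φ ∧
    (∃ K : Set Plane, IsCompact K ∧ K ⊆ Q0 ∧ ∀ p, p ∉ K → φ p = 0) ∧
    (∀ p, 0 ≤ φ p ∧ φ p ≤ 2) ∧
    (1 - 8 * η ≤ ∫ p, φ p ^ 2) ∧ (∫ p, φ p ^ 4 ≤ 9 / 4) ∧
    (∀ p b, - (φ p * fderiv ℝ (fun z => fderiv ℝ φ z (dyE b)) p (dyE b)) ≤
      π ^ 2 * (φ p ^ 2 + 4 * η)) := by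
  classical
  obtain ⟨S, hS, hS0, hS1, hS2, hS3⟩ := dy_exists_S η hη
  set φ : Plane → ℝ := fun p => if p ∈ Q0 then S (dyPhi0 p) else 0 with hφ
  have c0 : Continuous dyPhi0 := dyPhi0_contDiff.continuous
  have hin : ∀ p ∈ Q0, φ =ᶠ[𝓝 p] fun p => S (dyPhi0 p) := by
    intro p hp
    filter_upwards [dy_Q0_open.mem_nhds hp] with z hz
    simp [hφ, hz]
  have hout : ∀ p ∉ Q0, φ =ᶠ[𝓝 p] fun p => 0 := by
    intro p hp
    by_cases h : dyPhi0 p < η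
    · filter_upwards [(isOpen_lt c0 continuous_const).mem_nhds h] with z hz
      simp only [hφ]
      split_ifs
      · exact hS0 _ (le_of_lt hz)
      · rfl
    · have hp' : p ∉ Icc (0:ℝ) 1 ×ˢ Icc (0:ℝ) 1 := by
        intro h'
        rw [dyPhi0_bdry h' hp] at h
        exact h hη
      filter_upwards [(isClosed_Icc.prod isClosed_Icc).isOpen_compl.mem_nhds hp'] with z hz
      have : z ∉ Q0 := fun h => hz (prod_mono Ioo_subset_Icc_self Ioo_subset_Icc_self h)
      simp [hφ, this]
  have hcd : ContDiff ℝ (⊤ : ℕ∞) φ := by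
    rw [contDiff_iff_contDiffAt]
    intro p
    by_cases hp : p ∈ Q0
    · exact (hS.comp dyPhi0_contDiff).contDiffAt.congr_of_eventuallyEq (hin p hp)
    · exact contDiffAt_const.congr_of_eventuallyEq (hout p hp)
  have hQ : ∀ p ∈ Q0, φ p = S (dyPhi0 p) := fun p hp => by simp [hφ, hp]
  have hnQ : ∀ p ∉ Q0, φ p = 0 := fun p hp => by simp [hφ, hp]
  have hle : ∀ p ∈ Q0, φ p ≤ dyPhi0 p := fun p hp => by
    rw [hQ p hp]; exact (hS3 _).2.2 (dyPhi0_pos hp).le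
  have hge : ∀ p ∈ Q0, dyPhi0 p - 2 * η ≤ φ p := fun p hp => by
    rw [hQ p hp]; exact (hS3 _).2.1
  have hb : ∀ p, 0 ≤ φ p ∧ φ p ≤ 2 := by
    intro p
    by_cases hp : p ∈ Q0
    · exact ⟨hQ p hp ▸ (hS3 _).1, (hle p hp).trans (dyPhi0_le p)⟩
    · rw [hnQ p hp]; norm_num
  have hcon : Continuous φ := hcd.continuous
  refine ⟨φ, hcd, ⟨(Icc (0:ℝ) 1 ×ˢ Icc (0:ℝ) 1) ∩ {p | η ≤ dyPhi0 p}, ?_, ?_, ?_⟩, hb, ?_, ?_, ?_⟩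
  · exact (isCompact_Icc.prod isCompact_Icc).inter_right (isClosed_le continuous_const c0)
  · rintro p ⟨h1, h2⟩
    by_contra h
    replace h2 : η ≤ dyPhi0 p := h2
    rw [dyPhi0_bdry h1 h] at h2
    linarith
  · intro p hp
    by_cases h : p ∈ Q0
    · rw [hQ p h]
      apply hS0
      by_contra hcon
      exact hp ⟨prod_mono Ioo_subset_Icc_self Ioo_subset_Icc_self h, (not_le.1 hcon).le⟩
    · exact hnQ p h
  · rw [← setIntegral_eq_integral_of_forall_compl_eq_zero (s := Q0)
      (fun p hp => by rw [hnQ p hp]; norm_num)]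
    have : ∫ p in Q0, dyPhi0 p ^ 2 ≤ ∫ p in Q0, (φ p ^ 2 + 8 * η) := by
      apply setIntegral_mono_on (dy_Q0_intOn _ (by fun_prop)) (dy_Q0_intOn _ (by fun_prop))
        dy_Q0_open.measurableSet
      intro p hp
      nlinarith [hge p hp, hb p, dyPhi0_le p, dyPhi0_pos hp]
    rw [dy_int_sq, integral_add (dy_Q0_intOn _ (by fun_prop)) (dy_Q0_intOn _ (by fun_prop))] at this
    simp [Measure.real, dy_Q0_vol] at this
    linarith
  · rw [← setIntegral_eq_integral_of_forall_compl_eq_zero (s := Q0)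
      (fun p hp => by rw [hnQ p hp]; norm_num), ← dy_int_four]
    apply setIntegral_mono_on (dy_Q0_intOn _ (by fun_prop)) (dy_Q0_intOn _ (by fun_prop))
        dy_Q0_open.measurableSet
    intro p hp
    exact pow_le_pow_left₀ (hb p).1 (hle p hp) 4
  · intro p b
    by_cases hp : p ∈ Q0
    · have e : fderiv ℝ (fun z => fderiv ℝ φ z (dyE b)) p (dyE b) =
          fderiv ℝ (fun z => fderiv ℝ (fun z => S (dyPhi0 z)) z (dyE b)) p (dyE b) := by
        have : (fun z => fderiv ℝ φ z (dyE b)) =ᶠ[𝓝 p]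
            (fun z => fderiv ℝ (fun z => S (dyPhi0 z)) z (dyE b)) := by
          filter_upwards [dy_Q0_open.mem_nhds hp] with z hz
          rw [(hin z hz).fderiv_eq]
        rw [this.fderiv_eq]
      rw [e, dy_second (fun z => S (dyPhi0 z)) (hS.comp dyPhi0_contDiff),
        dy_S_second S (fun t : ℝ => dyPhi0 (p + t • dyE b)) hS
          (dyPhi0_contDiff.comp (by fun_prop))]
      obtain ⟨_, -, h2⟩ := dyPhi0_line p b
      rw [h2]
      simp only [zero_smul, add_zero]
      set t := dyPhi0 p with ht
      have t0 : 0 < t := dyPhi0_pos hp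
      have h3 := hS3 t
      rw [hQ p hp, ← ht]
      have hφ2 := (hb p).2
      rw [hQ p hp, ← ht] at hφ2
      have k1 : 0 ≤ S t * (deriv (deriv S) t *
        (deriv (fun t : ℝ => dyPhi0 (p + t • dyE b)) 0) ^ 2) :=
        mul_nonneg h3.1 (mul_nonneg (hS2 t) (sq_nonneg _))
      have k2 : t * deriv S t * S t ≤ S t ^ 2 + 4 * η := by
        have : t * deriv S t ≤ t := by nlinarith [(hS1 t).2]
        nlinarith [h3.1, h3.2.1, mul_le_mul_of_nonneg_right this h3.1]
      nlinarith [mul_le_mul_of_nonneg_left k2 (sq_nonneg π)]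
    · rw [hnQ p hp]
      simp
      positivity

def dyq (v : Plane) : ℝ := v.1 ^ 2 + v.2 ^ 2
def dyu (v : Plane) : ℝ := dyq v / (2 + dyq v)
def dys (β : ℝ) (v : Plane) : ℝ := dyu v ^ (β / 2)
def dyrho (β : ℝ) (v : Plane) : ℝ := dys β v / √(dyq v)

lemma dyq_nonneg (v : Plane) : 0 ≤ dyq v := by unfold dyq; positivity
lemma dyq_pos {v : Plane} (hv : v ≠ 0) : 0 < dyq v := by
  unfold dyq
  by_contra h
  apply hv
  have h1 : v.1 = 0 := by nlinarith [sq_nonneg v.1, sq_nonneg v.2]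
  have h2 : v.2 = 0 := by nlinarith [sq_nonneg v.1, sq_nonneg v.2]
  exact Prod.ext h1 h2
lemma dyq_neg (v : Plane) : dyq (-v) = dyq v := by simp [dyq]
lemma dyu_nonneg (v : Plane) : 0 ≤ dyu v := by
  have := dyq_nonneg v; unfold dyu; positivity
lemma dyu_le_one (v : Plane) : dyu v ≤ 1 := by
  have := dyq_nonneg v
  unfold dyu; rw [div_le_one (by linarith)]; linarith
lemma dyu_pos {v : Plane} (hv : v ≠ 0) : 0 < dyu v := by
  have := dyq_pos hv; unfold dyu; positivity
lemma dyq_contDiff : ContDiff ℝ (⊤ : ℕ∞) dyq := by unfold dyq; fun_prop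
lemma dyu_contDiff : ContDiff ℝ (⊤ : ℕ∞) dyu := by
  unfold dyu
  apply dyq_contDiff.div (contDiff_const.add dyq_contDiff)
  intro v
  have := dyq_nonneg v
  positivity
lemma dys_nonneg (β : ℝ) (v : Plane) : 0 ≤ dys β v := rpow_nonneg (dyu_nonneg v) _
lemma dys_le_one {β : ℝ} (hβ : 0 < β) (v : Plane) : dys β v ≤ 1 :=
  rpow_le_one (dyu_nonneg v) (dyu_le_one v) (by positivity)
lemma dyrho_nonneg (β : ℝ) (v : Plane) : 0 ≤ dyrho β v :=
  div_nonneg (dys_nonneg _ _) (sqrt_nonneg _)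
lemma dys_continuous {β : ℝ} (hβ : 0 < β) : Continuous (dys β) :=
  dyu_contDiff.continuous.rpow_const fun _ => Or.inr (by positivity)
lemma dyrho_measurable {β : ℝ} (hβ : 0 < β) : Measurable (dyrho β) :=
  (dys_continuous hβ).measurable.div
    (dyq_contDiff.continuous.measurable.sqrt)

lemma dyu_fderiv (v : Plane) (e : Plane) :
    fderiv ℝ dyu v e = 4 * (v.1 * e.1 + v.2 * e.2) / (2 + dyq v) ^ 2 := by
  have hpos : 2 + dyq v ≠ 0 := by have := dyq_nonneg v; positivity
  have hl : HasDerivAt (fun t : ℝ => v + t • e) e 0 := by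
    simpa using ((hasDerivAt_id (0:ℝ)).smul_const e).const_add v
  have h1 : HasDerivAt (fun t : ℝ => dyu (v + t • e)) (fderiv ℝ dyu v e) 0 := by
    have := ((dyu_contDiff.differentiable (by simp)) (v + (0:ℝ) • e)).hasFDerivAt.comp_hasDerivAt 0 hl
    simpa [Function.comp_def] using this
  have hc : ∀ a b : ℝ, HasDerivAt (fun t : ℝ => (a + t * b) ^ 2) (2 * a * b) 0 := by
    intro a b
    have := ((((hasDerivAt_id (0:ℝ)).mul_const b).const_add a).pow 2)
    exact this.congr_deriv (by simp)
  have hq : HasDerivAt (fun t : ℝ => dyq (v + t • e)) (2 * v.1 * e.1 + 2 * v.2 * e.2) 0 := by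
    have := (hc v.1 e.1).add (hc v.2 e.2)
    exact this
  have h2 := hq.div (hq.const_add 2) (by simpa using hpos)
  have := h1.unique h2
  rw [this]
  simp only [zero_smul, add_zero]
  congr 1
  ring

lemma dy_log_bound {v : Plane} (hv : v ≠ 0) {β : ℝ} (hβ : 0 < β) :
    1 - dyu v ^ β ≤ β * (2.3 + 0.4 / √(dyq v)) := by
  have hq := dyq_pos hv
  have hu := dyu_pos hv
  set r := √(dyq v) with hr
  have hr0 : 0 < r := sqrt_pos.2 hq
  have hrq : dyq v = r ^ 2 := (sq_sqrt hq.le).symm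
  have h1 : 1 - dyu v ^ β ≤ - (β * log (dyu v)) := by
    rw [rpow_def_of_pos hu]
    have := add_one_le_exp (log (dyu v) * β)
    linarith
  have h2 : - log (dyu v) ≤ 2 * log (1 + √2 / r) := by
    rw [← log_inv, ← log_rpow (by positivity)]
    apply log_le_log (by positivity)
    have : (1 + √2 / r) ^ (2:ℝ) = (1 + √2 / r) ^ 2 := by exact_mod_cast rpow_natCast _ 2
    rw [this]
    unfold dyu
    rw [hrq, inv_div]
    have e : (1 + √2 / r) ^ 2 = (2 + r ^ 2) / r ^ 2 + 2 * (√2 / r) := by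
      have : √2 ^ 2 = 2 := sq_sqrt (by norm_num)
      field_simp
      nlinarith
    rw [e]
    have : 0 ≤ √2 / r := by positivity
    linarith
  have h3 : log (1 + √2 / r) ≤ exp (-2) * (1 + √2 / r) + 1 := by
    have := log_le_sub_one_of_pos (x := exp (-2) * (1 + √2 / r)) (by positivity)
    rw [log_mul (exp_ne_zero _) (by positivity), log_exp] at this
    linarith
  have h4 : exp (-2) ≤ 0.1354 := by
    rw [exp_neg, show (2:ℝ) = 1 + 1 by norm_num, exp_add]
    rw [inv_le_comm₀ (by positivity) (by norm_num)]
    have := exp_one_gt_d9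
    nlinarith
  have h5 : √2 ≤ 1.4143 := sqrt_le_iff.2 ⟨by norm_num, by norm_num⟩
  have h6 : √2 / r ≤ 1.4143 * (1 / r) := by
    rw [div_eq_mul_one_div]; gcongr
  have h7 : exp (-2) * (1 + √2 / r) ≤ 0.1354 * (1 + 1.4143 * (1 / r)) := by gcongr
  have h8 : 0 < 1 / r := by positivity
  have h9 : (0.4:ℝ) / r = 0.4 * (1 / r) := by ring
  rw [h9]
  have : - log (dyu v) ≤ 2.3 + 0.4 * (1 / r) := by
    linarith
  nlinarith

lemma dy_exists_w (β η : ℝ) (hβ : 0 < β) (hη : 0 < η) : ∃ w : Plane → ℝ,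
    ContDiff ℝ (⊤ : ℕ∞) w ∧ (∀ v, w (-v) = w v) ∧ (∀ v, 0 ≤ w v ∧ w v ≤ 1) ∧
    (∀ v, w v ^ 2 ≤ dys β v) ∧ (∃ U : Set Plane, IsOpen U ∧ 0 ∈ U ∧ ∀ v ∈ U, w v = 0) ∧
    (∀ v, ∃ l : ℝ, |l| ≤ β * dys β v / dyq v ∧
      ∀ e, fderiv ℝ (fun z => w z ^ 2) v e = l * (v.1 * e.1 + v.2 * e.2)) ∧
    (∀ v, v ≠ 0 → 1 - w v ^ 4 ≤ β * (2.3 + 0.4 / √(dyq v)) + 8 * η) := by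
  obtain ⟨S, hS, hS0, hS1, hS2, hS3⟩ := dy_exists_S η hη
  set σ : Plane → ℝ := fun v => dyu v ^ (β / 4) with hσ
  have hσc : Continuous σ := dyu_contDiff.continuous.rpow_const fun _ => Or.inr (by positivity)
  have hσ0 : ∀ v, 0 ≤ σ v := fun v => rpow_nonneg (dyu_nonneg v) _
  have hσ1 : ∀ v, σ v ≤ 1 := fun v => rpow_le_one (dyu_nonneg v) (dyu_le_one v) (by positivity)
  have hσ2 : ∀ v, σ v ^ 2 = dys β v := by
    intro v
    simp only [hσ, dys]
    rw [← rpow_natCast, ← rpow_mul (dyu_nonneg v)]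
    congr 1; push_cast; ring
  have hσ4 : ∀ v, σ v ^ 4 = dyu v ^ β := by
    intro v
    simp only [hσ]
    rw [← rpow_natCast, ← rpow_mul (dyu_nonneg v)]
    congr 1; push_cast; ring
  have hle : ∀ v, S (σ v) ≤ σ v := fun v => (hS3 _).2.2 (hσ0 v)
  have h0 : ∀ v, 0 ≤ S (σ v) := fun v => (hS3 _).1
  have hU : IsOpen {v | σ v < η} := isOpen_lt hσc continuous_const
  have hU0 : (0 : Plane) ∈ {v | σ v < η} := by
    show σ 0 < η
    have : dyu 0 = 0 := by simp [dyu, dyq]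
    simp only [hσ]
    rw [this, zero_rpow (by positivity)]
    exact hη
  have hUz : ∀ v ∈ {v | σ v < η}, S (σ v) = 0 := fun v hv => hS0 _ (le_of_lt hv)
  have hev : (fun v => S (σ v)) =ᶠ[𝓝 0] fun _ => 0 := by
    filter_upwards [hU.mem_nhds hU0] with v hv using hUz v hv
  refine ⟨fun v => S (σ v), ?_, ?_, ?_, ?_, ⟨_, hU, hU0, hUz⟩, ?_, ?_⟩
  · rw [contDiff_iff_contDiffAt]
    intro v
    by_cases hv : v = 0
    · subst hv
      exact contDiffAt_const.congr_of_eventuallyEq hev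
    · apply hS.contDiffAt.comp
      exact dyu_contDiff.contDiffAt.rpow_const_of_ne (dyu_pos hv).ne'
  · intro v
    simp only [hσ, dyu, dyq_neg]
  · exact fun v => ⟨h0 v, (hle v).trans (hσ1 v)⟩
  · intro v
    rw [← hσ2]
    exact pow_le_pow_left₀ (h0 v) (hle v) 2
  · intro v
    by_cases hv : v = 0
    · subst hv
      refine ⟨0, by simp [dyq], ?_⟩
      intro e
      have : (fun z => S (σ z) ^ 2) =ᶠ[𝓝 0] fun _ => (0:ℝ) := by
        filter_upwards [hev] with z hz
        rw [hz]; norm_num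
      rw [this.fderiv_eq]
      simp
    · have hu := dyu_pos hv
      have hq := dyq_pos hv
      refine ⟨2 * S (σ v) * (deriv S (σ v) * (β / 4 * dyu v ^ (β / 4 - 1))) * (4 / (2 + dyq v) ^ 2), ?_, ?_⟩
      · have e1 : dyu v ^ (β / 4 - 1) = σ v * ((2 + dyq v) / dyq v) := by
          rw [rpow_sub_one hu.ne']
          simp only [hσ]
          rw [div_eq_mul_inv]
          congr 1
          unfold dyu
          rw [inv_div]
        rw [e1]
        have hs0 := hσ0 v
        have hd := hS1 (σ v)
        have hh := h0 v
        rw [abs_of_nonneg (by have := hd.1; positivity)]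
        calc 2 * S (σ v) * (deriv S (σ v) * (β / 4 * (σ v * ((2 + dyq v) / dyq v)))) * (4 / (2 + dyq v) ^ 2)
            ≤ 2 * σ v * (1 * (β / 4 * (σ v * ((2 + dyq v) / dyq v)))) * (4 / (2 + dyq v) ^ 2) := by
              have := hle v
              have := hd.1
              have := hd.2
              gcongr
          _ = β * σ v ^ 2 / dyq v * (2 / (2 + dyq v)) := by field_simp
          _ ≤ β * σ v ^ 2 / dyq v * 1 := by
              gcongr
              rw [div_le_one (by positivity)]
              linarith
          _ = _ := by rw [hσ2, mul_one]
      · intro e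
        have h1 := ((dyu_contDiff.differentiable (by simp)) v).hasFDerivAt
        have h2 : HasDerivAt (fun u : ℝ => S (u ^ (β / 4)) ^ 2)
            (2 * S (σ v) * (deriv S (σ v) * (β / 4 * dyu v ^ (β / 4 - 1)))) (dyu v) := by
          have a1 := hasDerivAt_rpow_const (x := dyu v) (p := β / 4) (Or.inl hu.ne')
          have a2 := ((hS.differentiable (by simp) (σ v)).hasDerivAt.comp (dyu v) a1).pow 2
          exact a2.congr_deriv (by simp [hσ])
        have h3 := (h2.comp_hasFDerivAt v h1).fderiv
        have h4 : (fun z => S (σ z) ^ 2) = (fun u : ℝ => S (u ^ (β / 4)) ^ 2) ∘ dyu := rfl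
        rw [h4, h3, smul_apply, dyu_fderiv, smul_eq_mul]
        ring
  · intro v hv
    have h1 := dy_log_bound hv hβ
    rw [← hσ4] at h1
    have h2 : σ v ^ 4 - S (σ v) ^ 4 ≤ 8 * η := by
      have a := hle v
      have b := h0 v
      have c := hσ1 v
      have d := (hS3 (σ v)).2.1
      set x := σ v
      set y := S x
      have e : x ^ 4 - y ^ 4 = (x - y) * (x ^ 3 + x ^ 2 * y + x * y ^ 2 + y ^ 3) := by ring
      have hx0 : 0 ≤ x := hσ0 v
      have hy1 : y ≤ 1 := a.trans c
      have f : x ^ 3 + x ^ 2 * y + x * y ^ 2 + y ^ 3 ≤ 4 := by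
        have : x ^ 3 ≤ 1 := pow_le_one₀ hx0 c
        have : y ^ 3 ≤ 1 := pow_le_one₀ b hy1
        have : x ^ 2 * y ≤ 1 := mul_le_one₀ (pow_le_one₀ hx0 c) b hy1
        have : x * y ^ 2 ≤ 1 := mul_le_one₀ c (by positivity) (pow_le_one₀ b hy1)
        linarith
      rw [e]
      calc _ ≤ (2 * η) * 4 := by
            apply mul_le_mul _ f (by positivity) (by positivity)
            linarith
        _ = _ := by ring
    linarith

open ENNReal in
lemma dy_rpow_lint (p R : ℝ) (hp : 0 < p) (hR : 0 < R) :
    ∫⁻ r in Ioo 0 R, ENNReal.ofReal (r ^ (p - 1)) = ENNReal.ofReal (R ^ p / p) := by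
  have h1 : (∫ r in (0:ℝ)..R, r ^ (p - 1)) = R ^ p / p := by
    rw [integral_rpow (Or.inl (by linarith))]
    simp [zero_rpow hp.ne']
  rw [intervalIntegral.integral_of_le hR.le, integral_Ioc_eq_integral_Ioo] at h1
  rw [← h1, ofReal_integral_eq_lintegral_ofReal]
  · have := (intervalIntegral.intervalIntegrable_rpow' (a := 0) (b := R) (r := p - 1) (by linarith))
    exact ((intervalIntegrable_iff_integrableOn_Ioo_of_le hR.le).1 this)
  · filter_upwards [ae_restrict_mem measurableSet_Ioo] with r hr
    exact rpow_nonneg hr.1.le _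

lemma dyq_measurable : Measurable dyq := dyq_contDiff.continuous.measurable

lemma dy_polar (p R : ℝ) (hp : 0 < p) (hR : 0 < R) :
    ∫⁻ v : Plane, ({v | dyq v < R ^ 2} : Set Plane).indicator
      (fun v => ENNReal.ofReal (√(dyq v) ^ (p - 2))) v = ENNReal.ofReal (2 * π * R ^ p / p) := by
  rw [← lintegral_comp_polarCoord_symm]
  have h1 : ∀ z ∈ polarCoord.target, ENNReal.ofReal z.1 • ({v | dyq v < R ^ 2} : Set Plane).indicator
      (fun v => ENNReal.ofReal (√(dyq v) ^ (p - 2))) (polarCoord.symm z) =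
      ((Ioo 0 R).indicator (fun r => ENNReal.ofReal (r ^ (p - 1))) z.1) * (fun _ : ℝ => 1) z.2 := by
    intro z hz
    have hz0 : 0 < z.1 := hz.1
    have hq : dyq (polarCoord.symm z) = z.1 ^ 2 := by
      simp only [dyq, polarCoord_symm_apply]
      nlinarith [sin_sq_add_cos_sq z.2]
    by_cases h : z.1 < R
    · rw [indicator_of_mem, indicator_of_mem]
      · rw [hq, sqrt_sq hz0.le, smul_eq_mul, ← ENNReal.ofReal_mul hz0.le, mul_one]
        congr 1
        rw [show p - 1 = 1 + (p - 2) by ring, rpow_add hz0, rpow_one]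
      · exact ⟨hz0, h⟩
      · have h2 : dyq (polarCoord.symm z) < R ^ 2 := by
          rw [hq]; gcongr
        exact h2
    · rw [indicator_of_notMem, indicator_of_notMem]
      · simp
      · exact fun h' => h h'.2
      · intro h'
        replace h' : dyq (polarCoord.symm z) < R ^ 2 := h'
        rw [hq] at h'
        exact h (lt_of_pow_lt_pow_left₀ 2 hR.le h')
  rw [setLIntegral_congr_fun polarCoord.open_target.measurableSet h1]
  have ht : polarCoord.target = Ioi (0:ℝ) ×ˢ Ioo (-π) π := rfl
  rw [ht, Measure.volume_eq_prod, ← Measure.prod_restrict, lintegral_prod_mul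
      (f := (Ioo 0 R).indicator (fun r => ENNReal.ofReal (r ^ (p - 1)))) (g := fun _ => 1)]
  · rw [lintegral_indicator measurableSet_Ioo, Measure.restrict_restrict measurableSet_Ioo,
      inter_eq_left.2 Ioo_subset_Ioi_self, dy_rpow_lint p R hp hR]
    simp only [lintegral_const, Measure.restrict_apply_univ, Real.volume_Ioo, one_mul]
    rw [← ENNReal.ofReal_mul (by positivity)]
    congr 1
    ring
  · apply Measurable.aemeasurable
    apply Measurable.indicator _ measurableSet_Ioo
    fun_prop
  · fun_prop

lemma dy_P1 (d : Plane → ℝ) (hd : Measurable d) (D : ℝ) (hD : ∀ p, d p ≤ D) (hD0 : 0 ≤ D)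
    (h1 : ∫⁻ p, ENNReal.ofReal (d p) = 1) (y : Plane) :
    ∫⁻ x, ENNReal.ofReal (1 / √(dyq (x - y))) * ENNReal.ofReal (d x) ≤
      ENNReal.ofReal (5 + 2 * π * D / 5) := by
  set F : Plane → ENNReal := ({v | dyq v < (1/5 : ℝ) ^ 2} : Set Plane).indicator
      (fun v => ENNReal.ofReal (√(dyq v) ^ ((1:ℝ) - 2))) with hF
  have hFm : Measurable F := by
    apply Measurable.indicator
    · have := dyq_measurable
      fun_prop
    · exact measurableSet_lt dyq_measurable measurable_const
  have hI : ∫⁻ v, F v = ENNReal.ofReal (2 * π / 5) := by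
    rw [hF, dy_polar 1 (1/5) one_pos (by norm_num)]
    congr 1
    rw [rpow_one]; ring
  have hpt : ∀ v : Plane, ENNReal.ofReal (1 / √(dyq v)) ≤ 5 + F v := by
    intro v
    by_cases h : dyq v < (1/5 : ℝ) ^ 2
    · rw [hF, indicator_of_mem (by exact h)]
      apply le_add_left
      apply ENNReal.ofReal_le_ofReal
      rw [show (1:ℝ) - 2 = -1 by norm_num, rpow_neg_one, one_div]
    · apply le_add_right
      rw [show (5 : ENNReal) = ENNReal.ofReal 5 by simp]
      apply ENNReal.ofReal_le_ofReal
      push Not at h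
      have : (1/5 : ℝ) ≤ √(dyq v) := le_sqrt_of_sq_le h
      rw [div_le_iff₀ (by linarith)]
      linarith
  calc _ ≤ ∫⁻ x, (5 * ENNReal.ofReal (d x) + ENNReal.ofReal D * F (x - y)) := by
        apply lintegral_mono
        intro x
        calc ENNReal.ofReal (1 / √(dyq (x - y))) * ENNReal.ofReal (d x)
            ≤ (5 + F (x - y)) * ENNReal.ofReal (d x) := by gcongr; exact hpt _
          _ ≤ _ := by
            rw [add_mul]
            refine add_le_add le_rfl ?_
            rw [mul_comm]
            gcongr
            exact hD x
    _ = _ := by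
        rw [lintegral_add_left (by fun_prop), lintegral_const_mul _ (by fun_prop), h1,
          lintegral_const_mul _ (by fun_prop), lintegral_sub_right_eq_self F y, hI,
          ← ENNReal.ofReal_mul hD0, mul_one, show (5 : ENNReal) = ENNReal.ofReal 5 by simp,
          ← ENNReal.ofReal_add (by norm_num) (by positivity)]
        congr 1; ring

lemma dy_P2 (β : ℝ) (hβ : 0 < β) (d : Plane → ℝ) (hd : Measurable d) (hd0 : ∀ p, 0 ≤ d p)
    (hdQ : ∀ p ∉ Q0, d p = 0) :
    ∫⁻ x, (∫⁻ y, ENNReal.ofReal (dyrho β (x - y) ^ 2) * ENNReal.ofReal (d y)) * ENNReal.ofReal (d x) ≤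
      (∫⁻ x, ENNReal.ofReal (d x ^ 2)) * ENNReal.ofReal (π / β) := by
  set F : Plane → ENNReal := ({v | dyq v < (√2) ^ 2} : Set Plane).indicator
      (fun v => ENNReal.ofReal (√(dyq v) ^ (2 * β - 2))) with hF
  have hFm : Measurable F := by
    apply Measurable.indicator
    · have := dyq_measurable
      fun_prop
    · exact measurableSet_lt dyq_measurable measurable_const
  set k : ENNReal := ENNReal.ofReal (2 ^ (-β)) with hk
  have hI : k * ∫⁻ v, F v = ENNReal.ofReal (π / β) := by
    rw [hF, dy_polar (2 * β) (√2) (by positivity) (by positivity), hk,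
      ← ENNReal.ofReal_mul (by positivity)]
    congr 1
    have : √2 ^ (2 * β) = 2 ^ β := by
      rw [rpow_mul (by positivity)]
      congr 1
      have := sq_sqrt (show (0:ℝ) ≤ 2 by norm_num)
      exact_mod_cast this
    rw [this, rpow_neg (by norm_num)]
    field_simp
  have hpt : ∀ v : Plane, dyq v < √2 ^ 2 → ENNReal.ofReal (dyrho β v ^ 2) ≤ k * F v := by
    intro v hv
    rw [hF, indicator_of_mem (by exact hv), hk, ← ENNReal.ofReal_mul (by positivity)]
    apply ENNReal.ofReal_le_ofReal
    by_cases h0 : v = 0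
    · subst h0
      simp [dyrho, dyq]
      positivity
    · have hq := dyq_pos h0
      have hr : 0 < √(dyq v) := sqrt_pos.2 hq
      have e1 : √(dyq v) ^ (2 * β - 2) = dyq v ^ β / dyq v := by
        rw [rpow_sub hr, rpow_mul hr.le]
        have : √(dyq v) ^ (2:ℝ) = dyq v := by
          have := sq_sqrt hq.le
          exact_mod_cast this
        rw [this]
      have e2 : dys β v ^ 2 = dyu v ^ β := by
        unfold dys
        rw [← rpow_natCast, ← rpow_mul (dyu_nonneg v)]
        congr 1; push_cast; ring
      rw [dyrho, div_pow, sq_sqrt hq.le, e2, e1, ← mul_div_assoc]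
      gcongr
      calc dyu v ^ β ≤ (dyq v / 2) ^ β := by
            apply rpow_le_rpow (dyu_nonneg v) _ hβ.le
            unfold dyu
            gcongr
            linarith
        _ = _ := by
          rw [div_rpow hq.le (by norm_num), rpow_neg (by norm_num)]
          field_simp
  have hpt2 : ∀ x y : Plane, ENNReal.ofReal (dyrho β (x - y) ^ 2) * ENNReal.ofReal (d y) *
      ENNReal.ofReal (d x) ≤ ENNReal.ofReal (d x ^ 2 / 2) * (k * F (x - y)) +
        ENNReal.ofReal (d y ^ 2 / 2) * (k * F (x - y)) := by
    intro x y
    by_cases hx : x ∈ Q0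
    · by_cases hy : y ∈ Q0
      · have hq : dyq (x - y) < √2 ^ 2 := by
          rw [sq_sqrt (by norm_num)]
          obtain ⟨⟨a1, a2⟩, a3, a4⟩ := hx
          obtain ⟨⟨b1, b2⟩, b3, b4⟩ := hy
          simp only [dyq, Prod.fst_sub, Prod.snd_sub]
          nlinarith
        rw [← add_mul, ← ENNReal.ofReal_add (by positivity) (by positivity), mul_assoc,
          ← ENNReal.ofReal_mul (hd0 y), mul_comm]
        gcongr
        · nlinarith [sq_nonneg (d x - d y)]
        · exact hpt _ hq
      · simp [hdQ y hy]
    · simp [hdQ x hx]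
  have hkm : Measurable fun v => k * F v := by fun_prop
  calc _ = ∫⁻ x, ∫⁻ y, ENNReal.ofReal (dyrho β (x - y) ^ 2) * ENNReal.ofReal (d y) *
      ENNReal.ofReal (d x) := by
        congr 1; ext x
        rw [lintegral_mul_const]
        have := dyrho_measurable hβ
        fun_prop
    _ ≤ ∫⁻ x, ∫⁻ y, (ENNReal.ofReal (d x ^ 2 / 2) * (k * F (x - y)) +
        ENNReal.ofReal (d y ^ 2 / 2) * (k * F (x - y))) := by
        apply lintegral_mono; intro x
        apply lintegral_mono; intro y
        exact hpt2 x y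
    _ = (∫⁻ x, ∫⁻ y, ENNReal.ofReal (d x ^ 2 / 2) * (k * F (x - y))) +
        (∫⁻ x, ∫⁻ y, ENNReal.ofReal (d y ^ 2 / 2) * (k * F (x - y))) := by
        rw [← lintegral_add_left]
        · congr 1; ext x
          rw [lintegral_add_left (by fun_prop)]
        · apply Measurable.lintegral_prod_right' (f := fun z : Plane × Plane =>
            ENNReal.ofReal (d z.1 ^ 2 / 2) * (k * F (z.1 - z.2)))
          fun_prop
    _ = (∫⁻ x, ENNReal.ofReal (d x ^ 2 / 2)) * ENNReal.ofReal (π / β) +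
        (∫⁻ x, ENNReal.ofReal (d x ^ 2 / 2)) * ENNReal.ofReal (π / β) := by
        congr 1
        · rw [← lintegral_mul_const _ (by fun_prop)]
          congr 1; ext x
          rw [lintegral_const_mul _ (by fun_prop), lintegral_sub_left_eq_self (fun v => k * F v) x,
            lintegral_const_mul _ hFm, hI]
        · rw [lintegral_lintegral_swap (by
            apply Measurable.aemeasurable
            unfold Function.uncurry
            fun_prop), ← lintegral_mul_const _ (by fun_prop)]
          congr 1; ext x
          rw [lintegral_const_mul _ (by fun_prop), lintegral_sub_right_eq_self (fun v => k * F v) x,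
            lintegral_const_mul _ hFm, hI]
    _ = _ := by
        rw [← add_mul, ← lintegral_add_left (by fun_prop)]
        congr 2; ext x
        rw [← ENNReal.ofReal_add (by positivity) (by positivity)]
        congr 1; ring

lemma dy_one_le (ι : Type) (A : Finset ι) (a : ι → ℝ) (h : ∀ i, 0 ≤ a i ∧ a i ≤ 1) :
    1 ≤ ∏ i ∈ A, a i + ∑ i ∈ A, (1 - a i) := by
  classical
  induction A using Finset.induction_on with
  | empty => simp
  | insert i A hi ih =>
    rw [Finset.prod_insert hi, Finset.sum_insert hi]
    have h1 : ∏ i ∈ A, a i ≤ 1 := Finset.prod_le_one (fun i _ => (h i).1) (fun i _ => (h i).2)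
    nlinarith [h i, mul_nonneg (sub_nonneg.2 (h i).2) (sub_nonneg.2 h1)]

/-- product of a weight over ordered pairs of distinct elements -/
def dyg {N : ℕ} (w : Plane → ℝ) (A : Finset (Fin N)) (x : Config N) : ℝ :=
  ∏ a ∈ A, ∏ b ∈ A.erase a, w (x a - x b)

lemma dyg_insert {N : ℕ} (w : Plane → ℝ) (hw : ∀ v, w (-v) = w v) (A : Finset (Fin N))
    (i : Fin N) (hi : i ∉ A) (x : Config N) :
    dyg w (insert i A) x = dyg w A x * ∏ a ∈ A, w (x i - x a) ^ 2 := by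
  unfold dyg
  rw [Finset.prod_insert hi, Finset.erase_insert hi]
  have h1 : ∀ a ∈ A, ∏ b ∈ (insert i A).erase a, w (x a - x b) =
      w (x i - x a) * ∏ b ∈ A.erase a, w (x a - x b) := by
    intro a ha
    have hia : i ≠ a := fun h => hi (h ▸ ha)
    rw [Finset.erase_insert_of_ne hia, Finset.prod_insert (by simp [hi])]
    rw [← hw (x a - x i), neg_sub]
  rw [Finset.prod_congr rfl h1, Finset.prod_mul_distrib, Finset.prod_pow]
  ring

lemma dyg_update {N : ℕ} (w : Plane → ℝ) (A : Finset (Fin N))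
    (i : Fin N) (hi : i ∉ A) (x : Config N) (t : Plane) :
    dyg w A (Function.update x i t) = dyg w A x := by
  unfold dyg
  refine Finset.prod_congr rfl fun a ha => Finset.prod_congr rfl fun b hb => ?_
  have h1 : a ≠ i := fun h => hi (h ▸ ha)
  have h2 : b ≠ i := fun h => hi (h ▸ (Finset.mem_erase.1 hb).2)
  rw [Function.update_of_ne h1, Function.update_of_ne h2]

lemma dyg_nonneg {N : ℕ} (w : Plane → ℝ) (hw : ∀ v, 0 ≤ w v) (A : Finset (Fin N)) (x : Config N) :
    0 ≤ dyg w A x :=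
  Finset.prod_nonneg fun _ _ => Finset.prod_nonneg fun _ _ => hw _

lemma dyg_le_one {N : ℕ} (w : Plane → ℝ) (hw : ∀ v, 0 ≤ w v ∧ w v ≤ 1) (A : Finset (Fin N))
    (x : Config N) : dyg w A x ≤ 1 :=
  Finset.prod_le_one (fun _ _ => Finset.prod_nonneg fun _ _ => (hw _).1)
    fun _ _ => Finset.prod_le_one (fun _ _ => (hw _).1) fun _ _ => (hw _).2

lemma dyg_anti {N : ℕ} (w : Plane → ℝ) (hw : ∀ v, 0 ≤ w v ∧ w v ≤ 1) (hn : ∀ v, w (-v) = w v)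
    (A : Finset (Fin N)) (i : Fin N) (x : Config N) : dyg w A x ≤ dyg w (A.erase i) x := by
  by_cases h : i ∈ A
  · conv_lhs => rw [← Finset.insert_erase h]
    rw [dyg_insert w hn _ _ (by simp)]
    refine mul_le_of_le_one_right (dyg_nonneg w (fun v => (hw v).1) _ _) ?_
    exact Finset.prod_le_one (fun _ _ => sq_nonneg _) fun _ _ => pow_le_one₀ (hw _).1 (hw _).2
  · rw [Finset.erase_eq_of_notMem h]

lemma dyg_continuous {N : ℕ} (w : Plane → ℝ) (hw : Continuous w) (A : Finset (Fin N)) :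
    Continuous (dyg w A) := by
  unfold dyg
  refine continuous_finsetProd _ fun a _ => continuous_finsetProd _ fun b _ => ?_
  fun_prop

lemma dyg_contDiff {N : ℕ} (w : Plane → ℝ) (hw : ContDiff ℝ (⊤ : ℕ∞) w) (A : Finset (Fin N)) :
    ContDiff ℝ (⊤ : ℕ∞) (dyg w A) := by
  unfold dyg
  refine contDiff_prod fun a _ => contDiff_prod fun b _ => ?_
  fun_prop

section resample
variable {N : ℕ} (ν : Measure Plane) [IsProbabilityMeasure ν]

lemma dy_res_le (i : Fin N) (G H : Config N → ENNReal) (hG : Measurable G) (hH : Measurable H)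
    (hi : ∀ x t, H (Function.update x i t) = H x)
    (h : ∀ x, ∫⁻ t, G (Function.update x i t) ∂ν ≤ H x) :
    ∫⁻ x, G x ∂(Measure.pi fun _ => ν) ≤ ∫⁻ x, H x ∂(Measure.pi fun _ => ν) := by
  refine lintegral_le_of_lmarginal_le {i} hG hH ?_
  rw [lmarginal_singleton, lmarginal_singleton]
  intro x
  simp only [hi]
  simpa using h x

lemma dy_res_ge (i : Fin N) (G H : Config N → ENNReal) (hG : Measurable G) (hH : Measurable H)
    (hi : ∀ x t, H (Function.update x i t) = H x)
    (h : ∀ x, H x ≤ ∫⁻ t, G (Function.update x i t) ∂ν) :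
    ∫⁻ x, H x ∂(Measure.pi fun _ => ν) ≤ ∫⁻ x, G x ∂(Measure.pi fun _ => ν) := by
  refine lintegral_le_of_lmarginal_le {i} hH hG ?_
  rw [lmarginal_singleton, lmarginal_singleton]
  intro x
  simp only [hi]
  simpa using h x

/-- the normalization integral of a subset of particles -/
def dyZ (w : Plane → ℝ) (A : Finset (Fin N)) : ENNReal :=
  ∫⁻ x : Config N, ENNReal.ofReal (dyg w A x ^ 2) ∂(Measure.pi fun _ => ν)

variable (w : Plane → ℝ)

lemma dyg_meas (hwc : Continuous w)
    (A : Finset (Fin N)) :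
    Measurable fun x : Config N => ENNReal.ofReal (dyg w A x ^ 2) := by
  have := (dyg_continuous w hwc A).measurable
  fun_prop

lemma dyZ_insert (hwc : Continuous w) (hw : ∀ v, 0 ≤ w v ∧ w v ≤ 1) (hn : ∀ v, w (-v) = w v)
    (δ : ℝ) (hδ0 : 0 ≤ δ)
    (hδ : ∀ y, ∫⁻ t, ENNReal.ofReal (1 - w (t - y) ^ 4) ∂ν ≤ ENNReal.ofReal δ)
    (A : Finset (Fin N)) (i : Fin N) (hi : i ∉ A) :
    ENNReal.ofReal (1 - N * δ) * dyZ ν w A ≤ dyZ ν w (insert i A) := by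
  unfold dyZ
  rw [← lintegral_const_mul _ (dyg_meas w hwc A)]
  refine dy_res_ge ν i _ _ (dyg_meas w hwc _) ((dyg_meas w hwc A).const_mul _) ?_ ?_
  · intro x t
    rw [dyg_update w A i hi]
  · intro x
    have e1 : ∀ t, ENNReal.ofReal (dyg w (insert i A) (Function.update x i t) ^ 2) =
        ENNReal.ofReal (dyg w A x ^ 2) * ENNReal.ofReal (∏ a ∈ A, w (t - x a) ^ 4) := by
      intro t
      rw [dyg_insert w hn A i hi, dyg_update w A i hi, ← ENNReal.ofReal_mul (sq_nonneg _), mul_pow,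
        ← Finset.prod_pow]
      congr 2
      refine Finset.prod_congr rfl fun a ha => ?_
      have h1 : a ≠ i := fun h => hi (h ▸ ha)
      rw [Function.update_of_ne h1, Function.update_self]
      ring
    have hm : ∀ y, Measurable fun t => w (t - y) := fun y => by
      have := hwc.measurable
      fun_prop
    simp only [e1]
    rw [lintegral_const_mul _ (by fun_prop), mul_comm]
    gcongr
    rw [ENNReal.ofReal_sub _ (by positivity), tsub_le_iff_right, ENNReal.ofReal_one]
    calc (1 : ENNReal) = ∫⁻ t, 1 ∂ν := by simp
      _ ≤ ∫⁻ t, (ENNReal.ofReal (∏ a ∈ A, w (t - x a) ^ 4) +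
            ∑ a ∈ A, ENNReal.ofReal (1 - w (t - x a) ^ 4)) ∂ν := by
          apply lintegral_mono
          intro t
          have h0 : ∀ a, 0 ≤ w (t - x a) ^ 4 ∧ w (t - x a) ^ 4 ≤ 1 := fun a =>
            ⟨pow_nonneg (hw _).1 _, pow_le_one₀ (hw _).1 (hw _).2⟩
          dsimp only
          rw [← ENNReal.ofReal_sum_of_nonneg (fun a _ => sub_nonneg.2 (h0 a).2),
            ← ENNReal.ofReal_add (Finset.prod_nonneg fun a _ => (h0 a).1)
              (Finset.sum_nonneg fun a _ => sub_nonneg.2 (h0 a).2), ← ENNReal.ofReal_one]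
          exact ENNReal.ofReal_le_ofReal (dy_one_le _ A _ h0)
      _ = (∫⁻ t, ENNReal.ofReal (∏ a ∈ A, w (t - x a) ^ 4) ∂ν) +
            ∑ a ∈ A, ∫⁻ t, ENNReal.ofReal (1 - w (t - x a) ^ 4) ∂ν := by
          rw [lintegral_add_left (by fun_prop), lintegral_finsetSum _ (by fun_prop)]
      _ ≤ _ := by
          gcongr
          calc _ ≤ ∑ a ∈ A, ENNReal.ofReal δ := Finset.sum_le_sum fun a _ => hδ _
            _ = A.card * ENNReal.ofReal δ := by simp
            _ ≤ N * ENNReal.ofReal δ := by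
              gcongr
              simpa using Finset.card_le_univ A
            _ = _ := by rw [ENNReal.ofReal_mul (by positivity)]; simp

lemma dyZ_le_one (hw : ∀ v, 0 ≤ w v ∧ w v ≤ 1)
    (A : Finset (Fin N)) : dyZ ν w A ≤ 1 := by
  unfold dyZ
  calc _ ≤ ∫⁻ x : Config N, 1 ∂(Measure.pi fun _ => ν) := by
        apply lintegral_mono
        intro x
        rw [← ENNReal.ofReal_one]
        apply ENNReal.ofReal_le_ofReal
        exact pow_le_one₀ (dyg_nonneg w (fun v => (hw v).1) _ _) (dyg_le_one w hw _ _)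
    _ = 1 := by simp

lemma dyZ_empty : dyZ ν w (∅ : Finset (Fin N)) = 1 := by
  simp [dyZ, dyg]

lemma dyZ_lower (hwc : Continuous w) (hw : ∀ v, 0 ≤ w v ∧ w v ≤ 1) (hn : ∀ v, w (-v) = w v)
    (δ : ℝ) (hδ0 : 0 ≤ δ)
    (hδ : ∀ y, ∫⁻ t, ENNReal.ofReal (1 - w (t - y) ^ 4) ∂ν ≤ ENNReal.ofReal δ)
    (A : Finset (Fin N)) :
    ENNReal.ofReal (1 - N * δ) ^ A.card ≤ dyZ ν w A := by
  induction A using Finset.induction_on with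
  | empty => simp [dyZ_empty]
  | insert i A hi ih =>
    rw [Finset.card_insert_of_notMem hi, pow_succ, mul_comm]
    refine le_trans ?_ (dyZ_insert ν w hwc hw hn δ hδ0 hδ A i hi)
    gcongr

lemma dyZ_diag (hwc : Continuous w) (hw : ∀ v, 0 ≤ w v ∧ w v ≤ 1) (hn : ∀ v, w (-v) = w v)
    (R : Plane → ENNReal) (hR : Measurable R) (C : ENNReal)
    (hC : ∫⁻ x, (∫⁻ y, R (x - y) ∂ν) ∂ν ≤ C) (j k : Fin N) (hjk : j ≠ k) :
    ∫⁻ x : Config N, ENNReal.ofReal (dyg w (Finset.univ.erase j) x ^ 2) * R (x j - x k)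
      ∂(Measure.pi fun _ => ν) ≤ C * dyZ ν w ((Finset.univ.erase j).erase k) := by
  set B := (Finset.univ.erase j).erase k with hB
  have hm := dyg_meas w hwc B
  have hjB : j ∉ B := by simp [hB]
  have hkB : k ∉ B := by simp [hB]
  have hm1 : Measurable fun x => ∫⁻ y, R (x - y) ∂ν :=
    Measurable.lintegral_prod_right' (f := fun z : Plane × Plane => R (z.1 - z.2)) (by fun_prop)
  calc _ ≤ ∫⁻ x : Config N, ENNReal.ofReal (dyg w B x ^ 2) * R (x j - x k)
        ∂(Measure.pi fun _ => ν) := by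
        apply lintegral_mono
        intro x
        dsimp only
        gcongr
        · exact dyg_nonneg w (fun v => (hw v).1) _ _
        · exact dyg_anti w hw hn _ _ _
    _ ≤ ∫⁻ x : Config N, ENNReal.ofReal (dyg w B x ^ 2) * (∫⁻ y, R (x j - y) ∂ν)
        ∂(Measure.pi fun _ => ν) := by
        refine dy_res_le ν k _ _ (by fun_prop) (by fun_prop) ?_ ?_
        · intro x t
          rw [dyg_update w B k hkB, Function.update_of_ne hjk]
        · intro x
          simp only [dyg_update w B k hkB, Function.update_of_ne hjk, Function.update_self]
          rw [lintegral_const_mul _ (by fun_prop)]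
    _ ≤ ∫⁻ x : Config N, C * ENNReal.ofReal (dyg w B x ^ 2)
        ∂(Measure.pi fun _ => ν) := by
        refine dy_res_le ν j _ _ (by fun_prop) (by fun_prop) ?_ ?_
        · intro x t
          rw [dyg_update w B j hjB]
        · intro x
          simp only [dyg_update w B j hjB, Function.update_self]
          rw [lintegral_const_mul _ (by fun_prop), mul_comm]
          gcongr
    _ = _ := by
        rw [lintegral_const_mul _ hm]
        rfl

lemma dyZ_offdiag (hwc : Continuous w) (hw : ∀ v, 0 ≤ w v ∧ w v ≤ 1) (hn : ∀ v, w (-v) = w v)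
    (R : Plane → ENNReal) (hR : Measurable R) (hRn : ∀ v, R (-v) = R v) (K : ENNReal)
    (hK : ∀ y, ∫⁻ x, R (x - y) ∂ν ≤ K) (j k l : Fin N) (hjk : j ≠ k) (hjl : j ≠ l) (hkl : k ≠ l) :
    ∫⁻ x : Config N, ENNReal.ofReal (dyg w (Finset.univ.erase j) x ^ 2) *
      (R (x j - x k) * R (x j - x l))
      ∂(Measure.pi fun _ => ν) ≤ K ^ 2 * dyZ ν w (((Finset.univ.erase j).erase k).erase l) := by
  set B := ((Finset.univ.erase j).erase k).erase l with hB
  have hm := dyg_meas w hwc B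
  have hkB : k ∉ B := by simp [hB]
  have hlB : l ∉ B := by simp [hB]
  have hK' : ∀ y, ∫⁻ x, R (y - x) ∂ν ≤ K := by
    intro y
    convert hK y using 3 with x
    rw [← hRn, neg_sub]
  calc _ ≤ ∫⁻ x : Config N, ENNReal.ofReal (dyg w B x ^ 2) * (R (x j - x k) * R (x j - x l))
        ∂(Measure.pi fun _ => ν) := by
        apply lintegral_mono
        intro x
        dsimp only
        gcongr
        · exact dyg_nonneg w (fun v => (hw v).1) _ _
        · exact (dyg_anti w hw hn _ k _).trans (dyg_anti w hw hn _ _ _)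
    _ ≤ ∫⁻ x : Config N, ENNReal.ofReal (dyg w B x ^ 2) * (R (x j - x k) * K)
        ∂(Measure.pi fun _ => ν) := by
        refine dy_res_le ν l _ _ (by fun_prop) (by fun_prop) ?_ ?_
        · intro x t
          rw [dyg_update w B l hlB, Function.update_of_ne hjl, Function.update_of_ne hkl]
        · intro x
          simp only [dyg_update w B l hlB, Function.update_of_ne hjl, Function.update_of_ne hkl,
            Function.update_self]
          rw [lintegral_const_mul _ (by fun_prop), lintegral_const_mul _ (by fun_prop)]
          gcongr
          exact hK' _
    _ ≤ ∫⁻ x : Config N, K ^ 2 * ENNReal.ofReal (dyg w B x ^ 2)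
        ∂(Measure.pi fun _ => ν) := by
        refine dy_res_le ν k _ _ (by fun_prop) (by fun_prop) ?_ ?_
        · intro x t
          rw [dyg_update w B k hkB]
        · intro x
          simp only [dyg_update w B k hkB, Function.update_of_ne hjk, Function.update_self]
          rw [lintegral_const_mul _ (by fun_prop), lintegral_mul_const _ (by fun_prop), mul_comm, sq K]
          exact mul_le_mul_left (mul_le_mul_left (hK' _) _) _
    _ = _ := by
        rw [lintegral_const_mul _ hm]
        rfl

end resample

lemma dy_pi_withDensity {N : ℕ} (d : Plane → ℝ) (hd : Measurable d) (hd0 : ∀ p, 0 ≤ d p)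
    (hi : Integrable d) :
    Measure.pi (fun _ : Fin N => (volume : Measure Plane).withDensity fun p => ENNReal.ofReal (d p)) =
      (volume : Measure (Config N)).withDensity fun x => ENNReal.ofReal (∏ k, d (x k)) := by
  have : SigmaFinite ((volume : Measure Plane).withDensity fun p => ENNReal.ofReal (d p)) :=
    SigmaFinite.withDensity_ofReal d
  refine Measure.pi_eq fun s hs => ?_
  rw [withDensity_apply _ (MeasurableSet.univ_pi hs), ← lintegral_indicator (MeasurableSet.univ_pi hs)]
  have e1 : ∀ x : Config N, (univ.pi s).indicator (fun x => ENNReal.ofReal (∏ k, d (x k))) x =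
      ENNReal.ofReal (∏ k, (s k).indicator d (x k)) := by
    intro x
    by_cases h : x ∈ univ.pi s
    · rw [indicator_of_mem h]
      congr 1
      refine Finset.prod_congr rfl fun k _ => ?_
      rw [indicator_of_mem (h k (mem_univ k))]
    · rw [indicator_of_notMem h]
      have : ∃ k, x k ∉ s k := by
        by_contra! h'
        exact h fun k _ => h' k
      obtain ⟨k, hk⟩ := this
      rw [Finset.prod_eq_zero (Finset.mem_univ k) (indicator_of_notMem hk _), ENNReal.ofReal_zero]
  simp only [e1]
  have h0 : ∀ k p, 0 ≤ (s k).indicator d p := fun k p => indicator_nonneg (fun p _ => hd0 p) p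
  have hI : ∀ k, Integrable ((s k).indicator d) := fun k => hi.indicator (hs k)
  have hI2 : Integrable (fun x : Config N => ∏ k, (s k).indicator d (x k)) volume :=
    Integrable.fintype_prod hI
  rw [← ofReal_integral_eq_lintegral_ofReal hI2
    (ae_of_all _ fun x => Finset.prod_nonneg fun k _ => h0 k _),
    integral_fintype_prod_volume_eq_prod (fun k => (s k).indicator d),
    ENNReal.ofReal_prod_of_nonneg fun k _ => integral_nonneg (h0 k)]
  refine Finset.prod_congr rfl fun k _ => ?_
  rw [ofReal_integral_eq_lintegral_ofReal (hI k) (ae_of_all _ (h0 k)), withDensity_apply _ (hs k),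
    ← lintegral_indicator (hs k)]
  congr 1; ext p
  by_cases h : p ∈ s k <;> simp [h]

lemma dy_sq_sum {ι : Type} [DecidableEq ι] (A : Finset ι) (r : ι → ℝ) :
    (∑ k ∈ A, r k) ^ 2 = ∑ k ∈ A, (r k ^ 2 + ∑ l ∈ A.erase k, r k * r l) := by
  rw [sq, Finset.sum_mul_sum]
  refine Finset.sum_congr rfl fun k hk => ?_
  rw [← Finset.add_sum_erase _ _ hk, sq]

lemma dyZ_main {N : ℕ} (ν : Measure Plane) [IsProbabilityMeasure ν]
    (w : Plane → ℝ) (hwc : Continuous w) (hw : ∀ v, 0 ≤ w v ∧ w v ≤ 1)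
    (hn : ∀ v, w (-v) = w v) (δ : ℝ) (hδ0 : 0 ≤ δ) (hδ1 : N * δ < 1)
    (hδ : ∀ y, ∫⁻ t, ENNReal.ofReal (1 - w (t - y) ^ 4) ∂ν ≤ ENNReal.ofReal δ)
    (r : Plane → ℝ) (hr : Measurable r) (hr0 : ∀ v, 0 ≤ r v) (hrn : ∀ v, r (-v) = r v)
    (C K : ℝ) (hC0 : 0 ≤ C) (hK0 : 0 ≤ K)
    (hC : ∫⁻ x, (∫⁻ y, ENNReal.ofReal (r (x - y) ^ 2) ∂ν) ∂ν ≤ ENNReal.ofReal C)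
    (hK : ∀ y, ∫⁻ x, ENNReal.ofReal (r (x - y)) ∂ν ≤ ENNReal.ofReal K) (j : Fin N) :
    ∫⁻ x : Config N, ENNReal.ofReal (dyg w (Finset.univ.erase j) x ^ 2 *
      (∑ k ∈ Finset.univ.erase j, r (x j - x k)) ^ 2) ∂(Measure.pi fun _ => ν) ≤
    ENNReal.ofReal (((N - 1) * C / (1 - N * δ) ^ 2 + (N - 1) * (N - 2) * K ^ 2 / (1 - N * δ) ^ 3) *
      (dyZ ν w (Finset.univ : Finset (Fin N))).toReal) := by
  classical
  set c := 1 - N * δ with hc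
  have hc0 : 0 < c := by linarith
  set Z : Finset (Fin N) → ℝ := fun A => (dyZ ν w A).toReal with hZ
  have hZf : ∀ A, dyZ ν w A = ENNReal.ofReal (Z A) := fun A =>
    (ENNReal.ofReal_toReal (ne_top_of_le_ne_top ENNReal.one_ne_top (dyZ_le_one ν w hw A))).symm
  have hZ0 : ∀ A, 0 ≤ Z A := fun A => ENNReal.toReal_nonneg
  have hZe : ∀ (A : Finset (Fin N)) (i : Fin N), i ∈ A → Z (A.erase i) ≤ Z A / c := by
    intro A i hi
    have := dyZ_insert ν w hwc hw hn δ hδ0 hδ (A.erase i) i (by simp)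
    rw [Finset.insert_erase hi, hZf, hZf, ← hc, ← ENNReal.ofReal_mul hc0.le,
      ENNReal.ofReal_le_ofReal_iff (hZ0 _)] at this
    rw [le_div_iff₀ hc0]
    linarith
  have hgm := dyg_meas w hwc (Finset.univ.erase j)
  have hgc := (dyg_continuous w hwc (Finset.univ.erase j)).measurable
  have e1 : ∀ x : Config N, ENNReal.ofReal (dyg w (Finset.univ.erase j) x ^ 2 *
      (∑ k ∈ Finset.univ.erase j, r (x j - x k)) ^ 2) =
      ∑ k ∈ Finset.univ.erase j,
        (ENNReal.ofReal (dyg w (Finset.univ.erase j) x ^ 2) * ENNReal.ofReal (r (x j - x k) ^ 2) +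
        ∑ l ∈ (Finset.univ.erase j).erase k, ENNReal.ofReal (dyg w (Finset.univ.erase j) x ^ 2) *
          (ENNReal.ofReal (r (x j - x k)) * ENNReal.ofReal (r (x j - x l)))) := by
    intro x
    rw [dy_sq_sum, ENNReal.ofReal_mul (sq_nonneg _), ENNReal.ofReal_sum_of_nonneg, Finset.mul_sum]
    · refine Finset.sum_congr rfl fun k _ => ?_
      rw [ENNReal.ofReal_add (sq_nonneg _) (Finset.sum_nonneg fun l _ => mul_nonneg (hr0 _) (hr0 _)),
        mul_add, ENNReal.ofReal_sum_of_nonneg (fun l _ => mul_nonneg (hr0 _) (hr0 _)), Finset.mul_sum]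
      congr 1
      refine Finset.sum_congr rfl fun l _ => ?_
      rw [ENNReal.ofReal_mul (hr0 _)]
    · exact fun k _ => add_nonneg (sq_nonneg _) (Finset.sum_nonneg fun l _ => mul_nonneg (hr0 _) (hr0 _))
  simp only [e1]
  rw [lintegral_finsetSum _ (by fun_prop)]
  have hk : ∀ k ∈ Finset.univ.erase j, ∫⁻ x : Config N,
        (ENNReal.ofReal (dyg w (Finset.univ.erase j) x ^ 2) * ENNReal.ofReal (r (x j - x k) ^ 2) +
        ∑ l ∈ (Finset.univ.erase j).erase k, ENNReal.ofReal (dyg w (Finset.univ.erase j) x ^ 2) *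
          (ENNReal.ofReal (r (x j - x k)) * ENNReal.ofReal (r (x j - x l))))
          ∂(Measure.pi fun _ => ν) ≤
      ENNReal.ofReal ((C / c ^ 2 + (N - 2) * K ^ 2 / c ^ 3) * Z Finset.univ) := by
    intro k hk
    have hkj : k ≠ j := (Finset.mem_erase.1 hk).1
    have z1 : Z (Finset.univ.erase j) ≤ Z Finset.univ / c := hZe _ _ (Finset.mem_univ _)
    have z2 : Z ((Finset.univ.erase j).erase k) ≤ Z Finset.univ / c ^ 2 := by
      refine (hZe _ _ hk).trans ?_
      rw [sq, ← div_div]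
      gcongr
    rw [lintegral_add_left (by fun_prop), lintegral_finsetSum _ (by fun_prop)]
    have a1 := dyZ_diag ν w hwc hw hn (fun v => ENNReal.ofReal (r v ^ 2)) (by fun_prop) _ hC j k hkj.symm
    have a2 : ∀ l ∈ (Finset.univ.erase j).erase k,
        ∫⁻ x : Config N, ENNReal.ofReal (dyg w (Finset.univ.erase j) x ^ 2) *
          (ENNReal.ofReal (r (x j - x k)) * ENNReal.ofReal (r (x j - x l)))
          ∂(Measure.pi fun _ => ν) ≤ ENNReal.ofReal (K ^ 2 * (Z Finset.univ / c ^ 3)) := by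
      intro l hl
      have hlk : l ≠ k := (Finset.mem_erase.1 hl).1
      have hlj : l ≠ j := (Finset.mem_erase.1 (Finset.mem_erase.1 hl).2).1
      refine (dyZ_offdiag ν w hwc hw hn (fun v => ENNReal.ofReal (r v)) (by fun_prop)
        (fun v => by rw [hrn]) _ hK j k l hkj.symm hlj.symm hlk.symm).trans ?_
      rw [hZf, ← ENNReal.ofReal_pow hK0, ← ENNReal.ofReal_mul (by positivity)]
      apply ENNReal.ofReal_le_ofReal
      gcongr
      refine (hZe _ _ hl).trans ?_
      rw [pow_succ, ← div_div]
      gcongr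
    have hcard : (((Finset.univ.erase j).erase k).card : ℝ) = N - 2 := by
      rw [Finset.cast_card_erase_of_mem hk, Finset.cast_card_erase_of_mem (Finset.mem_univ _)]
      simp; ring
    have a3 : (0:ℝ) ≤ N - 2 := by rw [← hcard]; exact Nat.cast_nonneg _
    have a4 := hZ0 Finset.univ
    calc _ ≤ ENNReal.ofReal C * ENNReal.ofReal (Z ((Finset.univ.erase j).erase k)) +
          ∑ l ∈ (Finset.univ.erase j).erase k, ENNReal.ofReal (K ^ 2 * (Z Finset.univ / c ^ 3)) := by
          rw [← hZf]
          exact add_le_add a1 (Finset.sum_le_sum a2)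
      _ ≤ ENNReal.ofReal (C * (Z Finset.univ / c ^ 2)) +
          ENNReal.ofReal ((N - 2) * (K ^ 2 * (Z Finset.univ / c ^ 3))) := by
          rw [← ENNReal.ofReal_mul hC0]
          refine add_le_add ?_ (le_of_eq ?_)
          · apply ENNReal.ofReal_le_ofReal
            gcongr
          · rw [Finset.sum_const, nsmul_eq_mul, ← hcard, ENNReal.ofReal_mul (Nat.cast_nonneg _),
              ENNReal.ofReal_natCast]
      _ = _ := by
          rw [← ENNReal.ofReal_add (by positivity) (by positivity)]
          congr 1
          ring
  refine (Finset.sum_le_sum hk).trans (le_of_eq ?_)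
  have hcard : ((Finset.univ.erase j).card : ℝ) = N - 1 := by
    rw [Finset.cast_card_erase_of_mem (Finset.mem_univ _)]
    simp
  rw [Finset.sum_const, nsmul_eq_mul, ← ENNReal.ofReal_natCast, ← ENNReal.ofReal_mul (Nat.cast_nonneg _),
    hcard]
  congr 1
  ring

lemma dy_E3 (N : ℕ) (β η : ℝ) (hβ : 0 < β) (hη : 0 < η) (hηβ : η ≤ β / 10) (hη1 : η ≤ 1 / 100)
    (hβN : N * (8 * β) < 1)
    (φ : Plane → ℝ) (hφ : Continuous φ) (K : Set Plane) (hK : IsCompact K) (hKQ : K ⊆ Q0)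
    (hφK : ∀ p, p ∉ K → φ p = 0) (hφ2 : ∀ p, 0 ≤ φ p ∧ φ p ≤ 2)
    (m : ℝ) (hm : m = ∫ p, φ p ^ 2) (hm1 : 1 - 8 * η ≤ m) (hφ4 : ∫ p, φ p ^ 4 ≤ 9 / 4)
    (w : Plane → ℝ) (hwc : Continuous w) (hw : ∀ v, 0 ≤ w v ∧ w v ≤ 1)
    (hn : ∀ v, w (-v) = w v)
    (hwδ : ∀ v, v ≠ 0 → 1 - w v ^ 4 ≤ β * (2.3 + 0.4 / √(dyq v)) + 8 * η) :
    ∃ Z : ℝ, m ^ N * (1 - N * (8 * β)) ^ N ≤ Z ∧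
      ∫⁻ x : Config N, ENNReal.ofReal (dyg w Finset.univ x ^ 2 * (∏ k, φ (x k)) ^ 2) =
        ENNReal.ofReal Z ∧
      ∀ j : Fin N, ∫⁻ x : Config N, ENNReal.ofReal ((dyg w (Finset.univ.erase j) x ^ 2 *
        (∑ k ∈ Finset.univ.erase j, dyrho β (x j - x k)) ^ 2) * (∏ k, φ (x k)) ^ 2) ≤
        ENNReal.ofReal (((N - 1) * (9 * π / (4 * β * m ^ 2)) / (1 - N * (8 * β)) ^ 2 +
          (N - 1) * (N - 2) * 12 ^ 2 / (1 - N * (8 * β)) ^ 3) * Z) := by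
  have hm0 : 0.92 ≤ m := by linarith
  have hmp : 0 < m := by linarith
  set d : Plane → ℝ := fun p => φ p ^ 2 / m with hd
  have hdm : Measurable d := by
    have := hφ.measurable
    fun_prop
  have hd0 : ∀ p, 0 ≤ d p := fun p => by positivity
  have hcs : ∀ n : ℕ, n ≠ 0 → Integrable (fun p => φ p ^ n) := by
    intro n hn0
    apply (hφ.pow n).integrable_of_hasCompactSupport
    apply HasCompactSupport.intro hK
    intro p hp
    simp [hφK p hp, hn0]
  have hdI : Integrable d := (hcs 2 two_ne_zero).div_const m
  have hd1 : ∫⁻ p, ENNReal.ofReal (d p) = 1 := by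
    rw [← ofReal_integral_eq_lintegral_ofReal hdI (ae_of_all _ hd0), hd, integral_div, ← hm,
      div_self hmp.ne', ENNReal.ofReal_one]
  set ν : Measure Plane := volume.withDensity fun p => ENNReal.ofReal (d p) with hν
  have hνp : IsProbabilityMeasure ν := by
    refine ⟨?_⟩
    rw [hν, withDensity_apply _ MeasurableSet.univ, Measure.restrict_univ, hd1]
  have hνi : ∀ F : Plane → ENNReal, Measurable F → ∫⁻ p, F p ∂ν = ∫⁻ p, F p * ENNReal.ofReal (d p) := by
    intro F hF
    rw [hν, lintegral_withDensity_eq_lintegral_mul _ (by fun_prop) hF]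
    congr 1; ext p
    simp [mul_comm]
  have hdq := dyq_measurable
  have hP1 : ∀ y, ∫⁻ x, ENNReal.ofReal (1 / √(dyq (x - y))) ∂ν ≤ ENNReal.ofReal 12 := by
    intro y
    rw [hνi _ (by fun_prop)]
    refine (dy_P1 d hdm (4 / m) ?_ (by positivity) hd1 y).trans ?_
    · intro p
      simp only [hd]
      gcongr
      nlinarith [hφ2 p]
    · apply ENNReal.ofReal_le_ofReal
      have h1 : 4 / m ≤ 5 := by
        rw [div_le_iff₀ hmp]; linarith
      have := pi_lt_d2
      have := pi_pos
      nlinarith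
  have hδ : ∀ y, ∫⁻ t, ENNReal.ofReal (1 - w (t - y) ^ 4) ∂ν ≤ ENNReal.ofReal (8 * β) := by
    intro y
    have hae : ∀ᵐ t ∂ν, t ≠ y := by
      have : ∀ᵐ t ∂(volume : Measure Plane), t ≠ y := by
        rw [ae_iff]
        simp
      exact (withDensity_absolutelyContinuous _ _).ae_le this
    calc _ ≤ ∫⁻ t, (ENNReal.ofReal (2.3 * β + 8 * η) +
            ENNReal.ofReal (0.4 * β) * ENNReal.ofReal (1 / √(dyq (t - y)))) ∂ν := by
          apply lintegral_mono_ae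
          filter_upwards [hae] with t ht
          rw [← ENNReal.ofReal_mul (by positivity), ← ENNReal.ofReal_add (by positivity) (by positivity)]
          apply ENNReal.ofReal_le_ofReal
          refine (hwδ _ (sub_ne_zero.2 ht)).trans (le_of_eq ?_)
          ring
      _ = ENNReal.ofReal (2.3 * β + 8 * η) +
            ENNReal.ofReal (0.4 * β) * ∫⁻ t, ENNReal.ofReal (1 / √(dyq (t - y))) ∂ν := by
          rw [lintegral_add_left (by fun_prop), lintegral_const_mul _ (by fun_prop)]
          simp
      _ ≤ ENNReal.ofReal (2.3 * β + 8 * η) + ENNReal.ofReal (0.4 * β) * ENNReal.ofReal 12 := by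
          gcongr
          exact hP1 y
      _ ≤ _ := by
          rw [← ENNReal.ofReal_mul (by positivity), ← ENNReal.ofReal_add (by positivity) (by positivity)]
          apply ENNReal.ofReal_le_ofReal
          linarith
  have hrm := dyrho_measurable hβ
  have hrn : ∀ v, dyrho β (-v) = dyrho β v := by
    intro v
    simp [dyrho, dys, dyu, dyq_neg]
  have hK' : ∀ y, ∫⁻ x, ENNReal.ofReal (dyrho β (x - y)) ∂ν ≤ ENNReal.ofReal 12 := by
    intro y
    refine (lintegral_mono fun x => ?_).trans (hP1 y)
    apply ENNReal.ofReal_le_ofReal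
    unfold dyrho
    gcongr
    exact dys_le_one hβ _
  have hC : ∫⁻ x, (∫⁻ y, ENNReal.ofReal (dyrho β (x - y) ^ 2) ∂ν) ∂ν ≤
      ENNReal.ofReal (9 * π / (4 * β * m ^ 2)) := by
    have hmm : Measurable fun x => ∫⁻ y, ENNReal.ofReal (dyrho β (x - y) ^ 2) ∂ν :=
      Measurable.lintegral_prod_right' (f := fun z : Plane × Plane =>
        ENNReal.ofReal (dyrho β (z.1 - z.2) ^ 2)) (by fun_prop)
    rw [hνi _ hmm]
    have : ∀ x, ∫⁻ y, ENNReal.ofReal (dyrho β (x - y) ^ 2) ∂ν =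
      ∫⁻ y, ENNReal.ofReal (dyrho β (x - y) ^ 2) * ENNReal.ofReal (d y) := fun x => hνi _ (by fun_prop)
    simp only [this]
    refine (dy_P2 β hβ d hdm hd0 ?_).trans ?_
    · intro p hp
      have : φ p = 0 := hφK p fun h => hp (hKQ h)
      simp [hd, this]
    · have e : ∀ p, d p ^ 2 = φ p ^ 4 / m ^ 2 := fun p => by simp only [hd]; ring
      simp only [e]
      rw [← ofReal_integral_eq_lintegral_ofReal ((hcs 4 (by norm_num)).div_const _)
        (ae_of_all _ fun p => by positivity), integral_div,
        ← ENNReal.ofReal_mul (by positivity)]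
      apply ENNReal.ofReal_le_ofReal
      calc (∫ p, φ p ^ 4) / m ^ 2 * (π / β) ≤ 9 / 4 / m ^ 2 * (π / β) := by gcongr
        _ = _ := by field_simp
  have hM : ∀ F : Config N → ℝ, Measurable F → (∀ x, 0 ≤ F x) →
      ∫⁻ x, ENNReal.ofReal (F x * (∏ k, φ (x k)) ^ 2) =
        ENNReal.ofReal (m ^ N) * ∫⁻ x, ENNReal.ofReal (F x) ∂(Measure.pi fun _ => ν) := by
    intro F hF hF0
    have hWm : Measurable fun x : Config N => ENNReal.ofReal (∏ k, d (x k)) := by fun_prop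
    rw [hν, dy_pi_withDensity d hdm hd0 hdI,
      lintegral_withDensity_eq_lintegral_mul _ hWm (by fun_prop),
      ← lintegral_const_mul _ (by fun_prop)]
    congr 1; ext x
    rw [Pi.mul_apply, ← ENNReal.ofReal_mul (Finset.prod_nonneg fun k _ => hd0 _),
      ← ENNReal.ofReal_mul (by positivity)]
    congr 1
    simp only [hd]
    rw [Finset.prod_div_distrib, Finset.prod_pow]
    simp only [Finset.prod_const, Finset.card_univ, Fintype.card_fin]
    field_simp
  have hgm : ∀ A : Finset (Fin N), Measurable (dyg w A) := fun A => (dyg_continuous w hwc A).measurable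
  have hZt : dyZ ν w (Finset.univ : Finset (Fin N)) =
      ENNReal.ofReal (dyZ ν w (Finset.univ : Finset (Fin N))).toReal :=
    (ENNReal.ofReal_toReal (ne_top_of_le_ne_top ENNReal.one_ne_top (dyZ_le_one ν w hw _))).symm
  refine ⟨m ^ N * (dyZ ν w (Finset.univ : Finset (Fin N))).toReal, ?_, ?_, ?_⟩
  · gcongr
    have := dyZ_lower ν w hwc hw hn (8 * β) (by positivity) hδ (Finset.univ : Finset (Fin N))
    rw [Finset.card_univ, Fintype.card_fin, hZt, ← ENNReal.ofReal_pow (by linarith),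
      ENNReal.ofReal_le_ofReal_iff ENNReal.toReal_nonneg] at this
    exact this
  · rw [hM (fun x => dyg w Finset.univ x ^ 2) ((hgm _).pow_const 2) (fun x => sq_nonneg _),
      ENNReal.ofReal_mul (by positivity), ← hZt]
    rfl
  · intro j
    have hmm : Measurable fun x : Config N => (dyg w (Finset.univ.erase j) x ^ 2 *
        (∑ k ∈ Finset.univ.erase j, dyrho β (x j - x k)) ^ 2) := by
      have := hgm (Finset.univ.erase j)
      fun_prop
    rw [hM _ hmm (fun x => by positivity)]
    refine (mul_le_mul_right (dyZ_main ν w hwc hw hn (8 * β) (by positivity) hβN hδ (dyrho β) hrm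
      (dyrho_nonneg β) hrn _ 12 (by positivity) (by norm_num) hC hK' j) _).trans (le_of_eq ?_)
    rw [← ENNReal.ofReal_mul (by positivity)]
    congr 1
    ring

lemma dy_triangle {ι : Type} (A : Finset ι) (c : ι → ℝ) (v : ι → Plane) (b : ι → ℝ)
    (hb : ∀ k ∈ A, |c k| * √(dyq (v k)) ≤ b k) :
    (∑ k ∈ A, c k * (v k).1) ^ 2 + (∑ k ∈ A, c k * (v k).2) ^ 2 ≤ (∑ k ∈ A, b k) ^ 2 := by
  set z : ι → ℂ := fun k => ⟨c k * (v k).1, c k * (v k).2⟩ with hz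
  have h1 : ‖∑ k ∈ A, z k‖ ≤ ∑ k ∈ A, b k := by
    refine (norm_sum_le _ _).trans (Finset.sum_le_sum fun k hk => le_trans (le_of_eq ?_) (hb k hk))
    rw [Complex.norm_def, Complex.normSq_apply, ← sqrt_sq_eq_abs, ← sqrt_mul (sq_nonneg _)]
    congr 1
    simp only [hz, dyq]
    ring
  have h2 : ‖∑ k ∈ A, z k‖ ^ 2 = (∑ k ∈ A, c k * (v k).1) ^ 2 + (∑ k ∈ A, c k * (v k).2) ^ 2 := by
    rw [Complex.sq_norm, Complex.normSq_apply, Complex.re_sum, Complex.im_sum]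
    simp only [hz]
    ring
  rw [← h2]
  gcongr

lemma dy_F {N : ℕ} (α β : ℝ) (hα : 0 ≤ α) (hαβ : α ≤ β) (w : Plane → ℝ)
    (hwd : ContDiff ℝ (⊤ : ℕ∞) w)
    (hn : ∀ v, w (-v) = w v) (hw : ∀ v, 0 ≤ w v ∧ w v ≤ 1)
    (hws : ∀ v, w v ^ 2 ≤ dys β v)
    (hwf : ∀ v, ∃ l, |l| ≤ β * dys β v / dyq v ∧
      ∀ e : Plane, fderiv ℝ (fun z => w z ^ 2) v e = l * (v.1 * e.1 + v.2 * e.2))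
    (j : Fin N) (x : Config N) :
    (fderiv ℝ (dyg w Finset.univ) x (Pi.single j (1, 0))) ^ 2 +
    (fderiv ℝ (dyg w Finset.univ) x (Pi.single j (0, 1))) ^ 2 +
    ((α * (abPot N j x).1) ^ 2 + (α * (abPot N j x).2) ^ 2) * dyg w Finset.univ x ^ 2 ≤
    2 * β ^ 2 * (dyg w (Finset.univ.erase j) x ^ 2 *
      (∑ k ∈ Finset.univ.erase j, dyrho β (x j - x k)) ^ 2) := by
  classical
  set B := Finset.univ.erase j with hB
  have hjB : j ∉ B := by simp [hB]
  have hu : (Finset.univ : Finset (Fin N)) = insert j B := by simp [hB]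
  choose l hl1 hl2 using hwf
  have hW1 : ∀ v, w v ^ 2 ≤ 1 := fun v => pow_le_one₀ (hw v).1 (hw v).2
  have hW : Differentiable ℝ fun z => w z ^ 2 := (hwd.pow 2).differentiable (by simp)
  have hd : Differentiable ℝ (dyg w (Finset.univ : Finset (Fin N))) :=
    (dyg_contDiff w hwd _).differentiable (by simp)
  have hfd : ∀ e : Plane, fderiv ℝ (dyg w Finset.univ) x (Pi.single j e) =
      dyg w B x * ∑ k ∈ B, (∏ i ∈ B.erase k, w (x j - x i) ^ 2) *
        (l (x j - x k) * ((x j - x k).1 * e.1 + (x j - x k).2 * e.2)) := by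
    intro e
    rw [← (hd x).lineDeriv_eq_fderiv, lineDeriv]
    have e1 : (fun t : ℝ => dyg w Finset.univ (x + t • (Pi.single j e : Config N))) =
        fun t : ℝ => dyg w B x * ∏ k ∈ B, w (x j - x k + t • e) ^ 2 := by
      ext t
      have e2 : x + t • (Pi.single j e : Config N) = Function.update x j (x j + t • e) := by
        ext i : 1
        by_cases h : i = j
        · subst h; simp
        · simp [h]
      rw [e2, hu, dyg_insert w hn B j hjB, dyg_update w B j hjB]
      congr 1
      refine Finset.prod_congr rfl fun k hk => ?_
      have h1 : k ≠ j := fun h => hjB (h ▸ hk)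
      rw [Function.update_of_ne h1, Function.update_self]
      congr 2
      abel
    rw [e1]
    have h2 : ∀ k ∈ B, HasDerivAt (fun t : ℝ => w (x j - x k + t • e) ^ 2)
        (l (x j - x k) * ((x j - x k).1 * e.1 + (x j - x k).2 * e.2)) 0 := by
      intro k _
      have h3 : HasDerivAt (fun t : ℝ => x j - x k + t • e) e 0 := by
        have := ((hasDerivAt_id (0:ℝ)).smul_const e).const_add (x j - x k)
        simpa using this
      have h4 := (hW (x j - x k + (0:ℝ) • e)).hasFDerivAt.comp_hasDerivAt (0:ℝ) h3
      rw [zero_smul, add_zero, hl2] at h4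
      exact h4
    have h3 := (HasDerivAt.fun_finsetProd h2).const_mul (dyg w B x)
    rw [h3.deriv]
    simp
  have hprod : ∀ (A : Finset (Fin N)), 0 ≤ ∏ i ∈ A, w (x j - x i) ^ 2 ∧
      ∏ i ∈ A, w (x j - x i) ^ 2 ≤ 1 := fun A =>
    ⟨Finset.prod_nonneg fun _ _ => sq_nonneg _,
      Finset.prod_le_one (fun _ _ => sq_nonneg _) fun _ _ => hW1 _⟩
  have hrho : ∀ v, β * dys β v / dyq v * √(dyq v) = β * dyrho β v := by
    intro v
    unfold dyrho
    by_cases h : dyq v = 0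
    · simp [h]
    · have h1 : 0 < dyq v := lt_of_le_of_ne (dyq_nonneg v) (Ne.symm h)
      have h2 : 0 < √(dyq v) := sqrt_pos.2 h1
      field_simp
      rw [sq_sqrt h1.le]
  have t1 := dy_triangle B (fun k => (∏ i ∈ B.erase k, w (x j - x i) ^ 2) * l (x j - x k))
    (fun k => x j - x k) (fun k => β * dyrho β (x j - x k)) (by
      intro k _
      rw [← hrho]
      gcongr
      rw [abs_mul, abs_of_nonneg (hprod _).1]
      calc _ ≤ 1 * |l (x j - x k)| := by gcongr; exact (hprod _).2
        _ ≤ _ := by rw [one_mul]; exact hl1 _)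
  have t2 := dy_triangle B (fun k => (∏ i ∈ B, w (x j - x i) ^ 2) * α / dyq (x j - x k))
    (fun k => (-(x j - x k).2, (x j - x k).1)) (fun k => β * dyrho β (x j - x k)) (by
      intro k hk
      rw [← hrho, show dyq (-(x j - x k).2, (x j - x k).1) = dyq (x j - x k) by
        simp only [dyq]; ring]
      gcongr
      have h0 := dyq_nonneg (x j - x k)
      rw [abs_of_nonneg (div_nonneg (mul_nonneg (hprod _).1 hα) h0)]
      refine div_le_div_of_nonneg_right ?_ h0
      rw [mul_comm]
      have h5 : ∏ i ∈ B, w (x j - x i) ^ 2 ≤ dys β (x j - x k) := by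
        rw [← Finset.mul_prod_erase _ _ hk]
        calc _ ≤ w (x j - x k) ^ 2 * 1 := by gcongr; exact (hprod _).2
          _ ≤ _ := by rw [mul_one]; exact hws _
      exact mul_le_mul hαβ h5 (hprod _).1 (hα.trans hαβ))
  rw [← Finset.mul_sum] at t1 t2
  have g0 : dyg w Finset.univ x = dyg w B x * ∏ k ∈ B, w (x j - x k) ^ 2 := by
    rw [hu, dyg_insert w hn B j hjB]
  have p1 : α * (abPot N j x).1 * ∏ k ∈ B, w (x j - x k) ^ 2 =
      ∑ k ∈ B, (∏ i ∈ B, w (x j - x i) ^ 2) * α / dyq (x j - x k) * -(x j - x k).2 := by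
    rw [abPot, Prod.fst_sum, Finset.mul_sum, Finset.sum_mul]
    refine Finset.sum_congr rfl fun k _ => ?_
    simp only [perpInv, dyq]
    ring
  have p2 : α * (abPot N j x).2 * ∏ k ∈ B, w (x j - x k) ^ 2 =
      ∑ k ∈ B, (∏ i ∈ B, w (x j - x i) ^ 2) * α / dyq (x j - x k) * (x j - x k).1 := by
    rw [abPot, Prod.snd_sum, Finset.mul_sum, Finset.sum_mul]
    refine Finset.sum_congr rfl fun k _ => ?_
    simp only [perpInv, dyq]
    ring
  dsimp only at t1 t2
  rw [← p1, ← p2] at t2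
  rw [hfd, hfd, g0]
  have s1 : ∀ k, (∏ i ∈ B.erase k, w (x j - x i) ^ 2) *
        (l (x j - x k) * ((x j - x k).1 * (1:ℝ) + (x j - x k).2 * 0)) =
      (∏ i ∈ B.erase k, w (x j - x i) ^ 2) * l (x j - x k) * (x j - x k).1 := fun k => by ring
  have s2 : ∀ k, (∏ i ∈ B.erase k, w (x j - x i) ^ 2) *
        (l (x j - x k) * ((x j - x k).1 * (0:ℝ) + (x j - x k).2 * 1)) =
      (∏ i ∈ B.erase k, w (x j - x i) ^ 2) * l (x j - x k) * (x j - x k).2 := fun k => by ring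
  simp only [s1, s2]
  have G0 := sq_nonneg (dyg w B x)
  have := mul_le_mul_of_nonneg_left (add_le_add t1 t2) G0
  linarith

lemma dy_cross {N : ℕ} (g f : Config N → ℝ) (hg : ContDiff ℝ (⊤ : ℕ∞) g)
    (hf : ContDiff ℝ (⊤ : ℕ∞) f) (hfc : HasCompactSupport f) (v : Config N) :
    Integrable (fun x => (fderiv ℝ (fun z => g z * f z) x v) ^ 2 - (fderiv ℝ g x v) ^ 2 * f x ^ 2) ∧
    Integrable (fun x => g x ^ 2 * (f x * fderiv ℝ (fun z => fderiv ℝ f z v) x v)) ∧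
    ∫ x, ((fderiv ℝ (fun z => g z * f z) x v) ^ 2 - (fderiv ℝ g x v) ^ 2 * f x ^ 2) =
      - ∫ x, g x ^ 2 * (f x * fderiv ℝ (fun z => fderiv ℝ f z v) x v) := by
  have hgd : Differentiable ℝ g := hg.differentiable (by simp)
  have hfd : Differentiable ℝ f := hf.differentiable (by simp)
  have hf1 : ContDiff ℝ (⊤ : ℕ∞) fun z => fderiv ℝ f z v :=
    (hf.fderiv_right (m := (⊤ : ℕ∞)) (by simp)).clm_apply contDiff_const
  have hf2 : ContDiff ℝ (⊤ : ℕ∞) fun x => fderiv ℝ (fun z => fderiv ℝ f z v) x v :=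
    (hf1.fderiv_right (m := (⊤ : ℕ∞)) (by simp)).clm_apply contDiff_const
  have hg1 : ContDiff ℝ (⊤ : ℕ∞) fun z => fderiv ℝ g z v :=
    (hg.fderiv_right (m := (⊤ : ℕ∞)) (by simp)).clm_apply contDiff_const
  set h : Config N → ℝ := fun x => g x ^ 2 * f x with hh
  have hhs : ContDiff ℝ (⊤ : ℕ∞) h := (hg.pow 2).mul hf
  have hh1 : ContDiff ℝ (⊤ : ℕ∞) fun z => fderiv ℝ h z v :=
    (hhs.fderiv_right (m := (⊤ : ℕ∞)) (by simp)).clm_apply contDiff_const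
  have hfc1 : HasCompactSupport fun z => fderiv ℝ f z v := hfc.fderiv_apply ℝ v
  have hfc2 := hfc1.fderiv_apply ℝ v
  have hhd : Differentiable ℝ h := hhs.differentiable (by simp)
  have eh : ∀ x, fderiv ℝ h x v = 2 * g x * fderiv ℝ g x v * f x + g x ^ 2 * fderiv ℝ f x v := by
    intro x
    have := (((hgd x).hasFDerivAt.pow 2).mul (hfd x).hasFDerivAt).fderiv
    rw [show fderiv ℝ h x = _ from this]
    simp
    ring
  have egf : ∀ x, fderiv ℝ (fun z => g z * f z) x v = g x * fderiv ℝ f x v + f x * fderiv ℝ g x v := by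
    intro x
    have := ((hgd x).hasFDerivAt.mul (hfd x).hasFDerivAt).fderiv
    rw [show fderiv ℝ (fun z => g z * f z) x = _ from this]
    simp
  have ec : ∀ x, (fderiv ℝ (fun z => g z * f z) x v) ^ 2 - (fderiv ℝ g x v) ^ 2 * f x ^ 2 =
      fderiv ℝ f x v * fderiv ℝ h x v := by
    intro x
    rw [eh, egf]; ring
  have i1 : Integrable fun x => fderiv ℝ f x v * fderiv ℝ h x v :=
    (hf1.continuous.mul hh1.continuous).integrable_of_hasCompactSupport hfc1.mul_right
  have i2 : Integrable fun x => fderiv ℝ (fun z => fderiv ℝ f z v) x v * h x :=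
    (hf2.continuous.mul hhs.continuous).integrable_of_hasCompactSupport hfc2.mul_right
  have i3 : Integrable fun x => fderiv ℝ f x v * h x :=
    (hf1.continuous.mul hhs.continuous).integrable_of_hasCompactSupport hfc1.mul_right
  have e3 : ∀ x, g x ^ 2 * (f x * fderiv ℝ (fun z => fderiv ℝ f z v) x v) =
      fderiv ℝ (fun z => fderiv ℝ f z v) x v * h x := by
    intro x; simp only [hh]; ring
  simp only [ec, e3]
  refine ⟨i1, i2, ?_⟩
  exact integral_mul_fderiv_eq_neg_fderiv_mul_of_integrable i2 i1 i3
    (fun x _ => hf1.differentiable (by simp) x) (fun x _ => hhd x)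

lemma dy_slice {N : ℕ} (j : Fin N) (C : Config N → ℝ) (hC : ∀ x t, C (Function.update x j t) = C x)
    (hCd : Differentiable ℝ C) (φ : Plane → ℝ) (hφ : Differentiable ℝ φ) (x : Config N) (e : Plane) :
    fderiv ℝ (fun z : Config N => C z * φ (z j)) x (Pi.single j e) = C x * fderiv ℝ φ (x j) e := by
  have hd : Differentiable ℝ (fun z : Config N => C z * φ (z j)) := by fun_prop
  rw [← (hd x).lineDeriv_eq_fderiv, lineDeriv]
  have e1 : (fun t : ℝ => (fun z : Config N => C z * φ (z j)) (x + t • (Pi.single j e : Config N))) =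
      fun t : ℝ => C x * φ (x j + t • e) := by
    ext t
    have e2 : x + t • (Pi.single j e : Config N) = Function.update x j (x j + t • e) := by
      ext i : 1
      by_cases h : i = j
      · subst h; simp
      · simp [h]
    dsimp only
    rw [e2, hC, Function.update_self]
  rw [e1]
  have h3 : HasDerivAt (fun t : ℝ => x j + t • e) e 0 := by
    have := ((hasDerivAt_id (0:ℝ)).smul_const e).const_add (x j)
    simpa using this
  have h4 := (hφ (x j + (0:ℝ) • e)).hasFDerivAt.comp_hasDerivAt (0:ℝ) h3
  rw [zero_smul, add_zero] at h4
  exact (h4.const_mul (C x)).deriv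

lemma dy_fnn {N : ℕ} (η : ℝ) (hη : 0 < η) (φ : Plane → ℝ) (hφ : ContDiff ℝ (⊤ : ℕ∞) φ)
    (hφ2 : ∀ p, 0 ≤ φ p ∧ φ p ≤ 2)
    (hφe : ∀ p b, -(φ p * fderiv ℝ (fun z => fderiv ℝ φ z (dyE b)) p (dyE b)) ≤
      π ^ 2 * (φ p ^ 2 + 4 * η)) (j : Fin N) (b : Bool) (x : Config N) :
    -((∏ k, φ (x k)) * fderiv ℝ (fun z => fderiv ℝ (fun y : Config N => ∏ k, φ (y k)) z
      (Pi.single j (dyE b))) x (Pi.single j (dyE b))) ≤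
      π ^ 2 * ((∏ k, φ (x k)) ^ 2 + 4 * η * 4 ^ N) := by
  set C : Config N → ℝ := fun x => ∏ k ∈ Finset.univ.erase j, φ (x k) with hC
  have hCu : ∀ x t, C (Function.update x j t) = C x := by
    intro x t
    refine Finset.prod_congr rfl fun k hk => ?_
    rw [Function.update_of_ne (Finset.mem_erase.1 hk).1]
  have hCs : ContDiff ℝ (⊤ : ℕ∞) C := by
    refine contDiff_prod fun k _ => ?_
    fun_prop
  have hCd : Differentiable ℝ C := hCs.differentiable (by simp)
  have hf : ∀ y : Config N, ∏ k, φ (y k) = C y * φ (y j) := by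
    intro y
    rw [← Finset.prod_erase_mul _ _ (Finset.mem_univ j)]
  have hφd : Differentiable ℝ φ := hφ.differentiable (by simp)
  have hφ1 : ContDiff ℝ (⊤ : ℕ∞) fun z => fderiv ℝ φ z (dyE b) :=
    (hφ.fderiv_right (m := (⊤ : ℕ∞)) (by simp)).clm_apply contDiff_const
  simp only [hf]
  simp only [dy_slice j C hCu hCd φ hφd]
  rw [dy_slice j C hCu hCd _ (hφ1.differentiable (by simp))]
  have hC4 : C x ^ 2 ≤ 4 ^ N := by
    have h1 : C x ≤ 2 ^ N := by
      calc C x ≤ ∏ k ∈ Finset.univ.erase j, (2:ℝ) :=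
            Finset.prod_le_prod (fun k _ => (hφ2 _).1) (fun k _ => (hφ2 _).2)
        _ = 2 ^ (Finset.univ.erase j).card := by rw [Finset.prod_const]
        _ ≤ 2 ^ N := by
          apply pow_le_pow_right₀ (by norm_num)
          simpa using Finset.card_le_univ (Finset.univ.erase j)
    have h0 : 0 ≤ C x := Finset.prod_nonneg fun k _ => (hφ2 _).1
    calc C x ^ 2 ≤ (2 ^ N) ^ 2 := by gcongr
      _ = 4 ^ N := by rw [← pow_mul, mul_comm, pow_mul]; norm_num
  have h1 := mul_le_mul_of_nonneg_left (hφe (x j) b) (sq_nonneg (C x))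
  have h2 : π ^ 2 * (4 * η) * C x ^ 2 ≤ π ^ 2 * (4 * η) * 4 ^ N := by gcongr
  linarith

lemma dy_DSq {N : ℕ} (α : ℝ) (j : Fin N) (F : Config N → ℝ) (x : Config N)
    (hF : DifferentiableAt ℝ F x) :
    DSq N α j (fun y => (F y : ℂ)) x = (fderiv ℝ F x (Pi.single j (1, 0))) ^ 2 +
      (fderiv ℝ F x (Pi.single j (0, 1))) ^ 2 +
      ((α * (abPot N j x).1) ^ 2 + (α * (abPot N j x).2) ^ 2) * F x ^ 2 := by
  have h1 : ∀ v, pder N j v (fun y => (F y : ℂ)) x = ((fderiv ℝ F x (Pi.single j v) : ℝ) : ℂ) := by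
    intro v
    have := (Complex.ofRealCLM.hasFDerivAt.comp x hF.hasFDerivAt).fderiv
    rw [pder, show fderiv ℝ (fun y => (F y : ℂ)) x = _ from this]
    simp
  have h2 : ∀ a b c : ℝ, ‖-Complex.I * (a : ℂ) + ((b : ℝ) : ℂ) * (c : ℂ)‖ ^ 2 = a ^ 2 + b ^ 2 * c ^ 2 := by
    intro a b c
    rw [Complex.sq_norm, Complex.normSq_apply]
    simp
    ring
  unfold DSq DOp
  simp only [h1]
  rw [h2, h2]
  ring

lemma dy_cube_meas (N : ℕ) : MeasurableSet (cube N Q0) :=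
  MeasurableSet.univ_pi fun _ => dy_Q0_open.measurableSet

lemma dy_cube_vol (N : ℕ) : volume (cube N Q0) = 1 := by
  unfold cube
  rw [volume_pi_pi]
  simp [dy_Q0_vol]

lemma dy_f_supp {N : ℕ} (φ : Plane → ℝ) (K : Set Plane) (hφK : ∀ p, p ∉ K → φ p = 0)
    (x : Config N) (hx : x ∉ univ.pi fun _ : Fin N => K) : ∏ k, φ (x k) = 0 := by
  have : ∃ k, x k ∉ K := by
    by_contra! h'
    exact hx fun k _ => h' k
  obtain ⟨k, hk⟩ := this
  exact Finset.prod_eq_zero (Finset.mem_univ k) (hφK _ hk)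

lemma dy_G {N : ℕ} (α β η R Z : ℝ) (hα : 0 ≤ α) (hαβ : α ≤ β) (hβ : 0 < β) (hη : 0 < η)
    (hR : 0 ≤ R) (hZ : 0 ≤ Z)
    (φ : Plane → ℝ) (hφ : ContDiff ℝ (⊤ : ℕ∞) φ) (K : Set Plane) (hK : IsCompact K) (hKQ : K ⊆ Q0)
    (hφK : ∀ p, p ∉ K → φ p = 0) (hφ2 : ∀ p, 0 ≤ φ p ∧ φ p ≤ 2)
    (hφe : ∀ p b, -(φ p * fderiv ℝ (fun z => fderiv ℝ φ z (dyE b)) p (dyE b)) ≤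
      π ^ 2 * (φ p ^ 2 + 4 * η))
    (w : Plane → ℝ) (hwd : ContDiff ℝ (⊤ : ℕ∞) w)
    (hn : ∀ v, w (-v) = w v) (hw : ∀ v, 0 ≤ w v ∧ w v ≤ 1)
    (hws : ∀ v, w v ^ 2 ≤ dys β v)
    (hwf : ∀ v, ∃ l, |l| ≤ β * dys β v / dyq v ∧
      ∀ e : Plane, fderiv ℝ (fun z => w z ^ 2) v e = l * (v.1 * e.1 + v.2 * e.2))
    (hZI : ∫⁻ x : Config N, ENNReal.ofReal (dyg w Finset.univ x ^ 2 * (∏ k, φ (x k)) ^ 2) =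
        ENNReal.ofReal Z)
    (j : Fin N)
    (hRI : ∫⁻ x : Config N, ENNReal.ofReal ((dyg w (Finset.univ.erase j) x ^ 2 *
        (∑ k ∈ Finset.univ.erase j, dyrho β (x j - x k)) ^ 2) * (∏ k, φ (x k)) ^ 2) ≤
        ENNReal.ofReal R) :
    ∫ x in cube N Q0, DSq N α j (fun y => ((dyg w Finset.univ y * ∏ k, φ (y k) : ℝ) : ℂ)) x ≤
      2 * β ^ 2 * R + 2 * π ^ 2 * Z + 8 * π ^ 2 * η * 4 ^ N := by
  set g : Config N → ℝ := dyg w Finset.univ with hg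
  set f : Config N → ℝ := fun x => ∏ k, φ (x k) with hf
  have hgs : ContDiff ℝ (⊤ : ℕ∞) g := dyg_contDiff w hwd _
  have hfs : ContDiff ℝ (⊤ : ℕ∞) f := contDiff_prod fun k _ => by fun_prop
  have hgd : Differentiable ℝ g := hgs.differentiable (by simp)
  have hfd : Differentiable ℝ f := hfs.differentiable (by simp)
  have hKc : IsCompact (univ.pi fun _ : Fin N => K) := isCompact_univ_pi fun _ => hK
  have hf0 : ∀ x, x ∉ (univ.pi fun _ : Fin N => K) → f x = 0 := fun x hx => dy_f_supp φ K hφK x hx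
  have hKcube : (univ.pi fun _ : Fin N => K) ⊆ cube N Q0 := fun x hx k hk => hKQ (hx k hk)
  have hfc : HasCompactSupport f := HasCompactSupport.intro hKc hf0
  have hFd : Differentiable ℝ (fun y => g y * f y) := hgd.mul hfd
  set T : Config N → ℝ := fun x => (fderiv ℝ g x (Pi.single j (1, 0))) ^ 2 +
    (fderiv ℝ g x (Pi.single j (0, 1))) ^ 2 +
    ((α * (abPot N j x).1) ^ 2 + (α * (abPot N j x).2) ^ 2) * g x ^ 2 with hT
  have hTle : ∀ x, T x ≤ _ := fun x => dy_F α β hα hαβ w hwd hn hw hws hwf j x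
  have hT0 : ∀ x, 0 ≤ T x := fun x => by positivity
  obtain ⟨a1, a2, a3⟩ := dy_cross g f hgs hfs hfc (Pi.single j (dyE true))
  obtain ⟨b1, b2, b3⟩ := dy_cross g f hgs hfs hfc (Pi.single j (dyE false))
  have dT : dyE true = (1, 0) := by simp [dyE]
  have dF : dyE false = (0, 1) := by simp [dyE]
  -- the main identity
  have hDS : ∀ x, DSq N α j (fun y => ((g y * f y : ℝ) : ℂ)) x = T x * f x ^ 2 +
      (((fderiv ℝ (fun z => g z * f z) x (Pi.single j (dyE true))) ^ 2 -
        (fderiv ℝ g x (Pi.single j (dyE true))) ^ 2 * f x ^ 2) +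
      ((fderiv ℝ (fun z => g z * f z) x (Pi.single j (dyE false))) ^ 2 -
        (fderiv ℝ g x (Pi.single j (dyE false))) ^ 2 * f x ^ 2)) := by
    intro x
    rw [dy_DSq α j (fun y => g y * f y) x (hFd x), dT, dF]
    simp only [hT]
    ring
  -- vanishing outside
  have hzero : ∀ x ∉ cube N Q0, DSq N α j (fun y => ((g y * f y : ℝ) : ℂ)) x = 0 := by
    intro x hx
    have hx' : x ∉ (univ.pi fun _ : Fin N => K) := fun h => hx (hKcube h)
    have h1 : (fun z => g z * f z) =ᶠ[𝓝 x] fun _ => 0 := by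
      filter_upwards [hKc.isClosed.isOpen_compl.mem_nhds hx'] with z hz
      rw [hf0 z hz, mul_zero]
    rw [dy_DSq α j (fun y => g y * f y) x (hFd x), h1.fderiv_eq]
    simp [hf0 x hx']
  rw [setIntegral_eq_integral_of_forall_compl_eq_zero hzero]
  -- the T part
  have hTm : Measurable T := by
    have m1 : ∀ v : Config N, Measurable fun x => fderiv ℝ g x v := fun v =>
      ((hgs.fderiv_right (m := (⊤ : ℕ∞)) (by simp)).clm_apply contDiff_const).continuous.measurable
    have m2 := hgs.continuous.measurable
    have m3 : Measurable (abPot N j) := by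
      unfold abPot
      refine Finset.measurable_sum _ fun k _ => ?_
      unfold perpInv
      fun_prop
    have m4 := m1 (Pi.single j (1, 0))
    have m5 := m1 (Pi.single j (0, 1))
    simp only [hT]
    fun_prop
  have hfm := hfs.continuous.measurable
  have hTfm : Measurable fun x => T x * f x ^ 2 := by fun_prop
  have hTL : ∫⁻ x, ENNReal.ofReal (T x * f x ^ 2) ≤ ENNReal.ofReal (2 * β ^ 2 * R) := by
    rw [ENNReal.ofReal_mul (by positivity)]
    refine le_trans ?_ (mul_le_mul_right hRI _)
    rw [← lintegral_const_mul']
    · apply lintegral_mono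
      intro x
      dsimp only
      rw [← ENNReal.ofReal_mul (by positivity)]
      apply ENNReal.ofReal_le_ofReal
      rw [← mul_assoc]
      gcongr
      exact hTle x
    · exact ENNReal.ofReal_ne_top
  have hTf0 : 0 ≤ᵐ[volume] fun x => T x * f x ^ 2 := ae_of_all _ fun x => mul_nonneg (hT0 x) (sq_nonneg _)
  have hTI : Integrable fun x => T x * f x ^ 2 :=
    (lintegral_ofReal_ne_top_iff_integrable hTfm.aestronglyMeasurable hTf0).1
      (ne_top_of_le_ne_top ENNReal.ofReal_ne_top hTL)
  have hTle2 : ∫ x, T x * f x ^ 2 ≤ 2 * β ^ 2 * R := by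
    rw [integral_eq_lintegral_of_nonneg_ae hTf0 hTfm.aestronglyMeasurable]
    refine ENNReal.toReal_le_of_le_ofReal (by positivity) hTL
  -- norm part
  have hgfI : Integrable fun x => g x ^ 2 * f x ^ 2 := by
    apply ((hgs.pow 2).mul (hfs.pow 2)).continuous.integrable_of_hasCompactSupport
    apply HasCompactSupport.intro hKc
    intro x hx
    simp [hf0 x hx]
  have hZe : ∫ x, g x ^ 2 * f x ^ 2 = Z := by
    rw [integral_eq_lintegral_of_nonneg_ae (ae_of_all _ fun x => by positivity)
      hgfI.aestronglyMeasurable, hZI, ENNReal.toReal_ofReal hZ]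
  -- cross part
  have hcr : ∀ b : Bool, Integrable (fun x => g x ^ 2 *
      (f x * fderiv ℝ (fun z => fderiv ℝ f z (Pi.single j (dyE b))) x (Pi.single j (dyE b)))) →
      -∫ x, g x ^ 2 * (f x * fderiv ℝ (fun z => fderiv ℝ f z (Pi.single j (dyE b))) x
        (Pi.single j (dyE b))) ≤ π ^ 2 * Z + 4 * π ^ 2 * η * 4 ^ N := by
    intro b hb
    rw [← integral_neg]
    have hcI : Integrable ((cube N Q0).indicator fun _ => 4 * π ^ 2 * η * 4 ^ N) := by
      rw [integrable_indicator_iff (dy_cube_meas N)]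
      apply integrableOn_const
      · rw [dy_cube_vol]; simp
      · exact enorm_ne_top
    have hce : ∫ x, (cube N Q0).indicator (fun _ => 4 * π ^ 2 * η * 4 ^ N) x = 4 * π ^ 2 * η * 4 ^ N := by
      rw [integral_indicator (dy_cube_meas N), setIntegral_const, measureReal_def, dy_cube_vol]
      simp
    calc _ ≤ ∫ x, (π ^ 2 * (g x ^ 2 * f x ^ 2) +
          (cube N Q0).indicator (fun _ => 4 * π ^ 2 * η * 4 ^ N) x) := by
          apply integral_mono hb.neg ((hgfI.const_mul _).add hcI)
          intro x
          simp only [Pi.neg_apply, Pi.add_apply]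
          by_cases hx : x ∈ cube N Q0
          · rw [indicator_of_mem hx]
            have h1 := dy_fnn η hη φ hφ hφ2 hφe j b x
            have h2 := mul_le_mul_of_nonneg_left h1 (sq_nonneg (g x))
            have h3 : g x ^ 2 ≤ 1 := pow_le_one₀ (dyg_nonneg w (fun v => (hw v).1) _ _)
              (dyg_le_one w hw _ _)
            have h4 : g x ^ 2 * (4 * π ^ 2 * η * 4 ^ N) ≤ 1 * (4 * π ^ 2 * η * 4 ^ N) := by gcongr
            simp only [hf] at h2 ⊢
            linarith
          · rw [indicator_of_notMem hx, hf0 x fun h => hx (hKcube h)]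
            simp
      _ = _ := by
          rw [integral_add (hgfI.const_mul _) hcI, integral_const_mul, hZe, hce]
  simp only [hDS]
  have e1 := integral_add hTI (a1.add b1)
  simp only [Pi.add_apply] at e1
  rw [e1, integral_add a1 b1, a3, b3]
  have := hcr true a2
  have := hcr false b2
  linarith

lemma dy_DSq_nonneg (N : ℕ) (α : ℝ) (j : Fin N) (Ψ : Config N → ℂ) (x : Config N) :
    0 ≤ DSq N α j Ψ x := by
  unfold DSq; positivity

lemma dy_kinE_nonneg (N : ℕ) (α : ℝ) (Ω : Set Plane) (Ψ : Config N → ℂ) : 0 ≤ kinE N α Ω Ψ :=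
  Finset.sum_nonneg fun _ _ => integral_nonneg fun _ => dy_DSq_nonneg _ _ _ _ _

lemma dy_ED_le (N : ℕ) (α : ℝ) (Ψ : Config N → ℂ) (hA : Admissible N Ψ)
    (hc : IsCompact (tsupport Ψ)) (hs : tsupport Ψ ⊆ cube N Q0) (hZ : 0 < normSq N Q0 Ψ) :
    ED N α ≤ kinE N α Q0 Ψ / normSq N Q0 Ψ := by
  set Z := normSq N Q0 Ψ with hZd
  set c : ℝ := 1 / √Z with hcd
  have hc2 : c ^ 2 = 1 / Z := by rw [hcd, div_pow, sq_sqrt hZ.le, one_pow]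
  have hsub : tsupport (fun x => (c : ℂ) * Ψ x) ⊆ tsupport Ψ := by
    apply closure_mono
    intro x hx h
    apply hx
    simp only [h, mul_zero]
  unfold ED dirichletE
  refine csInf_le ⟨0, ?_⟩ ⟨fun x => (c : ℂ) * Ψ x, ⟨?_, ?_, ?_⟩, ?_, ?_, ?_, ?_⟩
  · rintro E ⟨Φ, -, -, -, -, rfl⟩
    exact dy_kinE_nonneg _ _ _ _
  · exact contDiff_const.mul hA.smooth
  · intro σ x
    rw [hA.symm]
  · obtain ⟨U, h1, h2, h3⟩ := hA.vanishes
    exact ⟨U, h1, h2, fun x hx => by rw [h3 x hx, mul_zero]⟩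
  · exact hc.of_isClosed_subset (isClosed_tsupport _) hsub
  · exact hsub.trans hs
  · unfold normSq
    simp only [norm_mul, mul_pow]
    rw [integral_const_mul]
    change _ * Z = 1
    rw [Complex.norm_real, norm_eq_abs, sq_abs, hc2, one_div, inv_mul_cancel₀ hZ.ne']
  · unfold kinE
    rw [Finset.sum_div]
    refine Finset.sum_congr rfl fun j _ => ?_
    have hd : Differentiable ℝ Ψ := hA.smooth.differentiable (by simp)
    have hp : ∀ v x, pder N j v (fun x => (c : ℂ) * Ψ x) x = c * pder N j v Ψ x := by
      intro v x
      unfold pder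
      have := ((hd x).hasFDerivAt.const_mul (c : ℂ)).fderiv
      rw [show fderiv ℝ (fun x => (c : ℂ) * Ψ x) x = _ from this]
      simp
    have hD : ∀ x, DSq N α j (fun x => (c : ℂ) * Ψ x) x = c ^ 2 * DSq N α j Ψ x := by
      intro x
      have hcn : ‖(c : ℂ)‖ ^ 2 = c ^ 2 := by rw [Complex.norm_real, norm_eq_abs, sq_abs]
      have e : ∀ a b : ℂ, ‖-Complex.I * (c * a) + b * (c * Ψ x)‖ ^ 2 =
          c ^ 2 * ‖-Complex.I * a + b * Ψ x‖ ^ 2 := by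
        intro a b
        rw [← hcn, ← mul_pow, ← norm_mul]
        congr 2
        ring
      unfold DSq DOp
      simp only [hp]
      rw [e, e]
      ring
    simp only [hD]
    rw [integral_const_mul, hc2]
    ring

lemma dy_admissible {N : ℕ} (φ : Plane → ℝ) (hφ : ContDiff ℝ (⊤ : ℕ∞) φ)
    (w : Plane → ℝ) (hwd : ContDiff ℝ (⊤ : ℕ∞) w)
    (hU : ∃ U : Set Plane, IsOpen U ∧ 0 ∈ U ∧ ∀ v ∈ U, w v = 0) :
    Admissible N (fun y => ((dyg w Finset.univ y * ∏ k, φ (y k) : ℝ) : ℂ)) := by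
  refine ⟨?_, ?_, ?_⟩
  · have h1 : ContDiff ℝ (⊤ : ℕ∞) fun y : Config N => dyg w Finset.univ y * ∏ k, φ (y k) :=
      (dyg_contDiff w hwd _).mul (contDiff_prod fun k _ => by fun_prop)
    exact Complex.ofRealCLM.contDiff.comp h1
  · intro σ x
    have h1 : ∏ k, φ ((x ∘ σ) k) = ∏ k, φ (x k) := Equiv.prod_comp σ fun k => φ (x k)
    have h2 : dyg w Finset.univ (x ∘ σ) = dyg w Finset.univ x := by
      unfold dyg
      rw [← Equiv.prod_comp σ fun a => ∏ b ∈ Finset.univ.erase a, w (x a - x b)]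
      refine Finset.prod_congr rfl fun a _ => ?_
      refine Finset.prod_equiv σ (by simp) ?_
      intro i _
      rfl
    rw [h1, h2]
  · obtain ⟨U, hUo, hU0, hUw⟩ := hU
    refine ⟨⋃ j : Fin N, ⋃ k : Fin N, ⋃ _ : j ≠ k, (fun x : Config N => x j - x k) ⁻¹' U, ?_, ?_, ?_⟩
    · refine isOpen_iUnion fun j => isOpen_iUnion fun k => isOpen_iUnion fun _ => ?_
      exact hUo.preimage (by fun_prop)
    · rintro x ⟨j, k, hjk, h⟩
      simp only [mem_iUnion]
      refine ⟨j, k, hjk, ?_⟩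
      simp only [mem_preimage, h, sub_self]
      exact hU0
    · intro x hx
      simp only [mem_iUnion] at hx
      obtain ⟨j, k, hjk, h⟩ := hx
      have : dyg w Finset.univ x = 0 := by
        unfold dyg
        apply Finset.prod_eq_zero (Finset.mem_univ j)
        apply Finset.prod_eq_zero (Finset.mem_erase.2 ⟨hjk.symm, Finset.mem_univ k⟩)
        exact hUw _ h
      rw [this, zero_mul, Complex.ofReal_zero]

lemma dy_arith (N β η m c S : ℝ) (hN1 : 1 ≤ N) (hβ : 0 < β) (hη : 0 < η) (hηβ : η ≤ β / 10)
    (hβN : 8 * π * β * N < 1) (hpi : 3 < π) (hm1 : 1 - 8 * η ≤ m) (hm92 : 0.92 ≤ m)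
    (hc : c = 1 - N * (8 * β)) (hc23 : 2 / 3 < c) (hNN : 0 ≤ (N - 1) * (N - 2)) (hN0 : 0 ≤ N - 1)
    (hS : S = (N - 1) * (9 * π / (4 * β * m ^ 2)) / c ^ 2 + (N - 1) * (N - 2) * 12 ^ 2 / c ^ 3) :
    N * (2 * β ^ 2 * S) ≤ (9 * π / 2) * N * (N - 1) * β *
        (1 + (4 / 3) ^ 3 * 20 * π * (N - 2) * β) / (1 - 8 * π * β * N) ^ 2 := by
  set κ := 1 - 8 * π * β * (N : ℝ) with hκ
  have hκ0 : 0 < κ := by linarith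
  have hκ1 : κ ≤ 1 := by
    have : 0 < 8 * π * β * N := by positivity
    linarith
  have hcp : 0 < c := by linarith
  have hmp : 0 < m := by linarith
  have hκmc : κ ≤ m * c := by
    have h3 : (1 - 8 * η) * c ≤ m * c := by gcongr
    have h4 : 1 - 8 * η - N * (8 * β) ≤ (1 - 8 * η) * c := by
      rw [hc]
      have : 0 ≤ 8 * η * (N * (8 * β)) := by positivity
      linarith
    have h5 : 8 * η + N * (8 * β) ≤ 8 * π * β * N := by
      have u1 : 3 * (β * N) ≤ π * (β * N) := by gcongr
      have u2 : β * 1 ≤ β * N := by gcongr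
      linarith
    linarith
  have q1 : (N - 1) * (9 * π / (4 * β * m ^ 2)) / c ^ 2 ≤ (N - 1) * (9 * π / (4 * β)) / κ ^ 2 := by
    have : (N - 1) * (9 * π / (4 * β * m ^ 2)) / c ^ 2 = (N - 1) * (9 * π / (4 * β)) / (m * c) ^ 2 := by
      field_simp
    rw [this]
    gcongr
  have q2 : (N - 1) * (N - 2) * 12 ^ 2 / c ^ 3 ≤ (N - 1) * (N - 2) * 486 / κ ^ 2 := by
    have r1 : (8:ℝ) / 27 ≤ c ^ 3 := by
      calc (8:ℝ) / 27 = (2 / 3) ^ 3 := by norm_num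
        _ ≤ _ := by gcongr
    have r2 : (12:ℝ) ^ 2 / c ^ 3 ≤ 486 := by
      rw [div_le_iff₀ (by positivity)]
      linarith
    have r3 : (486:ℝ) ≤ 486 / κ ^ 2 := by
      rw [le_div_iff₀ (by positivity)]
      have : κ ^ 2 ≤ 1 := pow_le_one₀ hκ0.le hκ1
      linarith
    rw [mul_div_assoc, mul_div_assoc]
    exact mul_le_mul_of_nonneg_left (r2.trans r3) hNN
  have q3 : N * (2 * β ^ 2 * S) ≤ N * (2 * β ^ 2 * ((N - 1) * (9 * π / (4 * β)) / κ ^ 2 +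
      (N - 1) * (N - 2) * 486 / κ ^ 2)) := by
    rw [hS]
    gcongr
  refine q3.trans ?_
  have q4 : N * (2 * β ^ 2 * ((N - 1) * (9 * π / (4 * β)) / κ ^ 2 +
      (N - 1) * (N - 2) * 486 / κ ^ 2)) = (9 * π / 2 * N * (N - 1) * β +
      972 * (N * β ^ 2 * ((N - 1) * (N - 2)))) / κ ^ 2 := by
    field_simp
    ring
  rw [q4]
  gcongr ?_ / _
  have q5 : 972 ≤ 9 * π / 2 * ((4 / 3) ^ 3 * 20 * π) := by nlinarith [mul_self_nonneg (π - 3)]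
  have q6 : 0 ≤ N * β ^ 2 * (((N:ℝ) - 1) * (N - 2)) := mul_nonneg (by positivity) hNN
  have := mul_le_mul_of_nonneg_right q5 q6
  linarith

lemma dy_final1 (N : ℕ) (hN : 1 ≤ N) (α β η : ℝ) (hα : 0 ≤ α) (hαβ : α ≤ β) (hβ : 0 < β)
    (hη : 0 < η) (hηβ : η ≤ β / 10) (hη1 : η ≤ 1 / 100) (hβN : 8 * π * β * N < 1) :
    ED N α ≤ 2 * π ^ 2 * (N : ℝ) +
      (9 * π / 2) * (N : ℝ) * ((N : ℝ) - 1) * β *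
        (1 + (4 / 3) ^ 3 * 20 * π * ((N : ℝ) - 2) * β) / (1 - 8 * π * β * (N : ℝ)) ^ 2 +
      8 * π ^ 2 * N * 8 ^ N * η := by
  have hN1 : (1:ℝ) ≤ N := by exact_mod_cast hN
  have hpi := pi_gt_three
  obtain ⟨φ, hφ, ⟨K, hK, hKQ, hφK⟩, hφ2, hm1, hφ4, hφe⟩ := dy_exists_phi η hη
  obtain ⟨w, hwd, hn, hw, hws, hU, hwf, hwδ⟩ := dy_exists_w β η hβ hη
  set m := ∫ p, φ p ^ 2 with hm
  have hbN : 0 < β * N := by positivity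
  set c := 1 - N * (8 * β) with hc
  have hc23 : 2 / 3 < c := by nlinarith
  have hc1 : c ≤ 1 := by rw [hc]; linarith
  obtain ⟨Z, hZl, hZI, hRI⟩ := dy_E3 N β η hβ hη hηβ hη1 (by linarith) φ hφ.continuous K hK hKQ hφK hφ2
    m hm hm1 hφ4 w hwd.continuous hw hn hwδ
  rw [← hc] at hZl hRI
  have hm92 : 0.92 ≤ m := by linarith
  have hmc : 1 / 2 ≤ m * c := by nlinarith
  have hZl2 : (1 / 2) ^ N ≤ Z := by
    refine le_trans ?_ hZl
    rw [← mul_pow]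
    gcongr
  have hZ0 : 0 < Z := lt_of_lt_of_le (by positivity) hZl2
  have hNN : (0:ℝ) ≤ (N - 1) * (N - 2) := by
    rcases Nat.lt_or_ge N 2 with h | h
    · have : N = 1 := by omega
      subst this; simp
    · have : (2:ℝ) ≤ N := by exact_mod_cast h
      exact mul_nonneg (by linarith) (by linarith)
  have hN0 : (0:ℝ) ≤ N - 1 := by linarith
  set S : ℝ := (N - 1) * (9 * π / (4 * β * m ^ 2)) / c ^ 2 + (N - 1) * (N - 2) * 12 ^ 2 / c ^ 3 with hS
  have hS0 : 0 ≤ S := by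
    have : 0 < c := by linarith
    rw [hS]
    apply add_nonneg <;> positivity
  set Ψ : Config N → ℂ := fun y => ((dyg w Finset.univ y * ∏ k, φ (y k) : ℝ) : ℂ) with hΨ
  have hA : Admissible N Ψ := dy_admissible φ hφ w hwd hU
  have hKc : IsCompact (univ.pi fun _ : Fin N => K) := isCompact_univ_pi fun _ => hK
  have hKcube : (univ.pi fun _ : Fin N => K) ⊆ cube N Q0 := fun x hx k hk => hKQ (hx k hk)
  have hΨ0 : ∀ x, x ∉ (univ.pi fun _ : Fin N => K) → Ψ x = 0 := by
    intro x hx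
    simp only [hΨ]
    rw [dy_f_supp φ K hφK x hx, mul_zero, Complex.ofReal_zero]
  have hts : tsupport Ψ ⊆ univ.pi fun _ : Fin N => K := by
    apply closure_minimal _ hKc.isClosed
    intro x hx
    by_contra h
    exact hx (hΨ0 x h)
  have hnorm : normSq N Q0 Ψ = Z := by
    unfold normSq
    rw [setIntegral_eq_integral_of_forall_compl_eq_zero]
    · have e : ∀ x, ‖Ψ x‖ ^ 2 = dyg w Finset.univ x ^ 2 * (∏ k, φ (x k)) ^ 2 := by
        intro x
        simp only [hΨ]
        rw [Complex.norm_real, norm_eq_abs, sq_abs, mul_pow]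
      simp only [e]
      have hcont : Continuous fun x : Config N => dyg w Finset.univ x ^ 2 * (∏ k, φ (x k)) ^ 2 := by
        have := dyg_continuous w hwd.continuous (Finset.univ : Finset (Fin N))
        have := hφ.continuous
        fun_prop
      rw [integral_eq_lintegral_of_nonneg_ae (ae_of_all _ fun x => by positivity)
        hcont.aestronglyMeasurable, hZI, ENNReal.toReal_ofReal hZ0.le]
    · intro x hx
      rw [hΨ0 x fun h => hx (hKcube h)]
      simp
  have hkin : kinE N α Q0 Ψ ≤ N * (2 * β ^ 2 * (S * Z) + 2 * π ^ 2 * Z + 8 * π ^ 2 * η * 4 ^ N) := by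
    unfold kinE
    calc _ ≤ ∑ j : Fin N, (2 * β ^ 2 * (S * Z) + 2 * π ^ 2 * Z + 8 * π ^ 2 * η * 4 ^ N) :=
          Finset.sum_le_sum fun j _ => dy_G α β η (S * Z) Z hα hαβ hβ hη (by positivity) hZ0.le
            φ hφ K hK hKQ hφK hφ2 hφe w hwd hn hw hws hwf hZI j (hRI j)
      _ = _ := by rw [Finset.sum_const, Finset.card_univ, Fintype.card_fin, nsmul_eq_mul]
  have hED := dy_ED_le N α Ψ hA (hKc.of_isClosed_subset (isClosed_tsupport _) hts) (hts.trans hKcube)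
    (by rw [hnorm]; exact hZ0)
  rw [hnorm] at hED
  have h1 : kinE N α Q0 Ψ / Z ≤ N * (2 * β ^ 2 * S + 2 * π ^ 2 + 8 * π ^ 2 * η * 8 ^ N) := by
    rw [div_le_iff₀ hZ0]
    refine hkin.trans ?_
    have h8 : (4:ℝ) ^ N ≤ 8 ^ N * Z := by
      calc (4:ℝ) ^ N = 8 ^ N * (1 / 2) ^ N := by rw [← mul_pow]; norm_num
        _ ≤ _ := by gcongr
    calc _ ≤ N * (2 * β ^ 2 * (S * Z) + 2 * π ^ 2 * Z + 8 * π ^ 2 * η * (8 ^ N * Z)) := by gcongr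
      _ = _ := by ring
  have h2 : N * (2 * β ^ 2 * S) ≤ (9 * π / 2) * (N : ℝ) * ((N : ℝ) - 1) * β *
        (1 + (4 / 3) ^ 3 * 20 * π * ((N : ℝ) - 2) * β) / (1 - 8 * π * β * (N : ℝ)) ^ 2 :=
    dy_arith N β η m c S hN1 hβ hη hηβ hβN hpi hm1 hm92 hc hc23 hNN hN0 hS
  calc ED N α ≤ _ := hED
    _ ≤ _ := h1
    _ ≤ _ := by linarith

lemma dy_final2 (N : ℕ) (hN : 1 ≤ N) (α β : ℝ) (hα : 0 ≤ α) (hαβ : α ≤ β) (hβ : 0 < β)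
    (hβN : 8 * π * β * N < 1) :
    ED N α ≤ 2 * π ^ 2 * (N : ℝ) +
      (9 * π / 2) * (N : ℝ) * ((N : ℝ) - 1) * β *
        (1 + (4 / 3) ^ 3 * 20 * π * ((N : ℝ) - 2) * β) / (1 - 8 * π * β * (N : ℝ)) ^ 2 := by
  apply le_of_forall_pos_le_add
  intro ε hε
  have hN1 : (1:ℝ) ≤ N := by exact_mod_cast hN
  set L : ℝ := 8 * π ^ 2 * N * 8 ^ N with hL
  have hL0 : 0 < L := by positivity
  set η := min (min (β / 10) (1 / 100)) (ε / L) with hη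
  have h0 : 0 < η := by positivity
  have h1 : η ≤ β / 10 := (min_le_left _ _).trans (min_le_left _ _)
  have h2 : η ≤ 1 / 100 := (min_le_left _ _).trans (min_le_right _ _)
  have h3 : η ≤ ε / L := min_le_right _ _
  refine (dy_final1 N hN α β η hα hαβ hβ h0 h1 h2 hβN).trans ?_
  gcongr
  rw [le_div_iff₀ hL0] at h3
  linarith

/-- Dyson-type upper bound, Dirichlet: for every `α ∈ [0,1]` and `N ≥ 1`
with `8παN < 1`,
`E^D_N(α) ≤ 2π²N + (9π/2) N(N−1) α (1 + (4/3)³ 20π(N−2)α)/(1−8παN)²`. -/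
theorem dyson_upper_bound_dirichlet (α : ℝ) (hα : α ∈ Set.Icc (0 : ℝ) 1)
    (N : ℕ) (hN : 1 ≤ N) (h : 8 * π * α * (N : ℝ) < 1) :
    ED N α ≤ 2 * π ^ 2 * (N : ℝ) +
      (9 * π / 2) * (N : ℝ) * ((N : ℝ) - 1) * α *
        (1 + (4 / 3) ^ 3 * 20 * π * ((N : ℝ) - 2) * α) / (1 - 8 * π * α * (N : ℝ)) ^ 2 := by
  set f : ℝ → ℝ := fun β => 2 * π ^ 2 * (N : ℝ) +
      (9 * π / 2) * (N : ℝ) * ((N : ℝ) - 1) * β *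
        (1 + (4 / 3) ^ 3 * 20 * π * ((N : ℝ) - 2) * β) / (1 - 8 * π * β * (N : ℝ)) ^ 2 with hf
  have hfc : ContinuousAt f α := by
    have : (1 - 8 * π * α * (N : ℝ)) ^ 2 ≠ 0 := pow_ne_zero 2 (by linarith)
    simp only [hf]
    fun_prop (disch := assumption)
  have hev : ∀ᶠ β in 𝓝[>] α, ED N α ≤ f β := by
    have hc : ContinuousAt (fun β : ℝ => 8 * π * β * (N : ℝ)) α := by fun_prop
    have h1 : ∀ᶠ β in 𝓝[>] α, 8 * π * β * (N : ℝ) < 1 :=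
      (hc.eventually_lt continuousAt_const h).filter_mono nhdsWithin_le_nhds
    filter_upwards [h1, self_mem_nhdsWithin] with β hb1 hb2
    have hb3 : α < β := hb2
    exact dy_final2 N hN α β hα.1 hb3.le (lt_of_le_of_lt hα.1 hb3) hb1
  exact ge_of_tendsto (hfc.tendsto.mono_left nhdsWithin_le_nhds) hev
end
end
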